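/- (Far-field expansion for point defects.) Let N = d, let p ≥ 0 and J ≥ 0 be integers, and let V ∈ C^K(ℝ^{d×ℛ}) with K ≥ J + 2 + max{0, ⌊(p−1)/d⌋} satisfy the point symmetry. Let C_{σρ} := ∂²V/∂g_σ∂g_ρ(0), so that H = δ²E(0), and assume H is stable and admits a lattice Green's function 𝒢. Let g : Λ → ℝ^{d×ℛ} have compact support and let ū ∈ 𝓗¹ satisfy δE(ū)[v] = ∑_{ℓ∈Λ}∑_{ρ∈ℛ} g_ρ(ℓ)·D_ρ v(ℓ) for all v ∈ 𝓗ᶜ. Then for any lattice basis 𝒮 there exist: a radius R > 0; functions u_i^C ∈ C^∞(ℝ^d∖B_R(0); ℝ^d) for d+1 ≤ i ≤ p (which can be chosen to solve the continuum corrector PDE hierarchy; extended by 0 on B_R(0)) satisfying |∇^j u_i^C(x)| ≤ C_{i,j}⟨x⟩^{2−d−i−j}(log⟨x⟩)^i for all j ∈ ℕ₀ and |x| ≥ R; and symmetric arrays b^{(i,k)} ∈ (ℝ^𝒮)^{⊙i} for 1 ≤ i ≤ p, 1 ≤ k ≤ d; such that the remainder r_{p+1} := ū − ∑_{i=d+1}^{p}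 u_i^C|_Λ − ∑_{i=1}^{p}∑_{k=1}^{d} b^{(i,k)} : D_𝒮^i 𝒢_k satisfies |D^j r_{p+1}(ℓ)| ≤ C⟨ℓ⟩^{1−d−j−p}(log⟨ℓ⟩)^{p+1} for all ℓ ∈ Λ and j = 1,…,J. -/

import Mathlib

noncomputable section

open scoped BigOperators
open MeasureTheory Filter Topology

namespace Defect

abbrev Vec (n : ℕ) : Type := Fin n → ℝ

/-- Euclidean norm of a vector in `ℝ^n`. -/
def enorm {n : ℕ} (v : Vec n) : ℝ := Real.sqrt (∑ i, (v i) ^ 2)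

/-- `⟨x⟩ := |x| + 2`. -/
def ang {n : ℕ} (v : Vec n) : ℝ := enorm v + 2

def dotV {n : ℕ} (x y : Vec n) : ℝ := ∑ i, x i * y i

/-- Matrix-vector product for a plain `Fin N → Fin N → ℝ` matrix. -/
def mulV {N : ℕ} (M : Fin N → Fin N → ℝ) (v : Vec N) : Vec N := fun i => ∑ j, M i j * v j

/-- Euclidean (Frobenius) norm of an `N × N` array. -/
def mnorm {N : ℕ} (M : Fin N → Fin N → ℝ) : ℝ := Real.sqrt (∑ i, ∑ j, (M i j) ^ 2)

/-- The lattice point `A z` for `z ∈ ℤ^d`. -/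
def latticePt (d : ℕ) (A : Matrix (Fin d) (Fin d) ℝ) (z : Fin d → ℤ) : Vec d :=
  fun i => ∑ j, A i j * (z j : ℝ)

/-- The Bravais lattice `Λ = A ℤ^d`. -/
def Lattice (d : ℕ) (A : Matrix (Fin d) (Fin d) ℝ) : Set (Vec d) :=
  Set.range (latticePt d A)

/-- First-order finite difference `D_ρ u (ℓ) = u(ℓ+ρ) - u(ℓ)`. -/
def D1 {d : ℕ} {M : Type} [AddCommGroup M] (ρ : Vec d) (u : Vec d → M) (ℓ : Vec d) : M :=
  u (ℓ + ρ) - u ℓ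

/-- Iterated finite difference `D_{ρ₁} ⋯ D_{ρ_j} u (ℓ)` (closed form). -/
def Dmulti {d : ℕ} {M : Type} [AddCommGroup M] [Module ℝ M] {j : ℕ}
    (ρs : Fin j → Vec d) (u : Vec d → M) (ℓ : Vec d) : M :=
  ∑ S : Finset (Fin j), ((-1 : ℝ) ^ (j - S.card)) • u (ℓ + ∑ i ∈ S, ρs i)

/-- `|Du(ℓ)|²`, the squared Euclidean norm of the stencil of first differences. -/
def Dnorm1Sq {d N : ℕ} (R : Finset (Vec d)) (u : Vec d → Vec N) (ℓ : Vec d) : ℝ :=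
  ∑ ρ ∈ R, (enorm (D1 ρ u ℓ)) ^ 2

/-- `|D^j u(ℓ)|`, the Euclidean norm of the array `(D_{ρ⃗} u(ℓ))_{ρ⃗ ∈ R^j}`. -/
def DnormJ {d N : ℕ} (R : Finset (Vec d)) (j : ℕ) (u : Vec d → Vec N) (ℓ : Vec d) : ℝ :=
  Real.sqrt (∑ ρs : Fin j → {x // x ∈ R},
    (enorm (Dmulti (fun i => (ρs i : Vec d)) u ℓ)) ^ 2)

/-- The linearized lattice operator
`H[u](ℓ) = ∑_{σ,ρ∈R} (C_{σρ} D_ρ u(ℓ-σ) - C_{σρ} D_ρ u(ℓ))`. -/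
def Hop (d N : ℕ) (R : Finset (Vec d)) (C : Vec d → Vec d → Fin N → Fin N → ℝ)
    (u : Vec d → Vec N) (ℓ : Vec d) : Vec N :=
  ∑ σ ∈ R, ∑ ρ ∈ R, (mulV (C σ ρ) (D1 ρ u (ℓ - σ)) - mulV (C σ ρ) (D1 ρ u ℓ))

/-- `u ∈ 𝓗¹`. -/
def InH1 {d N : ℕ} (A : Matrix (Fin d) (Fin d) ℝ) (R : Finset (Vec d))
    (u : Vec d → Vec N) : Prop :=
  Summable fun z : Fin d → ℤ => Dnorm1Sq R u (latticePt d A z)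

/-- `u ∈ 𝓗ᶜ` : the stencil `Du` has bounded support on the lattice. -/
def InHc {d N : ℕ} (A : Matrix (Fin d) (Fin d) ℝ) (R : Finset (Vec d))
    (u : Vec d → Vec N) : Prop :=
  ∃ rad : ℝ, ∀ z : Fin d → ℤ, rad ≤ enorm (latticePt d A z) →
    ∀ ρ ∈ R, D1 ρ u (latticePt d A z) = 0

/-- Stability of the lattice operator `H`. -/
def IsStable (d N : ℕ) (A : Matrix (Fin d) (Fin d) ℝ) (R : Finset (Vec d))
    (C : Vec d → Vec d → Fin N → Fin N → ℝ) : Prop :=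
  ∃ c₀ : ℝ, 0 < c₀ ∧ ∀ u : Vec d → Vec N, InHc A R u →
    c₀ * (∑' z : Fin d → ℤ, Dnorm1Sq R u (latticePt d A z)) ≤
      ∑' z : Fin d → ℤ, ∑ σ ∈ R, ∑ ρ ∈ R,
        dotV (D1 σ u (latticePt d A z)) (mulV (C σ ρ) (D1 ρ u (latticePt d A z)))

/-- `k`-th column of a matrix-valued function. -/
def col {d N : ℕ} (G : Vec d → Fin N → Fin N → ℝ) (k : Fin N) : Vec d → Vec N :=
  fun x i => G x i k

/-- `|D^j 𝒢(ℓ)|` for matrix-valued `𝒢`. -/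
def DnormJmat {d N : ℕ} (R : Finset (Vec d)) (j : ℕ)
    (G : Vec d → Fin N → Fin N → ℝ) (ℓ : Vec d) : ℝ :=
  Real.sqrt (∑ k : Fin N, (DnormJ R j (col G k) ℓ) ^ 2)

/-- `𝒢` is a lattice Green's function for `H`. -/
def IsLatticeGreen (d N : ℕ) (A : Matrix (Fin d) (Fin d) ℝ) (R : Finset (Vec d))
    (C : Vec d → Vec d → Fin N → Fin N → ℝ) (G : Vec d → Fin N → Fin N → ℝ) : Prop :=
  (∀ (k : Fin N) (z : Fin d → ℤ),
      Hop d N R C (col G k) (latticePt d A z) =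
        if latticePt d A z = 0 then Pi.single k 1 else 0) ∧
  (∀ j : ℕ, 1 ≤ j → ∃ cj : ℝ, ∀ z : Fin d → ℤ,
      DnormJmat R j G (latticePt d A z) ≤
        cj * ang (latticePt d A z) ^ ((2 : ℝ) - d - j))

/-- A symmetric array `b ∈ (ℝ^{Fin d})^{⊙ i}`. -/
def SymArr {d i : ℕ} (b : (Fin i → Fin d) → ℝ) : Prop :=
  ∀ (π : Equiv.Perm (Fin i)) (σv : Fin i → Fin d), b (σv ∘ π) = b σv

/-- `b : D_𝒮^i f`, a multipole term built from the basis `s`. -/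
def multipole (d N : ℕ) (s : Fin d → Vec d) (i : ℕ) (b : (Fin i → Fin d) → ℝ)
    (f : Vec d → Vec N) : Vec d → Vec N :=
  fun ℓ => ∑ σv : Fin i → Fin d, b σv • Dmulti (fun m => s (σv m)) f ℓ

/-- Iterated partial derivative `∂_{j₁} ⋯ ∂_{j_i} f (x)`. -/
def pderivMulti {d : ℕ} (i : ℕ) (js : Fin i → Fin d) (f : Vec d → ℝ) (x : Vec d) : ℝ :=
  iteratedFDeriv ℝ i f x (fun m => Pi.single (js m) (1 : ℝ))

/-- `a : ∇^i f (x)` for a tensor `a ∈ (ℝ^d)^{⊗ i}`. -/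
def aContract {d : ℕ} (i : ℕ) (a : (Fin i → Fin d) → ℝ) (f : Vec d → ℝ) (x : Vec d) : ℝ :=
  ∑ js : Fin i → Fin d, a js * pderivMulti i js f x

/-- Elementary tensor `σ⃗^⊗` as an array. -/
def tensorPow {d k : ℕ} (σs : Fin k → Vec d) : (Fin k → Fin d) → ℝ :=
  fun js => ∏ m, σs m (js m)

/-- Symmetric tensor product `σ⃗^⊙`. -/
def symTensor {d k : ℕ} (σs : Fin k → Vec d) : (Fin k → Fin d) → ℝ :=
  fun js => ((k.factorial : ℝ))⁻¹ * ∑ π : Equiv.Perm (Fin k), tensorPow (σs ∘ π) js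

/-- A symmetric tensor (array invariant under index permutations). -/
def SymTensor {d k : ℕ} (T : (Fin k → Fin d) → ℝ) : Prop :=
  ∀ (π : Equiv.Perm (Fin k)) (js : Fin k → Fin d), T (js ∘ π) = T js

/-- `∂V/∂g_ρ (gs)` as a vector in `ℝ^N`. -/
def gradV {d N : ℕ} (R : Finset (Vec d)) (V : ({x // x ∈ R} → Vec N) → ℝ)
    (ρ : {x // x ∈ R}) (gs : {x // x ∈ R} → Vec N) : Vec N :=
  fun i => fderiv ℝ V gs (Pi.single ρ (Pi.single i 1))

/-- The finite-difference stencil `Du(ℓ) = (D_ρ u(ℓ))_{ρ ∈ R}`. -/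
def Dstencil {d N : ℕ} (R : Finset (Vec d)) (u : Vec d → Vec N) (ℓ : Vec d) :
    {x // x ∈ R} → Vec N :=
  fun ρ => D1 (ρ : Vec d) u ℓ

/-- `C_{σρ} = ∂²V/∂g_σ ∂g_ρ (0)`. -/
def CofV {d N : ℕ} (R : Finset (Vec d)) (V : ({x // x ∈ R} → Vec N) → ℝ)
    (σ ρ : Vec d) (i j : Fin N) : ℝ :=
  if hσ : σ ∈ R then
    if hρ : ρ ∈ R then
      iteratedFDeriv ℝ 2 V 0
        ![Pi.single ⟨σ, hσ⟩ (Pi.single i 1), Pi.single ⟨ρ, hρ⟩ (Pi.single j 1)]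
    else 0
  else 0

/-- Summand of the first variation `δE(u)[v]` at a site. -/
def deltaEsite {d N : ℕ} (R : Finset (Vec d)) (V : ({x // x ∈ R} → Vec N) → ℝ)
    (u v : Vec d → Vec N) (ℓ : Vec d) : ℝ :=
  ∑ ρ ∈ R.attach, dotV (gradV R V ρ (Dstencil R u ℓ)) (D1 (ρ : Vec d) v ℓ)

/-- The pointwise atomistic force `δE(u)(ℓ)`. -/
def deltaEpt {d N : ℕ} (R : Finset (Vec d)) (V : ({x // x ∈ R} → Vec N) → ℝ)
    (u : Vec d → Vec N) (ℓ : Vec d) : Vec N :=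
  ∑ ρ ∈ R.attach,
    (gradV R V ρ (Dstencil R u (ℓ - (ρ : Vec d))) - gradV R V ρ (Dstencil R u ℓ))

/-- Point symmetry of the site potential. -/
def PointSym {d N : ℕ} (R : Finset (Vec d)) (hRsym : ∀ ρ ∈ R, -ρ ∈ R)
    (V : ({x // x ∈ R} → Vec N) → ℝ) : Prop :=
  ∀ gs : {x // x ∈ R} → Vec N,
    V (fun ρ => -(gs ⟨-(ρ : Vec d), hRsym _ ρ.2⟩)) = V gs

/-- The Cauchy–Born elasticity tensor `ℂ_{iajb}`. -/
def CB {d N : ℕ} (A : Matrix (Fin d) (Fin d) ℝ) (R : Finset (Vec d))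
    (C : Vec d → Vec d → Fin N → Fin N → ℝ)
    (i : Fin N) (a : Fin d) (j : Fin N) (b : Fin d) : ℝ :=
  (|A.det|)⁻¹ * ∑ ρ ∈ R, ∑ σ ∈ R, C ρ σ i j * ρ a * σ b

section
/-! ### Discrete weights and decay classes on `ℤ^d` -/

abbrev ZZ (d : ℕ) : Type := Fin d → ℤ

def wt {d : ℕ} (z : ZZ d) : ℝ := ‖z‖ + 2

def lg {d : ℕ} (z : ZZ d) : ℝ := 1 + Real.log (wt z)

def Df {d : ℕ} (v : ZZ d) (f : ZZ d → ℝ) : ZZ d → ℝ := fun z => f (z + v) - f z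

def Dl {d : ℕ} : List (ZZ d) → (ZZ d → ℝ) → ZZ d → ℝ
  | [], f => f
  | v :: vs, f => Dl vs (Df v f)

def Bd {d : ℕ} (a n : ℕ) (f : ℝ → ZZ d → ℝ) : Prop :=
  ∃ C : ℝ, 0 ≤ C ∧ ∀ p z, |f p z| ≤ C * (lg z ^ n / wt z ^ a)

def Ty {d : ℕ} (a n M : ℕ) (f : ℝ → ZZ d → ℝ) : Prop :=
  ∀ vs : List (ZZ d), vs.length ≤ M → Bd (a + vs.length) n (fun p => Dl vs (f p))

variable {d : ℕ}

lemma two_le_wt (z : ZZ d) : 2 ≤ wt z := by unfold wt; linarith [norm_nonneg z]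
lemma wt_pos (z : ZZ d) : 0 < wt z := by linarith [two_le_wt z]
lemma one_le_wt (z : ZZ d) : 1 ≤ wt z := by linarith [two_le_wt z]
lemma one_le_lg (z : ZZ d) : 1 ≤ lg z := by
  unfold lg; linarith [Real.log_nonneg (one_le_wt z)]
lemma lg_pos (z : ZZ d) : 0 < lg z := by linarith [one_le_lg z]

lemma wt_add_le (z v : ZZ d) : wt (z + v) ≤ wt z * (1 + ‖v‖) := by
  unfold wt; nlinarith [norm_add_le z v, norm_nonneg z, norm_nonneg v]

lemma wt_le_add (z v : ZZ d) : wt z ≤ wt (z + v) * (1 + ‖v‖) := by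
  have := wt_add_le (z + v) (-v)
  simpa using this

lemma lg_add_le (z v : ZZ d) : lg (z + v) ≤ lg z * (1 + ‖v‖) := by
  have h1 : Real.log (wt (z + v)) ≤ Real.log (wt z) + Real.log (1 + ‖v‖) := by
    rw [← Real.log_mul (wt_pos z).ne' (by positivity)]
    exact Real.log_le_log (wt_pos _) (wt_add_le z v)
  have h2 : Real.log (1 + ‖v‖) ≤ ‖v‖ := by
    have := Real.log_le_sub_one_of_pos (show 0 < 1 + ‖v‖ by positivity)
    linarith
  have h3 := one_le_lg z
  unfold lg at *
  nlinarith [norm_nonneg v]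

lemma lg_le_wt (z : ZZ d) : lg z ≤ wt z := by
  have := Real.log_le_sub_one_of_pos (wt_pos z)
  unfold lg; linarith

lemma frac_nonneg (z : ZZ d) (a n : ℕ) : 0 ≤ lg z ^ n / wt z ^ a :=
  div_nonneg (pow_nonneg (lg_pos z).le _) (pow_nonneg (wt_pos z).le _)

lemma Bd.of_le {a n : ℕ} {f : ℝ → ZZ d → ℝ} (C : ℝ)
    (h : ∀ p z, |f p z| ≤ C * (lg z ^ n / wt z ^ a)) : Bd a n f := by
  refine ⟨|C|, abs_nonneg _, fun p z => (h p z).trans ?_⟩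
  exact mul_le_mul_of_nonneg_right (le_abs_self C) (frac_nonneg z a n)

lemma Bd.add {a n : ℕ} {f g : ℝ → ZZ d → ℝ} (hf : Bd a n f) (hg : Bd a n g) :
    Bd a n (fun p z => f p z + g p z) := by
  obtain ⟨C, hC, h⟩ := hf
  obtain ⟨C', hC', h'⟩ := hg
  refine ⟨C + C', by positivity, fun p z => (abs_add_le _ _).trans ?_⟩
  rw [add_mul]; exact add_le_add (h p z) (h' p z)

lemma Bd.mul {a n b m : ℕ} {f g : ℝ → ZZ d → ℝ} (hf : Bd a n f) (hg : Bd b m g) :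
    Bd (a + b) (n + m) (fun p z => f p z * g p z) := by
  obtain ⟨C, hC, h⟩ := hf
  obtain ⟨C', hC', h'⟩ := hg
  refine ⟨C * C', by positivity, fun p z => ?_⟩
  rw [abs_mul]
  calc |f p z| * |g p z| ≤ (C * (lg z ^ n / wt z ^ a)) * (C' * (lg z ^ m / wt z ^ b)) :=
        mul_le_mul (h p z) (h' p z) (abs_nonneg _) (mul_nonneg hC (frac_nonneg _ _ _))
    _ = _ := by rw [pow_add, pow_add]; ring

lemma Bd.const_mul {a n : ℕ} {f : ℝ → ZZ d → ℝ} (c : ℝ) (hf : Bd a n f) :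
    Bd a n (fun p z => c * f p z) := by
  obtain ⟨C, hC, h⟩ := hf
  refine ⟨|c| * C, by positivity, fun p z => ?_⟩
  rw [abs_mul, mul_assoc]
  exact mul_le_mul_of_nonneg_left (h p z) (abs_nonneg _)

lemma Bd.mono {a n b m : ℕ} {f : ℝ → ZZ d → ℝ} (hf : Bd a n f) (hb : b ≤ a) (hm : n ≤ m) :
    Bd b m f := by
  obtain ⟨C, hC, h⟩ := hf
  refine ⟨C, hC, fun p z => (h p z).trans (mul_le_mul_of_nonneg_left ?_ hC)⟩
  have h1 := one_le_wt z
  have h2 := one_le_lg z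
  have h3 := wt_pos z
  gcongr

lemma Bd.trade {a n : ℕ} {f : ℝ → ZZ d → ℝ} (hf : Bd (a + 1) (n + 1) f) : Bd a n f := by
  obtain ⟨C, hC, h⟩ := hf
  refine ⟨C, hC, fun p z => (h p z).trans (mul_le_mul_of_nonneg_left ?_ hC)⟩
  have h3 := wt_pos z
  have h4 := lg_pos z
  rw [div_le_div_iff₀ (by positivity) (by positivity), pow_succ, pow_succ]
  have := lg_le_wt z
  have h5 : 0 ≤ lg z ^ n * wt z ^ a := by positivity
  nlinarith

lemma Bd.shift {a n : ℕ} {f : ℝ → ZZ d → ℝ} (hf : Bd a n f) (v : ZZ d) :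
    Bd a n (fun p z => f p (z + v)) := by
  obtain ⟨C, hC, h⟩ := hf
  refine ⟨C * ((1 + ‖v‖) ^ n * (1 + ‖v‖) ^ a), by positivity, fun p z => (h p (z + v)).trans ?_⟩
  rw [mul_assoc]
  refine mul_le_mul_of_nonneg_left ?_ hC
  have h3 := wt_pos z
  have h4 := wt_pos (z + v)
  have h5 := lg_pos (z + v)
  have h6 := lg_pos z
  have e1 : lg (z + v) ^ n ≤ lg z ^ n * (1 + ‖v‖) ^ n := by
    rw [← mul_pow]; exact pow_le_pow_left₀ h5.le (lg_add_le z v) n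
  have e2 : wt z ^ a ≤ wt (z + v) ^ a * (1 + ‖v‖) ^ a := by
    rw [← mul_pow]; exact pow_le_pow_left₀ h3.le (wt_le_add z v) a
  rw [← mul_div_assoc, div_le_div_iff₀ (by positivity) (by positivity)]
  calc lg (z + v) ^ n * wt z ^ a ≤ (lg z ^ n * (1 + ‖v‖) ^ n) * (wt (z + v) ^ a * (1 + ‖v‖) ^ a) :=
        mul_le_mul e1 e2 (by positivity) (by positivity)
    _ = _ := by ring

lemma Bd.congr {a n : ℕ} {f g : ℝ → ZZ d → ℝ} (hf : Bd a n f) (h : ∀ p z, g p z = f p z) :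
    Bd a n g := by
  have : g = f := by funext p z; exact h p z
  rwa [this]

lemma Bd.sub {a n : ℕ} {f g : ℝ → ZZ d → ℝ} (hf : Bd a n f) (hg : Bd a n g) :
    Bd a n (fun p z => f p z - g p z) :=
  (hf.add (hg.const_mul (-1))).congr (fun p z => by ring)

lemma Bd.reparam {a n : ℕ} {f : ℝ → ZZ d → ℝ} (hf : Bd a n f) (φ : ℝ → ℝ) :
    Bd a n (fun p => f (φ p)) := by
  obtain ⟨C, hC, h⟩ := hf
  exact ⟨C, hC, fun p z => h _ z⟩

/-! ### difference calculus -/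

lemma Df_add (v : ZZ d) (f g : ZZ d → ℝ) :
    Df v (fun z => f z + g z) = fun z => Df v f z + Df v g z := by
  funext z; simp only [Df]; ring

lemma Df_sub (v : ZZ d) (f g : ZZ d → ℝ) :
    Df v (fun z => f z - g z) = fun z => Df v f z - Df v g z := by
  funext z; simp only [Df]; ring

lemma Df_const_mul (v : ZZ d) (c : ℝ) (f : ZZ d → ℝ) :
    Df v (fun z => c * f z) = fun z => c * Df v f z := by
  funext z; simp only [Df]; ring

lemma Df_mul (v : ZZ d) (f g : ZZ d → ℝ) :
    Df v (fun z => f z * g z) = fun z => Df v f z * g (z + v) + f z * Df v g z := by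
  funext z; simp only [Df]; ring

lemma Df_shift (v w : ZZ d) (f : ZZ d → ℝ) :
    Df v (fun z => f (z + w)) = fun z => Df v f (z + w) := by
  funext z; simp only [Df]; congr 2; abel

lemma Df_comm (v w : ZZ d) (f : ZZ d → ℝ) : Df v (Df w f) = Df w (Df v f) := by
  funext z; simp only [Df]; rw [add_right_comm]; ring

lemma Dl_add (vs : List (ZZ d)) (f g : ZZ d → ℝ) :
    Dl vs (fun z => f z + g z) = fun z => Dl vs f z + Dl vs g z := by
  induction vs generalizing f g with
  | nil => rfl
  | cons v vs ih => simp only [Dl, Df_add, ih]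

lemma Dl_sub (vs : List (ZZ d)) (f g : ZZ d → ℝ) :
    Dl vs (fun z => f z - g z) = fun z => Dl vs f z - Dl vs g z := by
  induction vs generalizing f g with
  | nil => rfl
  | cons v vs ih => simp only [Dl, Df_sub, ih]

lemma Dl_const_mul (vs : List (ZZ d)) (c : ℝ) (f : ZZ d → ℝ) :
    Dl vs (fun z => c * f z) = fun z => c * Dl vs f z := by
  induction vs generalizing f with
  | nil => rfl
  | cons v vs ih => simp only [Dl, Df_const_mul, ih]

lemma Dl_shift (vs : List (ZZ d)) (w : ZZ d) (f : ZZ d → ℝ) :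
    Dl vs (fun z => f (z + w)) = fun z => Dl vs f (z + w) := by
  induction vs generalizing f with
  | nil => rfl
  | cons v vs ih => simp only [Dl, Df_shift, ih]

lemma Dl_Df (vs : List (ZZ d)) (v : ZZ d) (f : ZZ d → ℝ) :
    Dl vs (Df v f) = Df v (Dl vs f) := by
  induction vs generalizing f with
  | nil => rfl
  | cons w vs ih => simp only [Dl]; rw [← ih, Df_comm]

lemma Dl_append (vs ws : List (ZZ d)) (f : ZZ d → ℝ) :
    Dl (vs ++ ws) f = Dl ws (Dl vs f) := by
  induction vs generalizing f with
  | nil => rfl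
  | cons w vs ih => simp only [List.cons_append, Dl, ih]

lemma Dl_comm (vs ws : List (ZZ d)) (f : ZZ d → ℝ) :
    Dl vs (Dl ws f) = Dl ws (Dl vs f) := by
  induction vs generalizing f with
  | nil => rfl
  | cons w vs ih => simp only [Dl]; rw [← Dl_Df, ih]

lemma Dl_sum {ι : Type*} (vs : List (ZZ d)) (s : Finset ι) (f : ι → ZZ d → ℝ) :
    Dl vs (fun z => ∑ i ∈ s, f i z) = fun z => ∑ i ∈ s, Dl vs (f i) z := by
  classical
  induction s using Finset.induction_on with
  | empty =>
    simp only [Finset.sum_empty]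
    have := Dl_const_mul vs 0 (fun _ => 0)
    simpa using this
  | insert i s hi ih => simp only [Finset.sum_insert hi, Dl_add, ih]

lemma Dl_perm {vs ws : List (ZZ d)} (h : vs.Perm ws) (f : ZZ d → ℝ) : Dl vs f = Dl ws f := by
  induction h generalizing f with
  | nil => rfl
  | cons x _ ih => simp only [Dl, ih]
  | swap x y l => simp only [Dl, Df_comm]
  | trans _ _ ih1 ih2 => rw [ih1, ih2]

/-! ### the classes `Ty` -/

lemma Ty.bd {a n M : ℕ} {f : ℝ → ZZ d → ℝ} (hf : Ty a n M f) : Bd a n f := hf [] (Nat.zero_le _)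

lemma Ty.congr {a n M : ℕ} {f g : ℝ → ZZ d → ℝ} (hf : Ty a n M f) (h : ∀ p z, g p z = f p z) :
    Ty a n M g := by
  have : g = f := by funext p z; exact h p z
  rwa [this]

lemma Ty_zero {a n : ℕ} {f : ℝ → ZZ d → ℝ} (h : Bd a n f) : Ty a n 0 f := by
  intro vs hvs
  have : vs = [] := by simpa using hvs
  subst this; exact h

lemma Ty_succ {a n M : ℕ} {f : ℝ → ZZ d → ℝ} :
    Ty a n (M + 1) f ↔ Bd a n f ∧ ∀ v, Ty (a + 1) n M (fun p => Df v (f p)) := by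
  constructor
  · intro h
    refine ⟨h.bd, fun v vs hvs => ?_⟩
    have := h (v :: vs) (by simpa using hvs)
    simp only [Dl, List.length_cons] at this
    rwa [show a + 1 + vs.length = a + (vs.length + 1) by omega]
  · rintro ⟨h0, h1⟩ vs hvs
    cases vs with
    | nil => exact h0
    | cons v vs =>
      have := h1 v vs (by simpa using hvs)
      simp only [Dl, List.length_cons]
      rwa [show a + 1 + vs.length = a + (vs.length + 1) by omega] at this

lemma Ty.add {a n M : ℕ} {f g : ℝ → ZZ d → ℝ} (hf : Ty a n M f) (hg : Ty a n M g) :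
    Ty a n M (fun p z => f p z + g p z) := by
  intro vs hvs
  simp only [Dl_add]
  exact (hf vs hvs).add (hg vs hvs)

lemma Ty.sub {a n M : ℕ} {f g : ℝ → ZZ d → ℝ} (hf : Ty a n M f) (hg : Ty a n M g) :
    Ty a n M (fun p z => f p z - g p z) := by
  intro vs hvs
  simp only [Dl_sub]
  exact (hf vs hvs).sub (hg vs hvs)

lemma Ty.const_mul {a n M : ℕ} {f : ℝ → ZZ d → ℝ} (c : ℝ) (hf : Ty a n M f) :
    Ty a n M (fun p z => c * f p z) := by
  intro vs hvs
  simp only [Dl_const_mul]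
  exact (hf vs hvs).const_mul c

lemma Ty.neg {a n M : ℕ} {f : ℝ → ZZ d → ℝ} (hf : Ty a n M f) :
    Ty a n M (fun p z => - f p z) :=
  (hf.const_mul (-1)).congr (fun p z => by ring)

lemma Ty.zero_fun {a n M : ℕ} : Ty a n M (fun (_ : ℝ) (_ : ZZ d) => (0 : ℝ)) := by
  intro vs _
  refine ⟨0, le_rfl, fun p z => ?_⟩
  have := Dl_const_mul vs 0 (fun _ : ZZ d => 0)
  simp only [zero_mul] at this
  simp [this]

lemma Ty.sum {a n M : ℕ} {ι : Type*} {s : Finset ι} {f : ι → ℝ → ZZ d → ℝ}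
    (hf : ∀ i ∈ s, Ty a n M (f i)) : Ty a n M (fun p z => ∑ i ∈ s, f i p z) := by
  classical
  induction s using Finset.induction_on with
  | empty => simpa using Ty.zero_fun
  | insert i s hi ih =>
    simp only [Finset.sum_insert hi]
    exact (hf i (Finset.mem_insert_self _ _)).add
      (ih (fun j hj => hf j (Finset.mem_insert_of_mem hj)))

lemma Ty.mono {a n M b m M' : ℕ} {f : ℝ → ZZ d → ℝ} (hf : Ty a n M f) (hb : b ≤ a) (hm : n ≤ m)
    (hM : M' ≤ M) : Ty b m M' f :=
  fun vs hvs => (hf vs (hvs.trans hM)).mono (by omega) hm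

lemma Ty.trade {a n M : ℕ} {f : ℝ → ZZ d → ℝ} (hf : Ty (a + 1) (n + 1) M f) : Ty a n M f := by
  intro vs hvs
  have := hf vs hvs
  rw [show a + 1 + vs.length = (a + vs.length) + 1 by omega] at this
  exact this.trade

lemma Ty.shift {a n M : ℕ} {f : ℝ → ZZ d → ℝ} (hf : Ty a n M f) (v : ZZ d) :
    Ty a n M (fun p z => f p (z + v)) := by
  intro vs hvs
  simp only [Dl_shift]
  exact (hf vs hvs).shift v

lemma Ty.reparam {a n M : ℕ} {f : ℝ → ZZ d → ℝ} (hf : Ty a n M f) (φ : ℝ → ℝ) :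
    Ty a n M (fun p => f (φ p)) := fun vs hvs => (hf vs hvs).reparam φ

lemma Ty.df {a n M : ℕ} {f : ℝ → ZZ d → ℝ} (hf : Ty a n (M + 1) f) (v : ZZ d) :
    Ty (a + 1) n M (fun p => Df v (f p)) := (Ty_succ.1 hf).2 v

lemma Ty.dl {a n M : ℕ} {f : ℝ → ZZ d → ℝ} (vs : List (ZZ d)) (hf : Ty a n (M + vs.length) f) :
    Ty (a + vs.length) n M (fun p => Dl vs (f p)) := by
  intro ws hws
  have := hf (vs ++ ws) (by simp; omega)
  simp only [Dl_append, List.length_append] at this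
  rwa [← add_assoc] at this

lemma Ty.mul {a n b m M : ℕ} {f g : ℝ → ZZ d → ℝ} (hf : Ty a n M f) (hg : Ty b m M g) :
    Ty (a + b) (n + m) M (fun p z => f p z * g p z) := by
  induction M generalizing a b f g with
  | zero => exact Ty_zero (hf.bd.mul hg.bd)
  | succ M ih =>
    rw [Ty_succ]
    refine ⟨hf.bd.mul hg.bd, fun v => ?_⟩
    simp only [Df_mul]
    refine Ty.add ?_ ?_
    · have := ih (hf.df v) ((hg.mono le_rfl le_rfl (Nat.le_succ M)).shift v)
      rwa [show a + 1 + b = a + b + 1 by omega] at this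
    · have := ih (hf.mono le_rfl le_rfl (Nat.le_succ M)) (hg.df v)
      rwa [show a + (b + 1) = a + b + 1 by omega] at this

lemma Ty.loss {a n M : ℕ} {f : ℝ → ZZ d → ℝ} (hf : Ty (a + 1) n M f) : Ty a n (M + 1) f := by
  intro vs hvs
  by_cases h : vs.length ≤ M
  · exact (hf vs h).mono (by omega) le_rfl
  · cases vs with
    | nil => simp at h
    | cons v vs =>
      have hl : vs.length ≤ M := by simpa using hvs
      have h1 := hf vs hl
      simp only [Dl, Dl_Df, List.length_cons]
      have := (h1.shift v).sub h1
      rw [show a + 1 + vs.length = a + (vs.length + 1) by omega] at this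
      exact this

lemma Ty.const {M : ℕ} (c : ℝ) : Ty 0 0 M (fun (_ : ℝ) (_ : ZZ d) => c) := by
  cases M with
  | zero => exact Ty_zero ⟨|c|, abs_nonneg _, fun p z => by simp⟩
  | succ M =>
    rw [Ty_succ]
    refine ⟨⟨|c|, abs_nonneg _, fun p z => by simp⟩, fun v => ?_⟩
    refine Ty.zero_fun.congr (fun p z => ?_)
    simp [Df]

lemma Df_finsupp {f : ZZ d → ℝ} (hf : (Function.support f).Finite) (v : ZZ d) :
    (Function.support (Df v f)).Finite := by
  have h1 : (Function.support (fun z => f (z + v))).Finite := by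
    have : Function.support (fun z => f (z + v)) = (fun z => z + v) ⁻¹' Function.support f := rfl
    rw [this]
    exact hf.preimage (add_left_injective v).injOn
  refine (h1.union hf).subset ?_
  intro z hz
  by_contra hcon
  simp only [Set.mem_union, Function.mem_support, not_or, not_not] at hcon
  exact hz (by simp [Df, hcon.1, hcon.2])

lemma Dl_finsupp {f : ZZ d → ℝ} (hf : (Function.support f).Finite) (vs : List (ZZ d)) :
    (Function.support (Dl vs f)).Finite := by
  induction vs generalizing f with
  | nil => exact hf
  | cons v vs ih => exact ih (Df_finsupp hf v)

lemma Ty.of_finsupp {f : ZZ d → ℝ} (hf : (Function.support f).Finite) (a n M : ℕ) :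
    Ty a n M (fun _ => f) := by
  intro vs _
  have h := Dl_finsupp hf vs
  set g := Dl vs f
  set b := a + vs.length
  refine Bd.of_le (∑ z ∈ h.toFinset, |g z| * wt z ^ b) (fun p z => ?_)
  have h3 := wt_pos z
  have hnn : 0 ≤ ∑ z ∈ h.toFinset, |g z| * wt z ^ b :=
    Finset.sum_nonneg (fun z _ => mul_nonneg (abs_nonneg _) (pow_nonneg (wt_pos z).le _))
  change |g z| ≤ _
  by_cases hz : g z = 0
  · rw [hz, abs_zero]; exact mul_nonneg hnn (frac_nonneg _ _ _)
  · have h1 : |g z| * wt z ^ b ≤ ∑ z ∈ h.toFinset, |g z| * wt z ^ b :=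
      Finset.single_le_sum (f := fun z => |g z| * wt z ^ b)
        (fun z _ => mul_nonneg (abs_nonneg _) (pow_nonneg (wt_pos z).le _))
        (h.mem_toFinset.2 hz)
    have h2 : 1 ≤ lg z ^ n := one_le_pow₀ (one_le_lg z)
    rw [← mul_div_assoc, le_div_iff₀ (by positivity)]
    calc |g z| * wt z ^ b ≤ _ := h1
      _ ≤ _ := le_mul_of_one_le_right hnn h2

end

section
variable {d : ℕ}

/-! ### Lattice sums -/

def SumBd {ι : Type*} (f : ι → ℝ) (B : ℝ) : Prop := ∀ A : Finset ι, ∑ m ∈ A, |f m| ≤ B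

lemma SumBd.nonneg {ι : Type*} {f : ι → ℝ} {B : ℝ} (h : SumBd f B) : 0 ≤ B := by
  simpa using h ∅

lemma SumBd.summable {ι : Type*} {f : ι → ℝ} {B : ℝ} (h : SumBd f B) : Summable f :=
  Summable.of_norm (summable_of_sum_le (fun _ => norm_nonneg _) (fun u => h u))

lemma SumBd.abs_tsum_le {ι : Type*} {f : ι → ℝ} {B : ℝ} (h : SumBd f B) : |∑' m, f m| ≤ B := by
  have hs : Summable (fun m => ‖f m‖) := summable_of_sum_le (fun _ => norm_nonneg _) (fun u => h u)
  have h1 := norm_tsum_le_tsum_norm hs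
  have h2 : ∑' m, ‖f m‖ ≤ B := hs.tsum_le_of_sum_le (fun u => h u)
  exact h1.trans h2

lemma SumBd.mono {ι : Type*} {f g : ι → ℝ} {B : ℝ} (h : SumBd g B) (hfg : ∀ m, |f m| ≤ |g m|) :
    SumBd f B := fun A => (Finset.sum_le_sum (fun m _ => hfg m)).trans (h A)

lemma SumBd.le {ι : Type*} {f : ι → ℝ} {B B' : ℝ} (h : SumBd f B) (hB : B ≤ B') : SumBd f B' :=
  fun A => (h A).trans hB

lemma SumBd.add {ι : Type*} {f g : ι → ℝ} {B B' : ℝ} (h : SumBd f B) (h' : SumBd g B') :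
    SumBd (fun m => f m + g m) (B + B') := fun A => by
  calc ∑ m ∈ A, |f m + g m| ≤ ∑ m ∈ A, (|f m| + |g m|) :=
        Finset.sum_le_sum (fun m _ => abs_add_le _ _)
    _ = _ := Finset.sum_add_distrib
    _ ≤ _ := add_le_add (h A) (h' A)

lemma SumBd.const_mul {ι : Type*} {f : ι → ℝ} {B : ℝ} (c : ℝ) (h : SumBd f B) :
    SumBd (fun m => c * f m) (|c| * B) := fun A => by
  simp only [abs_mul, ← Finset.mul_sum]
  exact mul_le_mul_of_nonneg_left (h A) (abs_nonneg _)

lemma SumBd.comp {ι κ : Type*} {f : ι → ℝ} {B : ℝ} (h : SumBd f B) (e : κ → ι)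
    (he : Function.Injective e) : SumBd (fun m => f (e m)) B := fun A => by
  have := h (A.map ⟨e, he⟩)
  simpa using this

lemma SumBd.of_summable {ι : Type*} {f : ι → ℝ} (h : Summable f) : ∃ B, SumBd f B :=
  ⟨∑' m, |f m|, fun A => h.abs.sum_le_tsum A (fun _ _ => abs_nonneg _)⟩

/-- integer sup norm -/
def nn (z : ZZ d) : ℕ := Finset.univ.sup (fun i => (z i).natAbs)

lemma norm_eq_nn (z : ZZ d) : ‖z‖ = (nn z : ℝ) := by
  apply le_antisymm
  · rw [pi_norm_le_iff_of_nonneg (by positivity)]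
    intro i
    rw [Int.norm_eq_abs, ← Int.cast_abs, Int.abs_eq_natAbs]
    have : (z i).natAbs ≤ nn z := Finset.le_sup (f := fun i => (z i).natAbs) (Finset.mem_univ i)
    exact_mod_cast this
  · have : ∀ i, (z i).natAbs ≤ ⌊‖z‖⌋₊ := fun i => by
      apply Nat.le_floor
      have := norm_le_pi_norm z i
      rwa [Int.norm_eq_abs, ← Int.cast_abs, Int.abs_eq_natAbs] at this
    have h2 : nn z ≤ ⌊‖z‖⌋₊ := Finset.sup_le (fun i _ => this i)
    calc (nn z : ℝ) ≤ (⌊‖z‖⌋₊ : ℝ) := by exact_mod_cast h2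
      _ ≤ _ := Nat.floor_le (norm_nonneg _)

lemma wt_eq_nn (z : ZZ d) : wt z = (nn z : ℝ) + 2 := by rw [wt, norm_eq_nn]

def box (d k : ℕ) : Finset (ZZ d) := Fintype.piFinset (fun _ => Finset.Icc (-(k : ℤ)) k)

lemma mem_box {k : ℕ} {z : ZZ d} : z ∈ box d k ↔ nn z ≤ k := by
  simp only [box, Fintype.mem_piFinset, Finset.mem_Icc, nn, Finset.sup_le_iff, Finset.mem_univ,
    true_imp_iff]
  refine forall_congr' fun i => ?_
  omega

lemma card_box (k : ℕ) : (box d k).card = (2 * k + 1) ^ d := by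
  simp only [box, Fintype.card_piFinset, Int.card_Icc, Finset.prod_const, Finset.card_univ,
    Fintype.card_fin]
  congr 1; omega

lemma pow_diff_le (b n : ℕ) : (b + 2) ^ (n + 1) ≤ b ^ (n + 1) + 2 * (n + 1) * (b + 2) ^ n := by
  induction n with
  | zero => simp
  | succ n ih =>
    calc (b + 2) ^ (n + 1 + 1) = (b + 2) ^ (n + 1) * b + 2 * (b + 2) ^ (n + 1) := by ring
      _ ≤ (b ^ (n + 1) + 2 * (n + 1) * (b + 2) ^ n) * b + 2 * (b + 2) ^ (n + 1) := by gcongr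
      _ = b ^ (n + 1 + 1) + 2 * (n + 1) * ((b + 2) ^ n * b) + 2 * (b + 2) ^ (n + 1) := by ring
      _ ≤ b ^ (n + 1 + 1) + 2 * (n + 1) * ((b + 2) ^ n * (b + 2)) + 2 * (b + 2) ^ (n + 1) := by
          gcongr; omega
      _ = _ := by ring

lemma card_sphere (hd : 1 ≤ d) (k : ℕ) (A : Finset (ZZ d)) (hA : ∀ z ∈ A, nn z = k) :
    A.card ≤ (2 * d * 2 ^ d) * (k + 2) ^ (d - 1) := by
  obtain ⟨e, rfl⟩ : ∃ e, d = e + 1 := ⟨d - 1, by omega⟩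
  simp only [Nat.add_sub_cancel]
  have hpos : 1 ≤ (k + 2) ^ e := Nat.one_le_pow _ _ (by omega)
  rcases k with _ | k
  · have h : A.card ≤ (box (e + 1) 0).card :=
      Finset.card_le_card (fun z hz => mem_box.2 (hA z hz).le)
    rw [card_box] at h
    have : 1 ≤ 2 * (e + 1) * 2 ^ (e + 1) := Nat.mul_pos (by omega) (by positivity)
    calc A.card ≤ 1 * 1 := by simpa using h
      _ ≤ _ := Nat.mul_le_mul this hpos
  · have hsub : A ⊆ box (e + 1) (k + 1) \ box (e + 1) k := fun z hz => by
      rw [Finset.mem_sdiff, mem_box, mem_box, hA z hz]; omega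
    have h := Finset.card_le_card hsub
    rw [Finset.card_sdiff_of_subset (fun z hz => by rw [mem_box] at *; omega), card_box,
      card_box] at h
    have h2 := pow_diff_le (2 * k + 1) e
    have h3 : (2 * k + 1 + 2) ^ e ≤ 2 ^ e * (k + 1 + 2) ^ e := by
      rw [← mul_pow]; gcongr; omega
    rw [show 2 * (k + 1) + 1 = 2 * k + 1 + 2 by ring] at h
    calc A.card ≤ 2 * (e + 1) * (2 * k + 1 + 2) ^ e := by omega
      _ ≤ 2 * (e + 1) * (2 ^ e * (k + 1 + 2) ^ e) := by gcongr
      _ ≤ 2 * (e + 1) * (2 ^ (e + 1) * (k + 1 + 2) ^ e) := by gcongr <;> omega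
      _ = _ := by ring

lemma sum_radial (hd : 1 ≤ d) (A : Finset (ZZ d)) (f : ZZ d → ℝ) (φ : ℕ → ℝ)
    (hφ : ∀ k, 0 ≤ φ k) (hf : ∀ z ∈ A, |f z| ≤ φ (nn z)) :
    ∑ z ∈ A, |f z| ≤ (2 * d * 2 ^ d : ℕ) * ∑ k ∈ A.image nn, ((k : ℝ) + 2) ^ (d - 1) * φ k := by
  classical
  rw [← Finset.sum_fiberwise_of_maps_to (g := nn) (t := A.image nn)
    (fun z hz => Finset.mem_image_of_mem _ hz), Finset.mul_sum]
  refine Finset.sum_le_sum fun k _ => ?_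
  have h1 : ∑ z ∈ A with nn z = k, |f z| ≤ ∑ z ∈ A with nn z = k, φ k := by
    refine Finset.sum_le_sum fun z hz => ?_
    rw [Finset.mem_filter] at hz
    rw [← hz.2]; exact hf z hz.1
  refine h1.trans ?_
  rw [Finset.sum_const, nsmul_eq_mul, ← mul_assoc]
  refine mul_le_mul_of_nonneg_right ?_ (hφ k)
  have := card_sphere hd k (A.filter (fun z => nn z = k)) (fun z hz => (Finset.mem_filter.1 hz).2)
  exact_mod_cast this

lemma S1 (hd : 1 ≤ d) : ∃ C : ℝ, 0 ≤ C ∧ ∀ ρ : ℝ, 1 ≤ ρ →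
    SumBd (fun m : ZZ d => if wt m ≤ ρ then 1 / wt m ^ d else 0) (C * (1 + Real.log ρ)) := by
  classical
  refine ⟨((2 * d * 2 ^ d : ℕ) : ℝ), by positivity, fun ρ hρ A => ?_⟩
  refine (sum_radial hd A _ (fun k => if (k : ℝ) + 2 ≤ ρ then 1 / ((k : ℝ) + 2) ^ d else 0)
    (fun k => by positivity) (fun z _ => ?_)).trans ?_
  · rw [wt_eq_nn, abs_of_nonneg (by positivity)]
  · refine mul_le_mul_of_nonneg_left ?_ (by positivity)
    have hterm : ∀ k : ℕ, ((k : ℝ) + 2) ^ (d - 1) *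
        (if (k : ℝ) + 2 ≤ ρ then 1 / ((k : ℝ) + 2) ^ d else 0) =
        if (k : ℝ) + 2 ≤ ρ then ((k : ℝ) + 2)⁻¹ else 0 := fun k => by
      split_ifs
      · obtain ⟨e, rfl⟩ : ∃ e, d = e + 1 := ⟨d - 1, by omega⟩
        have : (k : ℝ) + 2 ≠ 0 := by positivity
        simp only [Nat.add_sub_cancel]; field_simp; ring
      · simp
    simp only [hterm]
    rw [← Finset.sum_filter]
    have h2 : ∑ k ∈ (A.image nn).filter (fun k : ℕ => (k : ℝ) + 2 ≤ ρ), ((k : ℝ) + 2)⁻¹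
        ≤ ∑ k ∈ Finset.range ⌊ρ⌋₊, (((k : ℝ) + 1))⁻¹ := by
      refine (Finset.sum_le_sum (fun k _ => ?_)).trans
        (Finset.sum_le_sum_of_subset_of_nonneg (fun k hk => ?_) (fun k _ _ => by positivity))
      · gcongr; norm_num
      · rw [Finset.mem_filter] at hk
        rw [Finset.mem_range]
        apply Nat.lt_of_succ_le
        apply Nat.le_floor
        push_cast; linarith [hk.2]
    refine h2.trans ?_
    have h3 := harmonic_le_one_add_log ⌊ρ⌋₊
    have h4 : Real.log (⌊ρ⌋₊ : ℝ) ≤ Real.log ρ :=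
      Real.log_le_log (by exact_mod_cast Nat.floor_pos.2 hρ) (Nat.floor_le (by linarith))
    simp only [harmonic] at h3
    push_cast at h3
    linarith

lemma S2 (hd : 1 ≤ d) : ∃ C : ℝ, 0 ≤ C ∧ ∀ ρ : ℝ, 0 ≤ ρ →
    SumBd (fun m : ZZ d => if wt m ≤ ρ then 1 / wt m ^ (d - 1) else 0) (C * ρ) := by
  classical
  refine ⟨((2 * d * 2 ^ d : ℕ) : ℝ), by positivity, fun ρ hρ A => ?_⟩
  refine (sum_radial hd A _ (fun k => if (k : ℝ) + 2 ≤ ρ then 1 / ((k : ℝ) + 2) ^ (d - 1) else 0)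
    (fun k => by positivity) (fun z _ => ?_)).trans ?_
  · rw [wt_eq_nn, abs_of_nonneg (by positivity)]
  · refine mul_le_mul_of_nonneg_left ?_ (by positivity)
    have hterm : ∀ k : ℕ, ((k : ℝ) + 2) ^ (d - 1) *
        (if (k : ℝ) + 2 ≤ ρ then 1 / ((k : ℝ) + 2) ^ (d - 1) else 0) =
        if (k : ℝ) + 2 ≤ ρ then 1 else 0 := fun k => by
      split_ifs
      · have : (k : ℝ) + 2 ≠ 0 := by positivity
        field_simp
      · simp
    simp only [hterm]
    rw [← Finset.sum_filter]
    have h2 : (A.image nn).filter (fun k : ℕ => (k : ℝ) + 2 ≤ ρ) ⊆ Finset.range ⌊ρ⌋₊ :=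
      fun k hk => by
        rw [Finset.mem_filter] at hk
        rw [Finset.mem_range]
        apply Nat.lt_of_succ_le
        apply Nat.le_floor
        push_cast; linarith [hk.2]
    have h3 := Finset.card_le_card h2
    rw [Finset.card_range] at h3
    simp only [Finset.sum_const, nsmul_eq_mul, mul_one]
    calc _ ≤ (⌊ρ⌋₊ : ℝ) := by exact_mod_cast h3
      _ ≤ ρ := Nat.floor_le hρ

lemma S3 (hd : 1 ≤ d) (q : ℕ) : ∃ C : ℝ, 0 ≤ C ∧ ∀ ρ : ℝ, 0 < ρ →
    SumBd (fun m : ZZ d => if ρ ≤ wt m then 1 / wt m ^ (d + (q + 1)) else 0)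
      (C * (1 / ρ ^ (q + 1))) := by
  classical
  refine ⟨((2 * d * 2 ^ d : ℕ) : ℝ) * 2, by positivity, fun ρ hρ A => ?_⟩
  refine (sum_radial hd A _
    (fun k => if ρ ≤ (k : ℝ) + 2 then 1 / ((k : ℝ) + 2) ^ (d + (q + 1)) else 0)
    (fun k => by positivity) (fun z _ => ?_)).trans ?_
  · rw [wt_eq_nn, abs_of_nonneg (by positivity)]
  · rw [mul_assoc ((2 * d * 2 ^ d : ℕ) : ℝ)]
    refine mul_le_mul_of_nonneg_left ?_ (by positivity)
    have hterm : ∀ k : ℕ, ((k : ℝ) + 2) ^ (d - 1) *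
        (if ρ ≤ (k : ℝ) + 2 then 1 / ((k : ℝ) + 2) ^ (d + (q + 1)) else 0) ≤
        if ρ ≤ (k : ℝ) + 2 then 1 / ρ ^ q * (((k : ℝ) + 2) ^ 2)⁻¹ else 0 := fun k => by
      split_ifs with h
      · obtain ⟨e, rfl⟩ : ∃ e, d = e + 1 := ⟨d - 1, by omega⟩
        have h0 : (0 : ℝ) < (k : ℝ) + 2 := by positivity
        simp only [Nat.add_sub_cancel]
        have : ((k : ℝ) + 2) ^ e * (1 / ((k : ℝ) + 2) ^ (e + 1 + (q + 1)))
          = 1 / ((k : ℝ) + 2) ^ q * (((k : ℝ) + 2) ^ 2)⁻¹ := by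
          rw [show e + 1 + (q + 1) = e + q + 2 by ring, pow_add, pow_add]; field_simp
        rw [this]
        gcongr
      · simp
    refine (Finset.sum_le_sum (fun k _ => hterm k)).trans ?_
    rw [← Finset.sum_filter, ← Finset.mul_sum]
    have hn0 : 1 ≤ ⌈ρ⌉₊ := Nat.ceil_pos.2 hρ
    set n0 := ⌈ρ⌉₊ with hn0def
    set S := (A.image nn).filter (fun k : ℕ => ρ ≤ (k : ℝ) + 2)
    have h1 : ∑ k ∈ S, (((k : ℝ) + 2) ^ 2)⁻¹ ≤ 2 / ρ := by
      have e1 : ∑ k ∈ S, (((k : ℝ) + 2) ^ 2)⁻¹ =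
          ∑ k ∈ S.image (fun k : ℕ => k + 2), (((k : ℕ) : ℝ) ^ 2)⁻¹ := by
        rw [Finset.sum_image (fun a _ b _ h => by simpa using h)]
        exact Finset.sum_congr rfl (fun k _ => by push_cast; rfl)
      rw [e1]
      have e2 : S.image (fun k : ℕ => k + 2) ⊆ Finset.Ioo (n0 - 1) (S.sup id + 3) := fun k hk => by
        obtain ⟨k', hk', rfl⟩ := Finset.mem_image.1 hk
        have hsup : k' ≤ S.sup id := Finset.le_sup (f := id) hk'
        have h3 : n0 ≤ k' + 2 := by
          apply Nat.ceil_le.2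
          have := (Finset.mem_filter.1 hk').2
          push_cast; exact this
        rw [Finset.mem_Ioo]; omega
      refine (Finset.sum_le_sum_of_subset_of_nonneg e2 (fun k _ _ => by positivity)).trans ?_
      refine (sum_Ioo_inv_sq_le (α := ℝ) (n0 - 1) (S.sup id + 3)).trans ?_
      have e3 : ((n0 - 1 : ℕ) : ℝ) + 1 = n0 := by
        have : n0 - 1 + 1 = n0 := by omega
        exact_mod_cast this
      rw [e3]
      have : ρ ≤ n0 := Nat.le_ceil ρ
      gcongr
    calc 1 / ρ ^ q * ∑ k ∈ S, (((k : ℝ) + 2) ^ 2)⁻¹ ≤ 1 / ρ ^ q * (2 / ρ) := by gcongr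
      _ = 2 * (1 / ρ ^ (q + 1)) := by rw [pow_succ]; field_simp

lemma summable_wt (hd : 1 ≤ d) (q : ℕ) : Summable (fun m : ZZ d => 1 / wt m ^ (d + (q + 1))) := by
  obtain ⟨C, _, h⟩ := S3 hd q
  have := (h 1 (by norm_num)).summable
  refine this.congr (fun m => by simp [one_le_wt m])

end

section
variable {d : ℕ}

/-! ### Hadamard lemma and composition -/

lemma contDiff_param_integral {E : Type} [NormedAddCommGroup E] [NormedSpace ℝ E]
    [FiniteDimensional ℝ E] (k : ℕ) :
    ∀ {G : Type} [NormedAddCommGroup G] [NormedSpace ℝ G] [CompleteSpace G] (f : E × ℝ → G),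
      ContDiff ℝ k f → ContDiff ℝ k (fun x => ∫ t in (0 : ℝ)..1, f (x, t)) := by
  induction k with
  | zero =>
    intro G _ _ _ f hf
    have hc : Continuous f := hf.continuous
    simp only [Nat.cast_zero, contDiff_zero]
    exact intervalIntegral.continuous_parametric_intervalIntegral_of_continuous'
      (f := fun x t => f (x, t)) (by simpa [Function.uncurry_def] using hc) 0 1
  | succ k ih =>
    intro G _ _ _ f hf
    have hc : Continuous f := hf.continuous
    have hdf : Differentiable ℝ f := hf.differentiable (by simp)
    push_cast at hf ⊢
    set f' : E × ℝ → (E →L[ℝ] G) := fun y => (fderiv ℝ f y).comp (ContinuousLinearMap.inl ℝ E ℝ)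
      with hf'
    have hf'c : ContDiff ℝ k f' := by
      have h1 : ContDiff ℝ k (fderiv ℝ f) := hf.fderiv_right le_rfl
      exact h1.clm_comp contDiff_const
    have hf'cont : Continuous f' := hf'c.continuous
    rw [contDiff_succ_iff_hasFDerivAt (n := k)]
    refine ⟨fun x => ∫ t in (0 : ℝ)..1, f' (x, t), ih f' hf'c, fun x₀ => ?_⟩
    have hcomp : IsCompact (Metric.closedBall x₀ 1 ×ˢ Set.Icc (0 : ℝ) 1) :=
      (isCompact_closedBall x₀ 1).prod isCompact_Icc
    obtain ⟨B, hB⟩ := hcomp.exists_bound_of_continuousOn hf'cont.continuousOn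
    refine (intervalIntegral.hasFDerivAt_integral_of_dominated_of_fderiv_le
      (F := fun x t => f (x, t)) (F' := fun x t => f' (x, t)) (bound := fun _ => B)
      (s := Metric.ball x₀ 1) (Metric.ball_mem_nhds x₀ one_pos) ?_ ?_ ?_ ?_ ?_ ?_)
    · exact Eventually.of_forall fun x =>
        (hc.comp (by fun_prop : Continuous fun t : ℝ => (x, t))).aestronglyMeasurable
    · exact (hc.comp (by fun_prop : Continuous fun t : ℝ => (x₀, t))).intervalIntegrable _ _
    · exact (hf'cont.comp (by fun_prop : Continuous fun t : ℝ => (x₀, t))).aestronglyMeasurable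
    · refine Eventually.of_forall fun t ht x hx => hB (x, t) ⟨Metric.ball_subset_closedBall hx, ?_⟩
      rw [Set.uIoc_of_le zero_le_one] at ht
      exact ⟨ht.1.le, ht.2⟩
    · exact intervalIntegrable_const
    · refine Eventually.of_forall fun t _ x _ => ?_
      have h1 := (hdf (x, t)).hasFDerivAt
      have h2 : HasFDerivAt (fun x : E => (x, t)) (ContinuousLinearMap.inl ℝ E ℝ) x :=
        hasFDerivAt_prodMk_left x t
      exact h1.comp x h2

lemma hadamard {I : Type} [Fintype I] [DecidableEq I] (k : ℕ) (f : (I → ℝ) → ℝ)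
    (hf : ContDiff ℝ (k + 1 : ℕ) f) :
    ∃ F : I → (I ⊕ I → ℝ) → ℝ, (∀ i, ContDiff ℝ k (F i)) ∧
      (∀ y y', f y' - f y = ∑ i, (y' i - y i) * F i (Sum.elim y y')) ∧
      (∀ i y, F i (Sum.elim y y) = fderiv ℝ f y (Pi.single i 1)) := by
  have hdf : Differentiable ℝ f := hf.differentiable (by simp)
  have hf1 : ContDiff ℝ k (fderiv ℝ f) := hf.fderiv_right (by push_cast; exact le_rfl)
  set seg : (I ⊕ I → ℝ) × ℝ → (I → ℝ) := fun q i =>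
    q.1 (Sum.inl i) + q.2 * (q.1 (Sum.inr i) - q.1 (Sum.inl i)) with hseg
  have hsegc : ContDiff ℝ k seg := by
    rw [contDiff_pi]; intro i; simp only [hseg]; fun_prop
  refine ⟨fun i Y => ∫ t in (0 : ℝ)..1, fderiv ℝ f (seg (Y, t)) (Pi.single i 1), ?_, ?_, ?_⟩
  · intro i
    refine contDiff_param_integral k (fun q => fderiv ℝ f (seg q) (Pi.single i 1)) ?_
    exact (hf1.comp hsegc).clm_apply contDiff_const
  · intro y y'
    have hsegy : ∀ t, seg (Sum.elim y y', t) = y + t • (y' - y) := fun t => by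
      funext i; simp [hseg]
    simp only [hsegy]
    have hcont : ∀ v : I → ℝ, Continuous fun t : ℝ => fderiv ℝ f (y + t • (y' - y)) v := fun v =>
      (hf1.continuous.comp (by fun_prop)).clm_apply continuous_const
    have hder : ∀ t : ℝ, HasDerivAt (fun t : ℝ => f (y + t • (y' - y)))
        (fderiv ℝ f (y + t • (y' - y)) (y' - y)) t := fun t => by
      have h1 := (hdf (y + t • (y' - y))).hasFDerivAt
      have h2 : HasDerivAt (fun t : ℝ => y + t • (y' - y)) (y' - y) t := by
        simpa using ((hasDerivAt_id t).smul_const (y' - y)).const_add y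
      exact h1.comp_hasDerivAt t h2
    have h3 := intervalIntegral.integral_eq_sub_of_hasDerivAt (a := 0) (b := 1)
      (fun t _ => hder t) ((hcont _).intervalIntegrable _ _)
    simp only [one_smul, zero_smul, add_zero, add_sub_cancel] at h3
    rw [← h3]
    have h4 : ∀ t : ℝ, fderiv ℝ f (y + t • (y' - y)) (y' - y) =
        ∑ i, (y' i - y i) * fderiv ℝ f (y + t • (y' - y)) (Pi.single i 1) := fun t => by
      conv_lhs => rw [show y' - y = ∑ i, (y' i - y i) • (Pi.single i (1 : ℝ) : I → ℝ) by
        funext j; simp [Finset.sum_apply, Pi.single_apply]]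
      rw [map_sum]
      refine Finset.sum_congr rfl fun i _ => ?_
      rw [map_smul, smul_eq_mul]
      congr 4
      funext j; simp [Finset.sum_apply, Pi.single_apply]
    simp only [h4]
    rw [intervalIntegral.integral_finsetSum
      (fun i _ => ((hcont _).const_mul _ |>.intervalIntegrable _ _))]
    simp only [intervalIntegral.integral_const_mul]
  · intro i y
    have hsegy : ∀ t, seg (Sum.elim y y, t) = y := fun t => by
      funext i; simp [hseg]
    simp [hsegy]

lemma hadamard_zero {I : Type} [Fintype I] [DecidableEq I] (k : ℕ) (f : (I → ℝ) → ℝ)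
    (hf : ContDiff ℝ (k + 1 : ℕ) f) :
    ∃ F : I → (I → ℝ) → ℝ, (∀ i, ContDiff ℝ k (F i)) ∧
      (∀ y, f y = f 0 + ∑ i, y i * F i y) ∧ (∀ i, F i 0 = fderiv ℝ f 0 (Pi.single i 1)) := by
  obtain ⟨F, h1, h2, h3⟩ := hadamard k f hf
  refine ⟨fun i y => F i (Sum.elim 0 y), fun i => (h1 i).comp ?_, fun y => ?_, fun i => h3 i 0⟩
  · rw [contDiff_pi]
    rintro (j | j)
    · exact contDiff_const
    · exact contDiff_apply ℝ ℝ j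
  · have := h2 0 y
    simp only [Pi.zero_apply, sub_zero] at this
    linarith

lemma Ty.bounded {n : ℕ} {f : ℝ → ZZ d → ℝ} {a : ℕ} (h : Ty a 0 n f) : ∃ C, ∀ p z, |f p z| ≤ C := by
  obtain ⟨C, hC, h⟩ := h.bd
  refine ⟨C, fun p z => (h p z).trans ?_⟩
  have : lg z ^ 0 / wt z ^ a ≤ 1 := by
    rw [pow_zero]
    exact div_le_one_of_le₀ (one_le_pow₀ (one_le_wt z)) (pow_nonneg (wt_pos z).le _)
  nlinarith

lemma Ty.comp (k : ℕ) : ∀ {I : Type} [Fintype I] (f : (I → ℝ) → ℝ)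
    (_ : ContDiff ℝ k f) (X : I → ℝ → ZZ d → ℝ) (_ : ∀ i, Ty 0 0 k (X i)),
    Ty 0 0 k (fun p z => f (fun i => X i p z)) := by
  have hbd : ∀ (k : ℕ) {I : Type} [Fintype I] (f : (I → ℝ) → ℝ)
    (_ : Continuous f) (X : I → ℝ → ZZ d → ℝ) (_ : ∀ i, Ty 0 0 k (X i)),
    Bd 0 0 (fun p z => f (fun i => X i p z)) := by
    intro k I _ f hf X hX
    choose C hC using fun i => (hX i).bounded
    have hcomp : IsCompact (Set.univ.pi fun i => Set.Icc (-C i) (C i)) :=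
      isCompact_univ_pi fun i => isCompact_Icc
    obtain ⟨B, hB⟩ := hcomp.exists_bound_of_continuousOn hf.continuousOn
    refine Bd.of_le B fun p z => ?_
    simp only [pow_zero, div_one, mul_one]
    exact hB _ (fun i _ => abs_le.1 (hC i p z))
  induction k with
  | zero => intro I _ f hf X hX; exact Ty_zero (hbd 0 f hf.continuous X hX)
  | succ k ih =>
    classical
    intro I _ f hf X hX
    rw [Ty_succ]
    refine ⟨hbd _ f hf.continuous X hX, fun v => ?_⟩
    obtain ⟨F, h1, h2, _⟩ := hadamard k f (by exact_mod_cast hf)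
    have key : Ty (0 + 1) 0 k (fun p z => ∑ i, Df v (X i p) z *
        F i (fun j => Sum.elim (fun j p z => X j p z) (fun j p z => X j p (z + v)) j p z)) := by
      refine Ty.sum fun i _ => ?_
      have e1 := (hX i).df v
      have e2 := ih (F i) (h1 i)
        (fun j => Sum.elim (fun j p z => X j p z) (fun j p z => X j p (z + v)) j) (by
          rintro (j | j)
          · exact (hX j).mono le_rfl le_rfl (Nat.le_succ k)
          · exact ((hX j).mono le_rfl le_rfl (Nat.le_succ k)).shift v)
      exact e1.mul e2
    refine key.congr fun p z => ?_
    simp only [Df]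
    rw [h2]
    refine Finset.sum_congr rfl fun i _ => ?_
    congr 2
    funext j
    rcases j with j | j <;> rfl

end

section
variable {d : ℕ}

/-! ### Cutoff family -/

def sq2 (m : ZZ d) : ℝ := ∑ i, ((m i : ℤ) : ℝ) ^ 2

def rr (p : ℝ) : ℝ := |p| + 2

def cA (p : ℝ) (m : ZZ d) : ℝ := 1 / (rr p ^ 2 + sq2 m)

lemma two_le_rr (p : ℝ) : 2 ≤ rr p := by unfold rr; linarith [abs_nonneg p]

lemma abs_coord_le (m : ZZ d) (i : Fin d) : |((m i : ℤ) : ℝ)| ≤ ‖m‖ := by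
  have := norm_le_pi_norm m i
  rwa [Int.norm_eq_abs] at this

lemma sq2_nonneg (m : ZZ d) : 0 ≤ sq2 m := Finset.sum_nonneg fun _ _ => sq_nonneg _

lemma norm_sq_le_sq2 (m : ZZ d) : ‖m‖ ^ 2 ≤ sq2 m := by
  have h : ‖m‖ ≤ Real.sqrt (sq2 m) := by
    rw [pi_norm_le_iff_of_nonneg (Real.sqrt_nonneg _)]
    intro i
    rw [Int.norm_eq_abs]
    apply Real.abs_le_sqrt
    exact Finset.single_le_sum (f := fun i => ((m i : ℤ) : ℝ) ^ 2) (fun i _ => sq_nonneg _)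
      (Finset.mem_univ i)
  calc ‖m‖ ^ 2 ≤ Real.sqrt (sq2 m) ^ 2 := by gcongr
    _ = _ := Real.sq_sqrt (sq2_nonneg m)

lemma sq2_le (m : ZZ d) : sq2 m ≤ d * ‖m‖ ^ 2 := by
  calc sq2 m ≤ ∑ _i : Fin d, ‖m‖ ^ 2 := Finset.sum_le_sum fun i _ => by
        rw [← sq_abs]; gcongr; exact abs_coord_le m i
    _ = _ := by simp

lemma cA_den_pos (p : ℝ) (m : ZZ d) : 0 < rr p ^ 2 + sq2 m := by
  have := two_le_rr p; have := sq2_nonneg m; positivity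

lemma cA_den_ge (p : ℝ) (m : ZZ d) : wt m ^ 2 / 2 ≤ rr p ^ 2 + sq2 m := by
  have h1 := two_le_rr p
  have h2 := norm_sq_le_sq2 m
  unfold wt
  nlinarith [sq_nonneg (‖m‖ - 2)]

lemma cA_le (p : ℝ) (m : ZZ d) : cA p m ≤ 2 * (1 / wt m ^ 2) := by
  have h := cA_den_ge p m
  have h0 := wt_pos m
  unfold cA
  rw [mul_one_div, div_le_div_iff₀ (cA_den_pos p m) (by positivity)]
  linarith

lemma cA_nonneg (p : ℝ) (m : ZZ d) : 0 ≤ cA p m := by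
  unfold cA; have := cA_den_pos p m; positivity

lemma Df_cA (p : ℝ) (v m : ZZ d) : Df v (cA p) m =
    - ∑ i, (2 * (v i : ℝ)) * ((m i : ℝ) * cA p m * cA p (m + v)) -
      sq2 v * (cA p m * cA p (m + v)) := by
  have h1 := (cA_den_pos p m).ne'
  have h2 := (cA_den_pos p (m + v)).ne'
  have h3 : sq2 (m + v) = sq2 m + ∑ i, 2 * (v i : ℝ) * (m i : ℝ) + sq2 v := by
    simp only [sq2, ← Finset.sum_add_distrib]
    refine Finset.sum_congr rfl fun i _ => ?_
    simp only [Pi.add_apply]; push_cast; ring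
  have h4 : ∑ i, (2 * (v i : ℝ)) * ((m i : ℝ) * cA p m * cA p (m + v)) =
      (∑ i, 2 * (v i : ℝ) * (m i : ℝ)) * (cA p m * cA p (m + v)) := by
    rw [Finset.sum_mul]; refine Finset.sum_congr rfl fun i _ => by ring
  rw [h4]
  simp only [Df]
  have e1 : cA p (m + v) - cA p m = (sq2 m - sq2 (m + v)) * (cA p m * cA p (m + v)) := by
    unfold cA; field_simp; ring
  rw [e1, h3]; ring

lemma Ty_cA (M : ℕ) : Ty 2 0 M (cA : ℝ → ZZ d → ℝ) ∧
    ∀ i, Ty 1 0 M (fun p (m : ZZ d) => (m i : ℝ) * cA p m) := by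
  have b1 : Bd 2 0 (cA : ℝ → ZZ d → ℝ) := Bd.of_le 2 fun p m => by
    rw [abs_of_nonneg (cA_nonneg p m)]; simpa using cA_le p m
  have b2 : ∀ i, Bd 1 0 (fun p (m : ZZ d) => (m i : ℝ) * cA p m) := fun i => Bd.of_le 2 fun p m => by
    rw [abs_mul, abs_of_nonneg (cA_nonneg p m)]
    have h0 := wt_pos m
    calc |(m i : ℝ)| * cA p m ≤ wt m * (2 * (1 / wt m ^ 2)) :=
          mul_le_mul ((abs_coord_le m i).trans (by unfold wt; linarith)) (cA_le p m)
            (cA_nonneg p m) h0.le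
      _ = _ := by field_simp
  induction M with
  | zero => exact ⟨Ty_zero b1, fun i => Ty_zero (b2 i)⟩
  | succ M ih =>
    obtain ⟨ih1, ih2⟩ := ih
    have hD : ∀ v, Ty 3 0 M (fun p => Df v (cA (d := d) p)) := fun v => by
      have t1 : Ty 3 0 M (fun p (m : ZZ d) => ∑ i, (2 * (v i : ℝ)) *
          ((m i : ℝ) * cA p m * cA p (m + v))) := Ty.sum fun i _ =>
        Ty.const_mul _ (((ih2 i).mul (ih1.shift v)))
      have t2 : Ty 3 0 M (fun p (m : ZZ d) => sq2 v * (cA p m * cA p (m + v))) :=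
        Ty.const_mul _ ((ih1.mul (ih1.shift v)).mono (by norm_num) le_rfl le_rfl)
      exact (t1.neg.sub t2).congr fun p m => Df_cA p v m
    refine ⟨Ty_succ.2 ⟨b1, hD⟩, fun i => Ty_succ.2 ⟨b2 i, fun v => ?_⟩⟩
    have t0 : Ty 2 0 M (fun p (m : ZZ d) => (v i : ℝ) * cA p (m + v)) :=
      Ty.const_mul _ (ih1.shift v)
    have t3 : Ty 1 0 M (fun p (m : ZZ d) => (m i : ℝ) * cA p (m + v)) := by
      have := ((ih2 i).shift v).sub (t0.mono (show 1 ≤ 2 by norm_num) le_rfl le_rfl)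
      refine this.congr fun p m => ?_
      simp only [Pi.add_apply]; push_cast; ring
    have t1 : Ty 2 0 M (fun p (m : ZZ d) => ∑ j, (2 * (v j : ℝ)) *
          ((m j : ℝ) * cA p m * ((m i : ℝ) * cA p (m + v)))) := Ty.sum fun j _ =>
        Ty.const_mul _ (((ih2 j).mul t3))
    have t2 : Ty 2 0 M (fun p (m : ZZ d) => sq2 v * (cA p m * ((m i : ℝ) * cA p (m + v)))) :=
        Ty.const_mul _ ((ih1.mul t3).mono (by norm_num) le_rfl le_rfl)
    refine (t0.add (t1.neg.sub t2)).congr fun p m => ?_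
    have h := Df_cA p v m
    have e1 : Df v (fun m : ZZ d => (m i : ℝ) * cA p m) m =
        (v i : ℝ) * cA p (m + v) + (m i : ℝ) * Df v (cA p) m := by
      simp only [Df, Pi.add_apply]; push_cast; ring
    rw [e1, h, mul_sub, mul_neg, Finset.mul_sum]
    congr 2
    · congr 1
      refine Finset.sum_congr rfl fun j _ => by ring
    · ring

def cX (p : ℝ) (m : ZZ d) : ℝ := rr p ^ 2 * cA p m

lemma Ty_cX (M : ℕ) : Ty 0 0 M (cX : ℝ → ZZ d → ℝ) := by
  have b1 : Bd 0 0 (cX : ℝ → ZZ d → ℝ) := Bd.of_le 1 fun p m => by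
    have h := cA_den_pos p m
    have h2 := sq2_nonneg m
    have : cX p m = rr p ^ 2 / (rr p ^ 2 + sq2 m) := by unfold cX cA; ring
    rw [this, abs_of_nonneg (by positivity)]
    simp only [pow_zero, div_one, mul_one]
    exact div_le_one_of_le₀ (by linarith) h.le
  induction M with
  | zero => exact Ty_zero b1
  | succ M ih =>
    rw [Ty_succ]
    refine ⟨b1, fun v => ?_⟩
    obtain ⟨ih1, ih2⟩ := Ty_cA (d := d) M
    have t0 : ∀ i, Ty 2 0 M (fun p (m : ZZ d) => (v i : ℝ) * cA p (m + v)) := fun i =>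
      Ty.const_mul _ (ih1.shift v)
    have t3 : ∀ i, Ty 1 0 M (fun p (m : ZZ d) => (m i : ℝ) * cA p (m + v)) := fun i => by
      have := ((ih2 i).shift v).sub ((t0 i).mono (show 1 ≤ 2 by norm_num) le_rfl le_rfl)
      refine this.congr fun p m => ?_
      simp only [Pi.add_apply]; push_cast; ring
    have t1 : Ty 1 0 M (fun p (m : ZZ d) => ∑ j, (2 * (v j : ℝ)) *
          ((m j : ℝ) * cA p (m + v))) := Ty.sum fun j _ => Ty.const_mul _ (t3 j)
    have t2 : Ty 1 0 M (fun p (m : ZZ d) => sq2 v * cA p (m + v)) :=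
        Ty.const_mul _ ((ih1.shift v).mono (by norm_num) le_rfl le_rfl)
    refine (ih.mul (t1.neg.sub t2)).congr fun p m => ?_
    have e1 : Df v (cX p) m = rr p ^ 2 * Df v (cA p) m := by simp only [Df, cX]; ring
    rw [e1, Df_cA, cX, mul_sub, mul_sub, mul_neg, mul_neg, Finset.mul_sum, Finset.mul_sum]
    congr 1
    · congr 1
      refine Finset.sum_congr rfl fun j _ => by ring
    · ring

def cut (p : ℝ) (m : ZZ d) : ℝ := Real.smoothTransition (130 * (cX p m - 64 / 65))

lemma Ty_cut (M : ℕ) : Ty 0 0 M (cut : ℝ → ZZ d → ℝ) := by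
  have h1 : ContDiff ℝ M (fun y : Unit → ℝ => Real.smoothTransition (130 * (y () - 64 / 65))) := by
    refine Real.smoothTransition.contDiff.comp ?_
    fun_prop
  exact Ty.comp M _ h1 (fun _ => cX) (fun _ => Ty_cX M)

lemma cX_eq (p : ℝ) (m : ZZ d) : cX p m = rr p ^ 2 / (rr p ^ 2 + sq2 m) := by unfold cX cA; ring

lemma cut_ne_zero {p : ℝ} {m : ZZ d} (h : cut p m ≠ 0) : ‖m‖ < rr p / 8 := by
  by_contra hcon
  push Not at hcon
  apply h
  apply Real.smoothTransition.zero_of_nonpos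
  have h1 := norm_sq_le_sq2 m
  have h2 := two_le_rr p
  have h3 : cX p m ≤ 64 / 65 := by
    rw [cX_eq, div_le_div_iff₀ (cA_den_pos p m) (by norm_num)]
    nlinarith
  linarith

lemma cut_ne_one {p : ℝ} {m : ZZ d} (h : cut p m ≠ 1) : rr p ≤ 12 * d * ‖m‖ := by
  by_contra hcon
  push Not at hcon
  apply h
  apply Real.smoothTransition.one_of_one_le
  have h1 := sq2_le m
  have h2 := two_le_rr p
  have h3 : 129 / 130 ≤ cX p m := by
    rw [cX_eq, div_le_div_iff₀ (by norm_num) (cA_den_pos p m)]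
    have h5 : 0 ≤ 12 * d * ‖m‖ := by positivity
    have h4 : (12 * d * ‖m‖) ^ 2 ≤ rr p ^ 2 := by gcongr
    rcases Nat.eq_zero_or_pos d with h0 | h0
    · subst h0
      have : sq2 m ≤ 0 := by simpa using h1
      nlinarith
    · have : (1 : ℝ) ≤ d := by exact_mod_cast h0
      have h6 : (d : ℝ) * ‖m‖ ^ 2 ≤ d * (d * ‖m‖ ^ 2) :=
        le_mul_of_one_le_left (by positivity) this
      nlinarith
  linarith

lemma cut_nonneg (p : ℝ) (m : ZZ d) : 0 ≤ cut p m := Real.smoothTransition.nonneg _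
lemma cut_le_one (p : ℝ) (m : ZZ d) : cut p m ≤ 1 := Real.smoothTransition.le_one _

end

section
variable {d : ℕ}

/-! ### Discrete Taylor expansion -/

def eb (i : Fin d) : ZZ d := Pi.single i 1

/-- iterated differences in coordinate directions -/
def Db (is : List (Fin d)) (f : ZZ d → ℝ) : ZZ d → ℝ := Dl (is.map eb) f

lemma nn_le_iff {z : ZZ d} {k : ℕ} : nn z ≤ k ↔ ∀ i, (z i).natAbs ≤ k := by
  simp [nn, Finset.sup_le_iff]

lemma exists_path_aux (n : ℕ) : ∀ m : ZZ d, ∑ i, (m i).natAbs = n →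
    ∃ L : List (Fin d × ℝ × ZZ d), L.length = n ∧
      (∀ q ∈ L, |q.2.1| ≤ 1 ∧ nn q.2.2 ≤ nn m) ∧
      ∀ (f : ZZ d → ℝ) (z : ZZ d),
        f (z - m) - f z = (L.map (fun q => q.2.1 * Df (eb q.1) f (z - q.2.2))).sum := by
  induction n with
  | zero =>
    intro m hm
    have : m = 0 := by
      funext i
      have := (Finset.sum_eq_zero_iff.1 hm) i (Finset.mem_univ i)
      simpa using this
    subst this
    exact ⟨[], rfl, by simp, by simp⟩
  | succ n ih =>
    intro m hm
    have : ∃ i, m i ≠ 0 := by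
      by_contra hcon
      push Not at hcon
      simp [hcon] at hm
    obtain ⟨i, hi⟩ := this
    have hsum : ∀ m1 : ZZ d, (∀ j, j ≠ i → m1 j = m j) → (m1 i).natAbs + 1 = (m i).natAbs →
        ∑ j, (m1 j).natAbs = n := fun m1 h1 h2 => by
      rw [← Finset.add_sum_erase _ _ (Finset.mem_univ i)] at hm ⊢
      have : ∑ j ∈ Finset.univ.erase i, (m1 j).natAbs = ∑ j ∈ Finset.univ.erase i, (m j).natAbs :=
        Finset.sum_congr rfl fun j hj => by rw [h1 j (Finset.ne_of_mem_erase hj)]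
      omega
    have hnn : ∀ m1 : ZZ d, (∀ j, j ≠ i → m1 j = m j) → (m1 i).natAbs + 1 = (m i).natAbs →
        nn m1 ≤ nn m := fun m1 h1 h2 => by
      rw [nn_le_iff]
      intro j
      have hj : (m j).natAbs ≤ nn m := nn_le_iff.1 le_rfl j
      by_cases hji : j = i
      · subst hji; omega
      · rw [h1 j hji]; exact hj
    rcases lt_or_gt_of_ne hi with hneg | hpos
    · set m1 := m + eb i with hm1
      have h1 : ∀ j, j ≠ i → m1 j = m j := fun j hj => by simp [hm1, eb, hj]
      have h2 : (m1 i).natAbs + 1 = (m i).natAbs := by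
        have : m1 i = m i + 1 := by simp [hm1, eb]
        omega
      obtain ⟨L, hL1, hL2, hL3⟩ := ih m1 (hsum m1 h1 h2)
      refine ⟨(i, 1, m1) :: L, by simp [hL1], ?_, ?_⟩
      · intro q hq
        rcases List.mem_cons.1 hq with rfl | hq
        · exact ⟨by simp, hnn m1 h1 h2⟩
        · exact ⟨(hL2 q hq).1, (hL2 q hq).2.trans (hnn m1 h1 h2)⟩
      · intro f z
        rw [List.map_cons, List.sum_cons, ← hL3 f z]
        have : z - m1 + eb i = z - m := by rw [hm1]; abel
        simp only [Df, this]; ring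
    · set m1 := m - eb i with hm1
      have h1 : ∀ j, j ≠ i → m1 j = m j := fun j hj => by simp [hm1, eb, hj]
      have h2 : (m1 i).natAbs + 1 = (m i).natAbs := by
        have : m1 i = m i - 1 := by simp [hm1, eb]
        omega
      obtain ⟨L, hL1, hL2, hL3⟩ := ih m1 (hsum m1 h1 h2)
      refine ⟨(i, -1, m) :: L, by simp [hL1], ?_, ?_⟩
      · intro q hq
        rcases List.mem_cons.1 hq with rfl | hq
        · exact ⟨by simp, le_rfl⟩
        · exact ⟨(hL2 q hq).1, (hL2 q hq).2.trans (hnn m1 h1 h2)⟩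
      · intro f z
        rw [List.map_cons, List.sum_cons, ← hL3 f z]
        have : z - m + eb i = z - m1 := by rw [hm1]; abel
        simp only [Df, this]; ring

lemma exists_path (d : ℕ) : ∃ L : ZZ d → List (Fin d × ℝ × ZZ d),
    ∀ m, ((L m).length : ℝ) ≤ d * wt m ∧ (∀ q ∈ L m, |q.2.1| ≤ 1 ∧ ‖q.2.2‖ ≤ ‖m‖) ∧
      ∀ (f : ZZ d → ℝ) (z : ZZ d),
        f (z - m) - f z = ((L m).map (fun q => q.2.1 * Df (eb q.1) f (z - q.2.2))).sum := by
  choose L h1 h2 h3 using fun m : ZZ d => exists_path_aux _ m rfl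
  refine ⟨L, fun m => ⟨?_, fun q hq => ⟨(h2 m q hq).1, ?_⟩, h3 m⟩⟩
  · rw [h1 m]
    have : ∑ i, (m i).natAbs ≤ d * nn m := by
      calc ∑ i, (m i).natAbs ≤ ∑ _i : Fin d, nn m :=
            Finset.sum_le_sum fun i _ => nn_le_iff.1 le_rfl i
        _ = _ := by simp
    have h4 : ((∑ i, (m i).natAbs : ℕ) : ℝ) ≤ d * nn m := by exact_mod_cast this
    refine h4.trans ?_
    rw [wt_eq_nn]; gcongr; linarith
  · rw [norm_eq_nn, norm_eq_nn]; exact_mod_cast (h2 m q hq).2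

lemma list_sum_abs_le {α : Type*} (L : List α) (f : α → ℝ) (B : ℝ) (h : ∀ q ∈ L, |f q| ≤ B) :
    |(L.map f).sum| ≤ L.length * B := by
  induction L with
  | nil => simp
  | cons a L ih =>
    have h1 := ih (fun q hq => h q (List.mem_cons_of_mem _ hq))
    have h2 := h a List.mem_cons_self
    rw [List.map_cons, List.sum_cons, List.length_cons]
    push_cast
    have := abs_add_le (f a) (L.map f).sum
    linarith

lemma list_sum_finset {α κ : Type*} (L : List α) (s : Finset κ) (f : κ → α → ℝ) :
    ∑ k ∈ s, (L.map (f k)).sum = (L.map (fun q => ∑ k ∈ s, f k q)).sum := by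
  induction L with
  | nil => simp
  | cons a L ih => simp only [List.map_cons, List.sum_cons, ← ih, Finset.sum_add_distrib]

lemma list_sum_sub {α : Type*} (L : List α) (f g : α → ℝ) :
    (L.map f).sum - (L.map g).sum = (L.map (fun q => f q - g q)).sum := by
  induction L with
  | nil => simp
  | cons a L ih => simp only [List.map_cons, List.sum_cons, ← ih]; ring

lemma wt_mono {z w : ZZ d} (h : ‖z‖ ≤ ‖w‖) : wt z ≤ wt w := by unfold wt; linarith

theorem taylor (d s : ℕ) : ∃ (κ : Type) (_ : Fintype κ) (vs : κ → List (Fin d)) (γ : κ → ZZ d → ℝ)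
    (C : ℝ), 0 ≤ C ∧ (∀ k, (vs k).length < s) ∧ (∀ k m, |γ k m| ≤ C * wt m ^ (vs k).length) ∧
    ∀ (f : ZZ d → ℝ) (z m : ZZ d) (B : ℝ), 0 ≤ B →
      (∀ (is : List (Fin d)) (m' : ZZ d), is.length = s → ‖m'‖ ≤ ‖m‖ → |Db is f (z - m')| ≤ B) →
      |f (z - m) - ∑ k, γ k m * Db (vs k) f z| ≤ C * wt m ^ s * B := by
  classical
  induction s with
  | zero =>
    refine ⟨Empty, inferInstance, fun e => e.elim, fun e => e.elim, 1, zero_le_one,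
      fun e => e.elim, fun e => e.elim, fun f z m B _ h => ?_⟩
    simpa [Db, Dl] using h [] m rfl le_rfl
  | succ s ih =>
    obtain ⟨κ, _, vs, γ, C, hC, h1, h2, h3⟩ := ih
    obtain ⟨L, hL⟩ := exists_path d
    refine ⟨Unit ⊕ (Fin d × κ), inferInstance,
      Sum.elim (fun _ => []) (fun q => q.1 :: vs q.2),
      Sum.elim (fun _ _ => 1) (fun q m => ((L m).map (fun r =>
        if r.1 = q.1 then r.2.1 * γ q.2 r.2.2 else 0)).sum), 1 + d * C, by positivity, ?_, ?_, ?_⟩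
    · rintro (_ | q)
      · simp
      · simpa using h1 q.2
    · rintro (_ | q) m
      · simp; positivity
      · simp only [Sum.elim_inr, List.length_cons]
        have hw := wt_pos m
        have hb : ∀ r ∈ L m, |if r.1 = q.1 then r.2.1 * γ q.2 r.2.2 else 0| ≤
            C * wt m ^ (vs q.2).length := fun r hr => by
          obtain ⟨ha, hb⟩ := (hL m).2.1 r hr
          split_ifs
          · rw [abs_mul]
            have hwr := wt_pos r.2.2
            calc |r.2.1| * |γ q.2 r.2.2| ≤ 1 * (C * wt r.2.2 ^ (vs q.2).length) :=
                  mul_le_mul ha (h2 _ _) (abs_nonneg _) zero_le_one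
              _ ≤ _ := by rw [one_mul]; gcongr; exact wt_mono hb
          · rw [abs_zero]; positivity
        refine (list_sum_abs_le _ _ _ hb).trans ?_
        calc ((L m).length : ℝ) * (C * wt m ^ (vs q.2).length)
            ≤ (d * wt m) * (C * wt m ^ (vs q.2).length) := by
              gcongr; exact (hL m).1
          _ = d * C * wt m ^ ((vs q.2).length + 1) := by rw [pow_succ]; ring
          _ ≤ _ := by gcongr; linarith
    · intro f z m B hB0 hB
      have hw := wt_pos m
      have e0 : f (z - m) - ∑ k : Unit ⊕ (Fin d × κ), Sum.elim (fun _ _ => 1) (fun q m => ((L m).map (fun r =>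
          if r.1 = q.1 then r.2.1 * γ q.2 r.2.2 else 0)).sum) k m *
            Db (Sum.elim (fun _ => []) (fun q : Fin d × κ => q.1 :: vs q.2) k) f z =
          ((L m).map (fun r => r.2.1 * (Df (eb r.1) f (z - r.2.2) -
            ∑ k, γ k r.2.2 * Db (vs k) (Df (eb r.1) f) z))).sum := by
        rw [Fintype.sum_sum_type]
        simp only [Sum.elim_inl, Sum.elim_inr, Finset.univ_unique, Finset.sum_singleton, one_mul]
        have e1 : Db ([] : List (Fin d)) f z = f z := rfl
        have e2 : ∀ q : Fin d × κ, Db (q.1 :: vs q.2) f z = Db (vs q.2) (Df (eb q.1) f) z :=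
          fun q => rfl
        rw [e1, ← sub_sub, (hL m).2.2 f z]
        have e3 : ∀ q : Fin d × κ, ((L m).map (fun r =>
            if r.1 = q.1 then r.2.1 * γ q.2 r.2.2 else 0)).sum * Db (q.1 :: vs q.2) f z =
            ((L m).map (fun r => (if r.1 = q.1 then r.2.1 * γ q.2 r.2.2 else 0) *
              Db (vs q.2) (Df (eb q.1) f) z)).sum := fun q => by
          rw [e2, List.sum_map_mul_right]
        simp only [e3]
        rw [list_sum_finset, list_sum_sub]
        congr 2
        funext r
        rw [mul_sub, Fintype.sum_prod_type]
        congr 1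
        rw [Finset.sum_eq_single r.1]
        · simp only [if_true, Finset.mul_sum]
          exact Finset.sum_congr rfl fun k _ => by ring
        · intro i _ hi
          exact Finset.sum_eq_zero fun k _ => by simp [Ne.symm hi]
        · simp
      rw [e0]
      have hb : ∀ r ∈ L m, |r.2.1 * (Df (eb r.1) f (z - r.2.2) -
            ∑ k, γ k r.2.2 * Db (vs k) (Df (eb r.1) f) z)| ≤ C * wt m ^ s * B := fun r hr => by
        obtain ⟨ha, hb⟩ := (hL m).2.1 r hr
        have hwr := wt_pos r.2.2
        have := h3 (Df (eb r.1) f) z r.2.2 B hB0 (fun is m' his hm' =>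
          hB (r.1 :: is) m' (by simp [his]) (hm'.trans hb))
        rw [abs_mul]
        calc |r.2.1| * _ ≤ 1 * (C * wt r.2.2 ^ s * B) :=
              mul_le_mul ha this (abs_nonneg _) zero_le_one
          _ ≤ _ := by rw [one_mul]; gcongr; exact wt_mono hb
      refine (list_sum_abs_le _ _ _ hb).trans ?_
      calc ((L m).length : ℝ) * (C * wt m ^ s * B) ≤ (d * wt m) * (C * wt m ^ s * B) := by
            gcongr; exact (hL m).1
        _ = d * C * wt m ^ (s + 1) * B := by rw [pow_succ]; ring
        _ ≤ _ := by gcongr; linarith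

end

section
variable {d : ℕ}

/-! ### Convolutions -/

def conv (k h : ZZ d → ℝ) (z : ZZ d) : ℝ := ∑' m, k (z - m) * h m

def Bounded1 (k : ZZ d → ℝ) : Prop := ∃ C, ∀ x, |k x| ≤ C

lemma Bounded1.df {k : ZZ d → ℝ} (hk : Bounded1 k) (v : ZZ d) : Bounded1 (Df v k) := by
  obtain ⟨C, hC⟩ := hk
  refine ⟨C + C, fun x => ?_⟩
  have := abs_sub (k (x + v)) (k x)
  simp only [Df]; linarith [hC (x + v), hC x]

lemma summable_shift {h : ZZ d → ℝ} (hh : Summable h) (v : ZZ d) :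
    Summable (fun m => h (m + v)) := by
  have := (Equiv.addRight v).summable_iff (f := h)
  exact this.2 hh

lemma summable_df {h : ZZ d → ℝ} (hh : Summable h) (v : ZZ d) : Summable (Df v h) :=
  (summable_shift hh v).sub hh

lemma summable_bdd_mul {k h : ZZ d → ℝ} (hk : Bounded1 k) (hh : Summable h) (z : ZZ d) :
    Summable (fun m => k (z - m) * h m) := by
  obtain ⟨C, hC⟩ := hk
  refine Summable.of_norm_bounded (g := fun m => C * |h m|) (hh.abs.mul_left C) fun m => ?_
  rw [norm_mul]
  exact mul_le_mul_of_nonneg_right (hC _) (abs_nonneg _)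

lemma Df_conv {k h : ZZ d → ℝ} (hk : Bounded1 k) (hh : Summable h) (v : ZZ d) :
    Df v (conv k h) = conv (Df v k) h := by
  funext z
  simp only [Df, conv]
  rw [← (summable_bdd_mul hk hh (z + v)).tsum_sub (summable_bdd_mul hk hh z)]
  refine tsum_congr fun m => ?_
  rw [show z + v - m = z - m + v by abel]; ring

lemma conv_Df {k h : ZZ d → ℝ} (hk : Bounded1 k) (hh : Summable h) (v : ZZ d) :
    conv (Df v k) h = conv k (Df v h) := by
  rw [← Df_conv hk hh]
  funext z
  simp only [Df, conv]
  have e1 : ∑' m, k (z + v - m) * h m = ∑' m, k (z - m) * h (m + v) := by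
    rw [← (Equiv.addRight v).tsum_eq]
    refine tsum_congr fun m => ?_
    simp only [Equiv.coe_addRight]
    rw [show z + v - (m + v) = z - m by abel]
  rw [e1, ← (summable_bdd_mul hk (summable_shift hh v) z).tsum_sub (summable_bdd_mul hk hh z)]
  exact tsum_congr fun m => by ring

lemma Dl_conv {k h : ZZ d → ℝ} (hk : Bounded1 k) (hh : Summable h) (vs : List (ZZ d)) :
    Dl vs (conv k h) = conv (Dl vs k) h := by
  induction vs generalizing k with
  | nil => rfl
  | cons v vs ih => simp only [Dl]; rw [Df_conv hk hh, ih (hk.df v)]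

lemma conv_Dl {k h : ZZ d → ℝ} (hk : Bounded1 k) (hh : Summable h) (vs : List (ZZ d)) :
    conv (Dl vs k) h = conv k (Dl vs h) := by
  induction vs generalizing k h with
  | nil => rfl
  | cons v vs ih => simp only [Dl]; rw [ih (hk.df v) hh, conv_Df hk, ← Dl_Df]
                    · exact (by
                        clear ih
                        induction vs generalizing h with
                        | nil => exact hh
                        | cons w vs ih2 => exact ih2 (summable_df hh w))

lemma Bounded1.of_bd {a : ℕ} {k : ZZ d → ℝ} (h : Bd a 0 (fun _ => k)) : Bounded1 k := by
  obtain ⟨C, hC⟩ := (Ty_zero h).bounded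
  exact ⟨C, hC 0⟩

lemma Dl_support {h : ZZ d → ℝ} {ρ : ℝ} (hh : ∀ m, h m ≠ 0 → ρ ≤ wt m) (vs : List (ZZ d)) :
    ∀ m, Dl vs h m ≠ 0 → ρ ≤ wt m * (vs.map (fun v => 1 + ‖v‖)).prod := by
  induction vs with
  | nil => intro m hm; simpa using hh m hm
  | cons v vs ih =>
    intro m hm
    simp only [Dl, Dl_Df] at hm
    rw [List.map_cons, List.prod_cons]
    have hP : 0 ≤ (vs.map (fun v => 1 + ‖v‖)).prod := List.prod_nonneg (by
      intro a ha; obtain ⟨v, _, rfl⟩ := List.mem_map.1 ha; positivity)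
    have hw := wt_pos m
    by_cases h1 : Dl vs h (m + v) = 0
    · by_cases h2 : Dl vs h m = 0
      · exact absurd (by simp [Df, h1, h2]) hm
      · refine (ih m h2).trans ?_
        have : 0 ≤ ‖v‖ * (wt m * (vs.map (fun v => 1 + ‖v‖)).prod) := by positivity
        nlinarith
    · refine (ih _ h1).trans ?_
      have := wt_add_le m v
      calc wt (m + v) * (vs.map (fun v => 1 + ‖v‖)).prod
          ≤ wt m * (1 + ‖v‖) * (vs.map (fun v => 1 + ‖v‖)).prod := by gcongr
        _ = _ := by ring

lemma wt_neg (z : ZZ d) : wt (-z) = wt z := by simp [wt]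

lemma log_le_lg {z : ZZ d} {c ρ : ℝ} (hc : 1 ≤ c) (h1 : 0 < ρ) (h : ρ ≤ c * wt z) :
    1 + Real.log ρ ≤ c * lg z := by
  have hw := wt_pos z
  have h2 : Real.log ρ ≤ Real.log c + Real.log (wt z) := by
    rw [← Real.log_mul (by linarith) hw.ne']; exact Real.log_le_log h1 h
  have h3 := Real.log_le_sub_one_of_pos (show 0 < c by linarith)
  have h4 := one_le_lg z
  unfold lg at *
  nlinarith

/-- far-field convolution bound -/
lemma conv_far (hd : 1 ≤ d) (q : ℕ) (a : ℕ) (ha : a = d - 1 ∨ a = d) (c : ℝ) (hc : 0 < c) :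
    ∃ C : ℝ, 0 ≤ C ∧ ∀ (z : ZZ d) (k h : ZZ d → ℝ) (A B : ℝ), 0 ≤ A → 0 ≤ B →
      (∀ x, |k x| ≤ A * (1 / wt x ^ a)) →
      (∀ m, |h m| ≤ B * (1 / wt m ^ (d + (q + 1)))) → (∀ m, h m ≠ 0 → c * wt z ≤ wt m) →
      SumBd (fun m => k (z - m) * h m) (C * A * B * (lg z / wt z ^ (a + (q + 1)))) := by
  -- near sum
  have hS : ∃ C1 : ℝ, 0 ≤ C1 ∧ ∀ z : ZZ d,
      SumBd (fun m : ZZ d => if wt m ≤ 3 * wt z then 1 / wt m ^ a else 0)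
        (C1 * (lg z * wt z ^ (d - a))) := by
    rcases ha with rfl | rfl
    · obtain ⟨C1, h1, h2⟩ := S2 (d := d) hd
      refine ⟨C1 * 3, by positivity, fun z => (h2 (3 * wt z) (by linarith [wt_pos z])).le ?_⟩
      rw [show d - (d - 1) = 1 by omega, pow_one]
      have := one_le_lg z
      have hw := wt_pos z
      have : 0 ≤ C1 * 3 * wt z * (lg z - 1) := mul_nonneg (by positivity) (by linarith)
      nlinarith
    · obtain ⟨C1, h1, h2⟩ := S1 (d := a) hd
      refine ⟨C1 * 3, by positivity, fun z => (h2 (3 * wt z) (by linarith [two_le_wt z])).le ?_⟩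
      have hw := wt_pos z
      have := log_le_lg (z := z) (c := 3) (by norm_num) (by positivity) (le_refl (3 * wt z))
      rw [Nat.sub_self, pow_zero, mul_one, mul_assoc]
      gcongr
  obtain ⟨C1, hC1, h1⟩ := hS
  obtain ⟨C2, hC2, h2⟩ := S3 (d := d) hd q
  refine ⟨C1 * (1 / c) ^ (d + (q + 1)) + C2 * (1 / c) ^ (q + 1), by positivity,
    fun z k h A B hA hB hk hh hs => ?_⟩
  have hw := wt_pos z
  have hl := one_le_lg z
  -- near
  have n1 := ((h1 z).comp (fun m => z - m) (sub_right_injective)).const_mul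
    (A * B * (1 / (c * wt z) ^ (d + (q + 1))))
  have n2 := (h2 (c * wt z) (by positivity)).const_mul (A * B * (1 / wt z ^ a))
  have n3 := n1.add n2
  refine (n3.mono (fun m => ?_)).le ?_
  · have t1 : 0 ≤ A * B * (1 / (c * wt z) ^ (d + (q + 1))) := by positivity
    have t2 : 0 ≤ A * B * (1 / wt z ^ a) := by positivity
    have w1 := wt_pos (z - m)
    have w2 := wt_pos m
    have p1 : 0 ≤ (if wt (z - m) ≤ 3 * wt z then 1 / wt (z - m) ^ a else 0) := by
      split_ifs <;> positivity
    have p2 : 0 ≤ (if c * wt z ≤ wt m then 1 / wt m ^ (d + (q + 1)) else 0) := by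
      split_ifs <;> positivity
    rw [abs_of_nonneg (add_nonneg (mul_nonneg t1 p1) (mul_nonneg t2 p2)), abs_mul]
    by_cases hm : h m = 0
    · rw [hm, abs_zero, mul_zero]
      exact add_nonneg (mul_nonneg t1 p1) (mul_nonneg t2 p2)
    have hm2 := hs m hm
    have cw : 0 < c * wt z := by positivity
    by_cases hz : wt (z - m) ≤ 3 * wt z
    · refine le_trans ?_ (le_add_of_nonneg_right (mul_nonneg t2 p2))
      rw [if_pos hz]
      calc |k (z - m)| * |h m| ≤ (A * (1 / wt (z - m) ^ a)) * (B * (1 / wt m ^ (d + (q + 1)))) :=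
            mul_le_mul (hk _) (hh _) (abs_nonneg _) (by positivity)
        _ ≤ (A * (1 / wt (z - m) ^ a)) * (B * (1 / (c * wt z) ^ (d + (q + 1)))) := by gcongr
        _ = _ := by ring
    · refine le_trans ?_ (le_add_of_nonneg_left (mul_nonneg t1 p1))
      rw [if_pos hm2]
      have : wt z ≤ wt (z - m) := by linarith
      calc |k (z - m)| * |h m| ≤ (A * (1 / wt (z - m) ^ a)) * (B * (1 / wt m ^ (d + (q + 1)))) :=
            mul_le_mul (hk _) (hh _) (abs_nonneg _) (by positivity)
        _ ≤ (A * (1 / wt z ^ a)) * (B * (1 / wt m ^ (d + (q + 1)))) := by gcongr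
        _ = _ := by ring
  · rw [abs_of_nonneg (by positivity), abs_of_nonneg (by positivity)]
    have had : a ≤ d := by omega
    have e1 : A * B * (1 / (c * wt z) ^ (d + (q + 1))) * (C1 * (lg z * wt z ^ (d - a))) =
        C1 * (1 / c) ^ (d + (q + 1)) * A * B * (lg z / wt z ^ (a + (q + 1))) := by
      have : wt z ^ (d + (q + 1)) = wt z ^ (d - a) * wt z ^ (a + (q + 1)) := by
        rw [← pow_add]; congr 1; omega
      rw [mul_pow, this, one_div_pow]; field_simp
    have e2 : A * B * (1 / wt z ^ a) * (C2 * (1 / (c * wt z) ^ (q + 1))) =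
        C2 * (1 / c) ^ (q + 1) * A * B * (1 / wt z ^ (a + (q + 1))) := by
      rw [mul_pow, pow_add (wt z) a, one_div_pow]; field_simp
    rw [e1, e2]
    have e3 : C2 * (1 / c) ^ (q + 1) * A * B * (1 / wt z ^ (a + (q + 1))) ≤
      C2 * (1 / c) ^ (q + 1) * A * B * (lg z / wt z ^ (a + (q + 1))) := by gcongr
    linarith

end

section
variable {d : ℕ}

/-! ### Multipole expansion lemma -/

lemma bd_single {a n : ℕ} {f : ZZ d → ℝ} (h : Bd a n (fun _ => f)) :
    ∃ C, 0 ≤ C ∧ ∀ z, |f z| ≤ C * (lg z ^ n / wt z ^ a) := by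
  obtain ⟨C, hC, h⟩ := h; exact ⟨C, hC, h 0⟩

lemma bd_single0 {a : ℕ} {f : ZZ d → ℝ} (h : Bd a 0 (fun _ => f)) :
    ∃ C, 0 ≤ C ∧ ∀ z, |f z| ≤ C * (1 / wt z ^ a) := by
  simpa using bd_single h

/-- uniform bounds over the coordinate stencils -/
lemma unif_Db {a j : ℕ} {K : ZZ d → ℝ} (hK : ∀ M, Ty a 0 M (fun _ => K)) (vs : List (ZZ d))
    (hj : vs.length = j) (s : ℕ) :
    ∃ C, 0 ≤ C ∧ ∀ is : List (Fin d), is.length = s → ∀ z,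
      |Db is (Dl vs K) z| ≤ C * (1 / wt z ^ (a + j + s)) := by
  have h1 : ∀ is : List (Fin d), ∃ C, 0 ≤ C ∧ (is.length = s → ∀ z,
      |Db is (Dl vs K) z| ≤ C * (1 / wt z ^ (a + j + s))) := fun is => by
    by_cases his : is.length = s
    · have := hK _ (vs ++ is.map eb) le_rfl
      obtain ⟨C, hC, h⟩ := bd_single0 this
      refine ⟨C, hC, fun _ z => ?_⟩
      have := h z
      rw [Dl_append, List.length_append, List.length_map, hj, his, ← add_assoc] at this
      exact this
    · exact ⟨0, le_rfl, fun h => absurd h his⟩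
  choose C hC h using h1
  have hfin := List.finite_length_eq (Fin d) s
  refine ⟨∑ is ∈ hfin.toFinset, C is, Finset.sum_nonneg fun i _ => hC i, fun is his z => ?_⟩
  refine (h is his z).trans ?_
  have hw := wt_pos z
  gcongr
  exact Finset.single_le_sum (f := C) (fun i _ => hC i) (hfin.mem_toFinset.2 his)

lemma conv_sub_left {k k' h : ZZ d → ℝ} {z : ZZ d} (h1 : Summable (fun m => k (z - m) * h m))
    (h2 : Summable (fun m => k' (z - m) * h m)) :
    conv (fun x => k x - k' x) h z = conv k h z - conv k' h z := by
  simp only [conv, sub_mul]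
  exact h1.tsum_sub h2

theorem multipole_lemma (hd : 1 ≤ d) (q : ℕ) :
    ∃ (κ : Type) (_ : Fintype κ) (vs : κ → List (Fin d)), (∀ k, (vs k).length ≤ q) ∧
    ∀ F : ZZ d → ℝ, Bd (d + (q + 1)) 0 (fun _ => F) → ∃ c : κ → ℝ, ∀ M : ℕ,
      Ty (d + (q + 1)) 0 M (fun _ => F) → ∀ K : ZZ d → ℝ, (∀ M', Ty (d - 1) 0 M' (fun _ => K)) →
      Ty (d + q) 1 (M + 1) (fun _ z => conv K F z - ∑ k, c k * Db (vs k) K z) := by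
  classical
  obtain ⟨κ, _, ws, γ, Cγ, hCγ, hlen, hγ, htay⟩ := taylor d (q + 1)
  refine ⟨κ, inferInstance, ws, fun k => Nat.lt_succ_iff.1 (hlen k), fun F hF => ?_⟩
  obtain ⟨CF, hCF, hFb⟩ := bd_single0 hF
  -- moments
  have hmom : ∀ k m, |F m * γ k m| ≤ CF * Cγ * (1 / wt m ^ (d + ((q - (ws k).length) + 1))) :=
    fun k m => by
    have hw := wt_pos m
    have hl := Nat.lt_succ_iff.1 (hlen k)
    rw [abs_mul]
    calc |F m| * |γ k m| ≤ (CF * (1 / wt m ^ (d + (q + 1)))) * (Cγ * wt m ^ (ws k).length) :=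
          mul_le_mul (hFb m) (hγ k m) (abs_nonneg _) (by positivity)
      _ = _ := by
        have : wt m ^ (d + (q + 1)) = wt m ^ (d + ((q - (ws k).length) + 1)) *
            wt m ^ (ws k).length := by rw [← pow_add]; congr 1; omega
        rw [this]; field_simp
  have hmoms : ∀ k, Summable (fun m => F m * γ k m) := fun k =>
    Summable.of_norm_bounded (g := fun m => CF * Cγ * (1 / wt m ^ (d + ((q - (ws k).length) + 1))))
      ((summable_wt hd _).mul_left _) (hmom k)
  have hFs : Summable F := Summable.of_norm_bounded
    (g := fun m => CF * (1 / wt m ^ (d + (q + 1)))) ((summable_wt hd _).mul_left _) hFb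
  refine ⟨fun k => ∑' m, F m * γ k m, fun M hFM K hK us hus => ?_⟩
  set c : κ → ℝ := fun k => ∑' m, F m * γ k m with hc
  set j := us.length with hj
  set Kj := Dl us K with hKj
  have hKbdd : Bounded1 K := Bounded1.of_bd (hK 0).bd
  have hKjbd : Bd (d - 1 + j) 0 (fun _ => Kj) := hK j us le_rfl
  have hKjbdd : Bounded1 Kj := Bounded1.of_bd hKjbd
  obtain ⟨CK, hCK, hKb⟩ := unif_Db hK us hj.symm (q + 1)
  -- the three parts
  have hcut_s : ∀ p, Summable (fun m => cut p m * F m) := fun p =>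
    Summable.of_norm_bounded (g := fun m => |F m|) hFs.abs fun m => by
      rw [norm_mul, Real.norm_eq_abs, abs_of_nonneg (cut_nonneg p m)]
      exact mul_le_of_le_one_left (abs_nonneg _) (cut_le_one p m)
  have hcut_s2 : ∀ p, Summable (fun m => (1 - cut p m) * F m) := fun p =>
    (hFs.sub (hcut_s p)).congr fun m => by ring
  have hcut_m : ∀ p k, Summable (fun m => (1 - cut p m) * (F m * γ k m)) := fun p k =>
    Summable.of_norm_bounded (g := fun m => |F m * γ k m|) (hmoms k).abs fun m => by
      rw [norm_mul, Real.norm_eq_abs, abs_of_nonneg (by linarith [cut_le_one p m])]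
      exact mul_le_of_le_one_left (abs_nonneg _) (by linarith [cut_nonneg p m])
  have hcut_m1 : ∀ p k, Summable (fun m => cut p m * (F m * γ k m)) := fun p k =>
    ((hmoms k).sub (hcut_m p k)).congr fun m => by ring
  have hsplit : ∀ z, conv Kj F z - ∑ k, c k * Db (ws k) Kj z =
      (∑' m, cut ‖z‖ m * F m * (Kj (z - m) - ∑ k, γ k m * Db (ws k) Kj z)) +
      conv Kj (fun m => (1 - cut ‖z‖ m) * F m) z -
      ∑ k, Db (ws k) Kj z * ∑' m, (1 - cut ‖z‖ m) * (F m * γ k m) := fun z => by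
    have s1 := summable_bdd_mul hKjbdd (hcut_s ‖z‖) z
    have s2 := summable_bdd_mul hKjbdd (hcut_s2 ‖z‖) z
    have s3 : ∀ k ∈ (Finset.univ : Finset κ),
        Summable (fun m => Db (ws k) Kj z * (cut ‖z‖ m * (F m * γ k m))) :=
      fun k _ => (hcut_m1 ‖z‖ k).mul_left _
    have e1 : conv Kj F z = ∑' m, Kj (z - m) * (cut ‖z‖ m * F m) +
        conv Kj (fun m => (1 - cut ‖z‖ m) * F m) z := by
      simp only [conv]
      rw [← s1.tsum_add s2]
      exact tsum_congr fun m => by ring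
    have e2 : ∑' m, cut ‖z‖ m * F m * (Kj (z - m) - ∑ k, γ k m * Db (ws k) Kj z) =
        ∑' m, Kj (z - m) * (cut ‖z‖ m * F m) -
          ∑ k, Db (ws k) Kj z * ∑' m, cut ‖z‖ m * (F m * γ k m) := by
      have : ∀ k, Db (ws k) Kj z * ∑' m, cut ‖z‖ m * (F m * γ k m) =
          ∑' m, Db (ws k) Kj z * (cut ‖z‖ m * (F m * γ k m)) := fun k => tsum_mul_left.symm
      simp only [this]
      rw [← Summable.tsum_finsetSum s3, ← s1.tsum_sub (summable_sum s3)]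
      refine tsum_congr fun m => ?_
      rw [mul_sub, Finset.mul_sum]
      congr 1
      · ring
      · exact Finset.sum_congr rfl fun k _ => by ring
    have e3 : ∀ k, c k = ∑' m, cut ‖z‖ m * (F m * γ k m) +
        ∑' m, (1 - cut ‖z‖ m) * (F m * γ k m) := fun k => by
      rw [hc, ← (hcut_m1 ‖z‖ k).tsum_add (hcut_m ‖z‖ k)]
      exact tsum_congr fun m => by ring
    rw [e1, e2]
    simp only [e3, add_mul, Finset.sum_add_distrib]
    simp only [mul_comm (Db _ _ _)]
    ring
  have hrr : ∀ z : ZZ d, rr ‖z‖ = wt z := fun z => by simp [rr, wt]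
  have hDl : ∀ z, Dl us (fun z => conv K F z - ∑ k, c k * Db (ws k) K z) z =
      conv Kj F z - ∑ k, c k * Db (ws k) Kj z := fun z => by
    rw [Dl_sub, Dl_sum]
    have : Dl us (fun z => conv K F z) = conv (Dl us K) F := Dl_conv hKbdd hFs us
    simp only [this, Dl_const_mul]
    congr 1
    refine Finset.sum_congr rfl fun k _ => ?_
    simp only [Db]; rw [Dl_comm]
  -- bounds
  -- part 1
  have hP1 : Bd (d + q + j) 1 (fun _ z =>
      ∑' m, cut ‖z‖ m * F m * (Kj (z - m) - ∑ k, γ k m * Db (ws k) Kj z)) := by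
    obtain ⟨C1, hC1, h1⟩ := S1 (d := d) hd
    refine Bd.of_le (CF * Cγ * (CK * 2 ^ (d + q + j)) * (C1 * 2)) fun _ z => ?_
    have hwz := wt_pos z
    have h2 := (h1 (2 * wt z) (by linarith [two_le_wt z])).const_mul
      (CF * Cγ * (CK * (2 ^ (d + q + j) / wt z ^ (d + q + j))))
    rw [abs_of_nonneg (by positivity)] at h2
    have h3 : SumBd (fun m => cut ‖z‖ m * F m * (Kj (z - m) - ∑ k, γ k m * Db (ws k) Kj z)) _ :=
      h2.mono fun m => by
        have hwm := wt_pos m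
        by_cases hcm : cut ‖z‖ m = 0
        · rw [hcm, zero_mul, zero_mul, abs_zero]; exact abs_nonneg _
        have hnm := cut_ne_zero hcm
        rw [hrr] at hnm
        have hwm2 : wt m ≤ 2 * wt z := by
          have := two_le_wt z; unfold wt at *; linarith
        rw [if_pos hwm2, abs_mul, abs_mul, abs_of_nonneg (cut_nonneg _ _)]
        refine le_trans ?_ (le_abs_self _)
        have hT := htay Kj z m (CK * (2 ^ (d + q + j) / wt z ^ (d + q + j))) (by positivity)
          (fun is m' his hm' => by
            refine (hKb is his (z - m')).trans ?_
            have hww : wt z / 2 ≤ wt (z - m') := by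
              have : ‖z‖ - ‖m'‖ ≤ ‖z - m'‖ := norm_sub_norm_le z m'
              unfold wt at *; linarith [norm_nonneg m', norm_nonneg z]
            have hexp : d - 1 + j + (q + 1) = d + q + j := by omega
            rw [hexp]
            refine mul_le_mul_of_nonneg_left ?_ hCK
            rw [div_le_div_iff₀ (by have := wt_pos (z - m'); positivity) (by positivity),
              one_mul, ← mul_pow]
            gcongr
            linarith)
        calc cut ‖z‖ m * |F m| * _ ≤ (1 * (CF * (1 / wt m ^ (d + (q + 1))))) *
              (Cγ * wt m ^ (q + 1) * (CK * (2 ^ (d + q + j) / wt z ^ (d + q + j)))) := by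
              refine mul_le_mul (mul_le_mul (cut_le_one _ _) (hFb m) (abs_nonneg _) zero_le_one)
                hT (abs_nonneg _) (by positivity)
          _ = _ := by rw [pow_add (wt m) d]; field_simp
    refine h3.abs_tsum_le.trans ?_
    have hlog := log_le_lg (z := z) (c := 2) (by norm_num) (by positivity) (le_refl (2 * wt z))
    have hlz := lg_pos z
    calc _ ≤ CF * Cγ * (CK * (2 ^ (d + q + j) / wt z ^ (d + q + j))) * (C1 * (2 * lg z)) := by
          gcongr
      _ = _ := by rw [pow_one]; field_simp
  -- part 3
  have hsupp : ∀ z m, (1 - cut ‖z‖ m) ≠ 0 → 1 / (12 * d) * wt z ≤ wt m := fun z m h => by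
    have := cut_ne_one (p := ‖z‖) (m := m) (fun h' => h (by rw [h']; ring))
    rw [hrr] at this
    have hdpos : (0 : ℝ) < 12 * d := by
      have : (0 : ℝ) < d := by exact_mod_cast hd
      positivity
    rw [one_div_mul_eq_div, div_le_iff₀ hdpos]
    have : 12 * d * ‖m‖ ≤ 12 * d * wt m := by gcongr; unfold wt; linarith
    linarith
  have hcpos : (0 : ℝ) < 1 / (12 * d) := by
    have : (0 : ℝ) < d := by exact_mod_cast hd
    positivity
  have hP3 : Bd (d + q + j) 1 (fun _ z =>
      ∑ k, Db (ws k) Kj z * ∑' m, (1 - cut ‖z‖ m) * (F m * γ k m)) := by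
    have : ∀ k ∈ (Finset.univ : Finset κ), Ty (d + q + j) 1 0 (fun _ z =>
        Db (ws k) Kj z * ∑' m, (1 - cut ‖z‖ m) * (F m * γ k m)) := fun k _ => by
      apply Ty_zero
      obtain ⟨CK', hCK', hKb'⟩ := unif_Db hK us hj.symm (ws k).length
      obtain ⟨C3, hC3, h3⟩ := S3 (d := d) hd (q - (ws k).length)
      have hl := Nat.lt_succ_iff.1 (hlen k)
      have b1 : Bd (d - 1 + j + (ws k).length) 0 (fun _ => Db (ws k) Kj) :=
        Bd.of_le CK' fun _ z => by simpa using hKb' (ws k) rfl z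
      have b2 : Bd ((q - (ws k).length) + 1) 0
          (fun _ (z : ZZ d) => ∑' m, (1 - cut ‖z‖ m) * (F m * γ k m)) := by
        refine Bd.of_le (CF * Cγ * C3 * (12 * d) ^ ((q - (ws k).length) + 1)) fun _ z => ?_
        have hwz := wt_pos z
        have h4 := (h3 (1 / (12 * d) * wt z) (by positivity)).const_mul (CF * Cγ)
        rw [abs_of_nonneg (by positivity)] at h4
        have h5 : SumBd (fun m => (1 - cut ‖z‖ m) * (F m * γ k m)) _ := h4.mono fun m => by
          by_cases hcm : 1 - cut ‖z‖ m = 0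
          · rw [hcm, zero_mul, abs_zero]; exact abs_nonneg _
          have hwm := wt_pos m
          rw [if_pos (hsupp z m hcm), abs_mul, abs_of_nonneg (by linarith [cut_le_one ‖z‖ m]),
            abs_of_nonneg (a := CF * Cγ * _) (by positivity)]
          refine le_trans ?_ (hmom k m)
          exact mul_le_of_le_one_left (abs_nonneg _) (by linarith [cut_nonneg ‖z‖ m])
        refine h5.abs_tsum_le.trans (le_of_eq ?_)
        have hd0 : (d : ℝ) ≠ 0 := by
          have : (0 : ℝ) < d := by exact_mod_cast hd
          exact this.ne'
        rw [pow_zero, mul_pow, one_div_pow]; field_simp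
      exact (b1.mul b2).mono (by omega) (by omega)
    exact (Ty.sum this).bd
  -- part 2
  have hP2 : Bd (d + q + j) 1 (fun _ z => conv Kj (fun m => (1 - cut ‖z‖ m) * F m) z) := by
    rcases hus' : us with _ | ⟨v, vs⟩
    · -- no differences
      have hj0 : j = 0 := by rw [hj, hus']; rfl
      have hK0 : Kj = K := by rw [hKj, hus']; rfl
      obtain ⟨CK0, hCK0, hKb0⟩ := bd_single0 (hK 0).bd
      obtain ⟨C, hC, h⟩ := conv_far hd q (d - 1) (Or.inl rfl) _ hcpos
      refine Bd.of_le (C * CK0 * CF) fun _ z => ?_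
      have := (h z K (fun m => (1 - cut ‖z‖ m) * F m) CK0 CF hCK0 hCF hKb0 (fun m => by
        rw [abs_mul, abs_of_nonneg (by linarith [cut_le_one ‖z‖ m])]
        exact (mul_le_of_le_one_left (abs_nonneg _) (by linarith [cut_nonneg ‖z‖ m])).trans (hFb m))
        (fun m hm => hsupp z m (left_ne_zero_of_mul hm))).abs_tsum_le
      rw [hK0, hj0, pow_one]
      rw [show d + q + 0 = d - 1 + (q + 1) by omega]
      exact this
    · have hjl : j = vs.length + 1 := by rw [hj, hus']; rfl
      have hvs : vs.length ≤ M := by rw [hjl] at hus; omega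
      have hKK : Kj = Dl vs (Df v K) := by rw [hKj, hus']; rfl
      have hfam : Ty (d + (q + 1)) 0 M (fun p m => (1 - cut p m) * F m) := by
        have := ((Ty.const (d := d) (M := M) 1).sub (Ty_cut M)).mul hFM
        simpa using this
      obtain ⟨CD, hCD, hD⟩ := hfam vs hvs
      obtain ⟨CK0, hCK0, hKb0⟩ := bd_single0 (((hK 1).df v).bd)
      rw [show d - 1 + 1 = d by omega] at hKb0
      set P := (vs.map (fun v => 1 + ‖v‖)).prod with hP
      have hPpos : 0 < P := List.prod_pos (by
        intro a ha; obtain ⟨v, _, rfl⟩ := List.mem_map.1 ha; positivity)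
      obtain ⟨C, hC, h⟩ := conv_far hd (q + vs.length) d (Or.inr rfl) (1 / (12 * d) / P)
        (by positivity)
      refine Bd.of_le (C * CK0 * CD) fun _ z => ?_
      rw [hKK, conv_Dl (hKbdd.df v) (hcut_s2 ‖z‖)]
      have := (h z (Df v K) (Dl vs (fun m => (1 - cut ‖z‖ m) * F m)) CK0 CD hCK0 hCD hKb0
        (fun m => by
          have := hD ‖z‖ m
          rw [pow_zero, show d + (q + 1) + vs.length = d + (q + vs.length + 1) by ring] at this
          exact this)
        (fun m hm => by
          have := Dl_support (fun m hm => hsupp z m (left_ne_zero_of_mul hm)) vs m hm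
          rw [div_mul_eq_mul_div, div_le_iff₀ hPpos]
          exact this)).abs_tsum_le
      rw [pow_one, hjl, show d + q + (vs.length + 1) = d + (q + vs.length + 1) by ring]
      exact this
  exact ((hP1.add hP2).sub hP3).congr fun p z => by
    rw [← hsplit z]; exact hDl z

end

section
variable {d : ℕ}

/-- the linear lattice operator in coordinates -/
def Hz {I N : Type} [Fintype I] [Fintype N] (σ : I → ZZ d) (C : I → I → N → N → ℝ)
    (u : N → ZZ d → ℝ) (i : N) (z : ZZ d) : ℝ :=
  ∑ s, ∑ r, ∑ j, C s r i j * Df (-σ s) (Df (σ r) (u j)) z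

lemma tsum_by_parts {f g : ZZ d → ℝ} (v : ZZ d) (h1 : Summable fun z => f z * g z)
    (h2 : Summable fun z => f z * g (z + v)) :
    ∑' z, f z * Df v g z = ∑' z, Df (-v) f z * g z := by
  have h3 : Summable fun z => f (z - v) * g z := by
    have := (Equiv.addRight (-v)).summable_iff (f := fun z => f z * g (z + v))
    refine (this.2 h2).congr fun z => ?_
    simp [sub_eq_add_neg]
  have e : ∑' z, f z * g (z + v) = ∑' z, f (z - v) * g z := by
    rw [← (Equiv.addRight (-v)).tsum_eq (fun z => f z * g (z + v))]
    exact tsum_congr fun z => by simp [sub_eq_add_neg]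
  simp only [Df, mul_sub, sub_mul]
  rw [h2.tsum_sub h1, e, ← h3.tsum_sub h1]
  simp [sub_eq_add_neg]

lemma summable_finsupp_mul {f g : ZZ d → ℝ} (hf : f.support.Finite) :
    Summable fun z => f z * g z :=
  summable_of_finite_support (hf.subset fun z hz => by
    simp only [Function.mem_support] at hz ⊢; exact left_ne_zero_of_mul hz)

lemma Df_supp_finite {f : ZZ d → ℝ} (hf : f.support.Finite) (v : ZZ d) :
    (Df v f).support.Finite := by
  refine ((hf.image fun z => z - v).union hf).subset fun z hz => ?_
  by_contra hcon
  simp only [Set.mem_union, not_or, Function.mem_support, not_not, Set.mem_image, not_exists,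
    not_and] at hcon
  have h1 : f (z + v) = 0 := by
    by_contra h; exact hcon.1 (z + v) h (by abel)
  simp [Df, h1, hcon.2] at hz

lemma Df_by_parts {f : ZZ d → ℝ} (hf : f.support.Finite) (g : ZZ d → ℝ) (v : ZZ d) :
    ∑' z, f z * Df v g z = ∑' z, Df (-v) f z * g z :=
  tsum_by_parts v (summable_finsupp_mul hf) (summable_finsupp_mul hf)

section
variable {I N : Type} [Fintype I] [Fintype N] (σ : I → ZZ d) (C : I → I → N → N → ℝ)

lemma Hz_symm (hC : ∀ s r i j, C s r i j = C r s j i) (u f : N → ZZ d → ℝ)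
    (hf : ∀ i, (f i).support.Finite) :
    ∑' z, ∑ i, f i z * Hz σ C u i z = ∑' z, ∑ i, u i z * Hz σ C f i z := by
  have e1 : ∑' z, ∑ i, f i z * Hz σ C u i z =
      ∑ i, ∑ s, ∑ r, ∑ j, C s r i j * ∑' z, f i z * Df (-σ s) (Df (σ r) (u j)) z := by
    simp only [Hz, Finset.mul_sum, ← tsum_mul_left]
    have : ∀ i s r j, Summable fun z => C s r i j * (f i z * Df (-σ s) (Df (σ r) (u j)) z) :=
      fun i s r j => (summable_finsupp_mul (hf i)).mul_left _
    simp only [mul_left_comm (f _ _)]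
    rw [Summable.tsum_finsetSum fun i _ => summable_sum fun s _ => summable_sum fun r _ =>
      summable_sum fun j _ => this i s r j]
    refine Finset.sum_congr rfl fun i _ => ?_
    rw [Summable.tsum_finsetSum fun s _ => summable_sum fun r _ =>
      summable_sum fun j _ => this i s r j]
    refine Finset.sum_congr rfl fun s _ => ?_
    rw [Summable.tsum_finsetSum fun r _ => summable_sum fun j _ => this i s r j]
    refine Finset.sum_congr rfl fun r _ => ?_
    rw [Summable.tsum_finsetSum fun j _ => this i s r j]
  have e2 : ∑' z, ∑ i, u i z * Hz σ C f i z =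
      ∑ i, ∑ s, ∑ r, ∑ j, C s r i j * ∑' z, u i z * Df (-σ s) (Df (σ r) (f j)) z := by
    simp only [Hz, Finset.mul_sum, ← tsum_mul_left]
    have : ∀ i s r j, Summable fun z => C s r i j * (u i z * Df (-σ s) (Df (σ r) (f j)) z) :=
      fun i s r j => by
        have := summable_finsupp_mul (g := u i)
          (Df_supp_finite (Df_supp_finite (hf j) (σ r)) (-σ s))
        exact (this.mul_left _).congr fun z => by rw [mul_comm (u i z)]
    simp only [mul_left_comm (u _ _)]
    rw [Summable.tsum_finsetSum fun i _ => summable_sum fun s _ => summable_sum fun r _ =>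
      summable_sum fun j _ => this i s r j]
    refine Finset.sum_congr rfl fun i _ => ?_
    rw [Summable.tsum_finsetSum fun s _ => summable_sum fun r _ =>
      summable_sum fun j _ => this i s r j]
    refine Finset.sum_congr rfl fun s _ => ?_
    rw [Summable.tsum_finsetSum fun r _ => summable_sum fun j _ => this i s r j]
    refine Finset.sum_congr rfl fun r _ => ?_
    rw [Summable.tsum_finsetSum fun j _ => this i s r j]
  have e3 : ∀ i j s r, ∑' z, f i z * Df (-σ s) (Df (σ r) (u j)) z =
      ∑' z, u j z * Df (-σ r) (Df (σ s) (f i)) z := fun i j s r => by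
    rw [Df_by_parts (hf i), neg_neg, Df_by_parts (Df_supp_finite (hf i) _)]
    exact tsum_congr fun z => mul_comm _ _
  rw [e1, e2, show (∑ i, ∑ s, ∑ r, ∑ j, C s r i j * ∑' z, f i z * Df (-σ s) (Df (σ r) (u j)) z) =
    ∑ i, ∑ s, ∑ r, ∑ j, C r s j i * ∑' z, u j z * Df (-σ r) (Df (σ s) (f i)) z from
    Finset.sum_congr rfl fun i _ => Finset.sum_congr rfl fun s _ => Finset.sum_congr rfl fun r _ =>
      Finset.sum_congr rfl fun j _ => by rw [hC s r i j, e3]]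
  calc _ = ∑ i, ∑ j, ∑ s, ∑ r, C r s j i * ∑' z, u j z * Df (-σ r) (Df (σ s) (f i)) z := by
        refine Finset.sum_congr rfl fun i _ => ?_
        rw [Finset.sum_comm]
        conv_rhs => rw [Finset.sum_comm]
        conv_lhs => rw [Finset.sum_comm]
        exact Finset.sum_congr rfl fun s _ => Finset.sum_comm
    _ = ∑ j, ∑ i, ∑ r, ∑ s, C r s j i * ∑' z, u j z * Df (-σ r) (Df (σ s) (f i)) z := by
        rw [Finset.sum_comm]
        exact Finset.sum_congr rfl fun i _ => Finset.sum_congr rfl fun s _ => Finset.sum_comm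
    _ = _ := by
        refine Finset.sum_congr rfl fun j _ => ?_
        rw [Finset.sum_comm]
        exact Finset.sum_congr rfl fun i _ => Finset.sum_comm

lemma Hz_congr {f g : N → ZZ d → ℝ} {z : ZZ d} (i : N)
    (h : ∀ x : ZZ d, ‖x‖ ≤ 2 * ∑ s, ‖σ s‖ → ∀ j, f j (z + x) = g j (z + x)) :
    Hz σ C f i z = Hz σ C g i z := by
  have hs : ∀ s, ‖σ s‖ ≤ ∑ s, ‖σ s‖ := fun s =>
    Finset.single_le_sum (f := fun s => ‖σ s‖) (fun _ _ => norm_nonneg _) (Finset.mem_univ s)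
  have h0 : 0 ≤ ∑ s, ‖σ s‖ := Finset.sum_nonneg fun _ _ => norm_nonneg _
  unfold Hz
  refine Finset.sum_congr rfl fun s _ => Finset.sum_congr rfl fun r _ =>
    Finset.sum_congr rfl fun j _ => ?_
  have a1 := h (-σ s + σ r) ((norm_add_le _ _).trans (by
    rw [norm_neg]; linarith [hs s, hs r])) j
  have a2 := h (-σ s) (by rw [norm_neg]; linarith [hs s]) j
  have a3 := h (σ r) (by linarith [hs r]) j
  have a4 := h 0 (by rw [norm_zero]; linarith) j
  rw [add_zero] at a4
  simp only [Df, add_assoc, a1, a2, a3, a4]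

lemma Hz_df (u : N → ZZ d → ℝ) (w a : ZZ d) (i : N) (z : ZZ d) :
    Hz σ C (fun j z => Df w (u j) (z + a)) i z = Df w (Hz σ C u i) (z + a) := by
  have : Df w (Hz σ C u i) = fun z => ∑ s, ∑ r, ∑ j, C s r i j *
      Df (-σ s) (Df (σ r) (Df w (u j))) z := by
    funext z
    rw [Df]
    simp only [Hz, ← Finset.sum_sub_distrib, ← mul_sub]
    refine Finset.sum_congr rfl fun s _ => Finset.sum_congr rfl fun r _ =>
      Finset.sum_congr rfl fun j _ => ?_
    rw [Df_comm (σ r) w, Df_comm (-σ s) w]; rfl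
  rw [this]
  simp only [Hz, Df_shift]

lemma Hz_sub_const (u : N → ZZ d → ℝ) (c : N → ℝ) (i : N) (z : ZZ d) :
    Hz σ C (fun j z => u j z - c j) i z = Hz σ C u i z := by
  simp [Hz, Df]

lemma growth {f : ZZ d → ℝ} (hf : ∀ v, Tendsto (Df v f) cofinite (𝓝 0)) (ε : ℝ) (hε : 0 < ε) :
    ∃ B, ∀ z, |f z| ≤ B + ε * wt z := by
  classical
  -- radius beyond which unit differences are small
  have hfin : ({z | ∃ v ∈ box d 1, ε < |Df v f z|} : Set (ZZ d)).Finite := by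
    have : ({z | ∃ v ∈ box d 1, ε < |Df v f z|} : Set (ZZ d)) =
        ⋃ v ∈ box d 1, {z | ε < |Df v f z|} := by ext z; simp
    rw [this]
    refine Set.Finite.biUnion (Finset.finite_toSet _) fun v _ => ?_
    have := (hf v).eventually (Metric.ball_mem_nhds 0 hε)
    rw [eventually_cofinite] at this
    refine this.subset fun z hz => ?_
    simp only [Set.mem_setOf_eq, Metric.mem_ball, dist_zero_right, Real.norm_eq_abs, not_lt]
      at hz ⊢
    exact hz.le
  obtain ⟨n0, hn0⟩ : ∃ n0, ∀ z ∈ hfin.toFinset, nn z ≤ n0 :=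
    ⟨hfin.toFinset.sup nn, fun z hz => Finset.le_sup hz⟩
  set B := ∑ z ∈ box d (n0 + 1), |f z| with hB
  have key : ∀ n z, nn z = n → |f z| ≤ B + ε * n := by
    intro n
    induction n with
    | zero =>
      intro z hz
      have : |f z| ≤ B := Finset.single_le_sum (f := fun z => |f z|) (fun _ _ => abs_nonneg _)
        (mem_box.2 (by omega))
      simpa using this
    | succ n ih =>
      intro z hz
      by_cases hn : n + 1 ≤ n0 + 1
      · have : |f z| ≤ B := Finset.single_le_sum (f := fun z => |f z|) (fun _ _ => abs_nonneg _)
          (mem_box.2 (by omega))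
        have h2 : 0 ≤ ε * ((n + 1 : ℕ) : ℝ) := by positivity
        linarith
      · set v : ZZ d := fun i => (z i).sign with hv
        have hv1 : nn v ≤ 1 := nn_le_iff.2 fun i => by
          simp only [hv]; rcases lt_trichotomy (z i) 0 with h | h | h
          · rw [Int.sign_eq_neg_one_of_neg h]; simp
          · rw [h]; simp
          · rw [Int.sign_eq_one_of_pos h]; simp
        have hzi := nn_le_iff.1 hz.le
        have hle : nn (z - v) ≤ n := nn_le_iff.2 fun i => by
          have h3 := hzi i
          simp only [hv, Pi.sub_apply]
          rcases lt_trichotomy (z i) 0 with h | h | h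
          · rw [Int.sign_eq_neg_one_of_neg h]; omega
          · rw [h]; simp
          · rw [Int.sign_eq_one_of_pos h]; omega
        have hge : n ≤ nn (z - v) := by
          by_contra hlt
          push Not at hlt
          have h4 : nn z ≤ n := nn_le_iff.2 fun i => by
            have h5 := nn_le_iff.1 (le_refl (nn (z - v))) i
            have h6 := nn_le_iff.1 hv1 i
            simp only [Pi.sub_apply] at h5
            omega
          omega
        have hih := ih (z - v) (le_antisymm hle hge)
        have hsm : |Df v f (z - v)| ≤ ε := by
          by_contra hcon
          push Not at hcon
          have := hn0 (z - v) (hfin.mem_toFinset.2 ⟨v, mem_box.2 hv1, hcon⟩)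
          omega
        have : f z = f (z - v) + Df v f (z - v) := by simp [Df]
        rw [this]
        refine (abs_add_le _ _).trans ?_
        push_cast
        linarith
  refine ⟨B, fun z => (key _ z rfl).trans ?_⟩
  have : (nn z : ℝ) ≤ wt z := by rw [wt_eq_nn]; linarith
  have := mul_le_mul_of_nonneg_left this hε.le
  linarith

end

end

section
variable {d : ℕ}

section
variable {I N : Type} [Fintype I] [Fintype N] (σ : I → ZZ d) (C : I → I → N → N → ℝ)

lemma cut_supp_finite (p : ℝ) (f : ZZ d → ℝ) : (fun z => cut p z * f z).support.Finite := by
  refine (Finset.finite_toSet (box d ⌈rr p⌉₊)).subset fun z hz => ?_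
  have h1 : cut p z ≠ 0 := left_ne_zero_of_mul hz
  have h2 := cut_ne_zero h1
  simp only [Finset.mem_coe, mem_box]
  have h3 := Nat.le_ceil (rr p)
  rw [norm_eq_nn] at h2
  have h4 := two_le_rr p
  have : (nn z : ℝ) ≤ (⌈rr p⌉₊ : ℝ) := by linarith
  exact_mod_cast this

lemma tendsto_pair (hd : 1 ≤ d) (hC : ∀ s r i j, C s r i j = C r s j i) (u φ : N → ZZ d → ℝ)
    (hu : ∀ i, ∀ ε > 0, ∃ B, ∀ z, |u i z| ≤ B + ε * wt z)
    (hφ : ∀ i M, Ty (d - 1) 0 M (fun _ => φ i))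
    (hfin : ∀ i, (Hz σ C φ i).support.Finite) :
    Tendsto (fun n : ℕ => ∑' z, ∑ i, (cut n z * φ i z) * Hz σ C u i z) atTop
      (𝓝 (∑' z, ∑ i, u i z * Hz σ C φ i z)) := by
  classical
  set S0 : ℝ := 2 * ∑ s, ‖σ s‖ with hS
  have hS0 : 0 ≤ S0 := by
    have : 0 ≤ ∑ s, ‖σ s‖ := Finset.sum_nonneg fun _ _ => norm_nonneg _
    linarith
  set ψ : ℝ → N → ZZ d → ℝ := fun p i z => cut p z * φ i z with hψ
  have hfs : ∀ p i, (ψ p i).support.Finite := fun p i => cut_supp_finite p (φ i)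
  -- (a) uniform bound
  have ha : ∀ i, ∃ CH : ℝ, 0 ≤ CH ∧ ∀ p z, |Hz σ C (ψ p) i z| ≤ CH * (1 / wt z ^ (d + 1)) := by
    intro i
    have hT : ∀ j, Ty (d - 1) 0 2 (fun p => ψ p j) := fun j =>
      ((Ty_cut 2).mul (hφ j 2)).mono (by omega) le_rfl le_rfl
    have h2 : Bd (d + 1) 0 (fun p => Hz σ C (ψ p) i) := by
      have := (Ty.sum (s := Finset.univ) (M := 0) (a := d + 1) (n := 0)
        (f := fun s p z => ∑ r, ∑ j, C s r i j * Df (-σ s) (Df (σ r) (ψ p j)) z) fun s _ =>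
        Ty.sum fun r _ => Ty.sum fun j _ => Ty.const_mul _
          (Ty_zero ((hT j [σ r, -σ s] le_rfl).mono (by simp; omega) le_rfl))).bd
      exact this
    obtain ⟨CH, h3, h4⟩ := h2
    exact ⟨CH, h3, fun p z => by simpa using h4 p z⟩
  choose CH hCH ha using ha
  -- (b)
  have hb : ∀ p i z, Hz σ C (ψ p) i z ≠ Hz σ C φ i z → rr p ≤ 12 * d * (1 + S0) * wt z := by
    intro p i z h
    by_contra hcon
    push Not at hcon
    refine h (Hz_congr σ C i fun x hx j => ?_)
    have : cut p (z + x) = 1 := by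
      by_contra h1
      have h2 := cut_ne_one h1
      have h3 : ‖z + x‖ ≤ wt z * (1 + S0) := by
        have := wt_add_le z x
        have h4 : wt z * (1 + ‖x‖) ≤ wt z * (1 + S0) := by
          have := wt_pos z; gcongr
        have h5 : ‖z + x‖ ≤ wt (z + x) := by unfold wt; linarith
        linarith
      have h6 : 12 * (d : ℝ) * ‖z + x‖ ≤ 12 * d * (wt z * (1 + S0)) := by gcongr
      linarith
    simp [hψ, this]
  -- (c)
  have hc : ∀ p i z, Hz σ C (ψ p) i z ≠ 0 → wt z ≤ 2 * (1 + S0) * rr p := by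
    intro p i z h
    by_contra hcon
    push Not at hcon
    refine h ((Hz_congr (g := fun _ _ => 0) σ C i fun x hx j => ?_).trans (by simp [Hz, Df]))
    have : cut p (z + x) = 0 := by
      by_contra h1
      have h2 := cut_ne_zero h1
      have h3 := wt_le_add z x
      have h7 := two_le_rr p
      have h5 : wt (z + x) ≤ 2 * rr p := by unfold wt; linarith
      have h4 : wt (z + x) * (1 + ‖x‖) ≤ (2 * rr p) * (1 + S0) := by
        have := wt_pos (z + x); gcongr
      linarith
    simp [hψ, this]
  -- finite support of the limit
  obtain ⟨B0, hB0⟩ : ∃ B0 : ℝ, ∀ i z, Hz σ C φ i z ≠ 0 → wt z ≤ B0 := by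
    have : ∀ i, ∃ B : ℝ, ∀ z, Hz σ C φ i z ≠ 0 → wt z ≤ B := fun i => by
      refine ⟨∑ z ∈ (hfin i).toFinset, wt z, fun z hz => ?_⟩
      exact Finset.single_le_sum (f := fun z => wt z) (fun z _ => (wt_pos z).le)
        ((hfin i).mem_toFinset.2 hz)
    choose B hB using this
    refine ⟨∑ i, |B i|, fun i z hz => (hB i z hz).trans ((le_abs_self _).trans ?_)⟩
    exact Finset.single_le_sum (f := fun i => |B i|) (fun _ _ => abs_nonneg _) (Finset.mem_univ i)
  obtain ⟨C3, hC3, h3⟩ := S3 (d := d) hd 0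
  have hL : ∀ n : ℕ, ∑' z, ∑ i, (cut n z * φ i z) * Hz σ C u i z =
      ∑' z, ∑ i, u i z * Hz σ C (ψ n) i z := fun n => Hz_symm σ C hC u (ψ n) (hfs n)
  simp only [hL]
  have hs1 : ∀ (n : ℕ) i, Summable fun z => u i z * Hz σ C (ψ n) i z := fun n i => by
    refine summable_of_finite_support
      ((Finset.finite_toSet (box d ⌈2 * (1 + S0) * rr n⌉₊)).subset fun z hz => ?_)
    have h1 := hc n i z (right_ne_zero_of_mul hz)
    have h3 := Nat.le_ceil (2 * (1 + S0) * rr n)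
    rw [wt_eq_nn] at h1
    simp only [Finset.mem_coe, mem_box]
    have : (nn z : ℝ) ≤ (⌈2 * (1 + S0) * rr n⌉₊ : ℝ) := by linarith
    exact_mod_cast this
  have hs2 : ∀ i, Summable fun z => u i z * Hz σ C φ i z := fun i =>
    (summable_finsupp_mul (hfin i)).congr fun z => mul_comm _ _
  have hsum1 : ∀ n : ℕ, ∑' z, ∑ i, u i z * Hz σ C (ψ n) i z =
      ∑ i, ∑' z, u i z * Hz σ C (ψ n) i z := fun n =>
    Summable.tsum_finsetSum fun i _ => hs1 n i
  rw [Summable.tsum_finsetSum fun i _ => hs2 i]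
  simp only [hsum1]
  refine tendsto_finsetSum _ fun i _ => ?_
  rw [Metric.tendsto_atTop]
  intro δ hδ
  set c1 : ℝ := 12 * d * (1 + S0) with hc1
  set c2 : ℝ := 2 * (1 + S0) with hc2
  have hdpos : (0 : ℝ) < d := by exact_mod_cast hd
  have hc1p : 0 < c1 := by positivity
  have hc2p : 0 < c2 := by positivity
  set W : ℝ := CH i * (C3 * c1) + 1 with hW
  have hWp : 0 < W := by have := hCH i; positivity
  obtain ⟨B, hB⟩ := hu i (δ / (4 * W * c2)) (by positivity)
  obtain ⟨n0, hn0⟩ := exists_nat_gt (max (c1 * B0) (4 * W * |B| / δ))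
  refine ⟨n0, fun n hn => ?_⟩
  have hnn : (n0 : ℝ) ≤ rr n := by
    have : (n0 : ℝ) ≤ n := by exact_mod_cast hn
    unfold rr; rw [abs_of_nonneg (by positivity)]; linarith
  have hr1 : c1 * B0 < rr n := lt_of_lt_of_le ((le_max_left _ _).trans_lt hn0) hnn
  have hr2 : 4 * W * |B| / δ < rr n := lt_of_lt_of_le ((le_max_right _ _).trans_lt hn0) hnn
  have hrp : 0 < rr n := by linarith [two_le_rr n]
  rw [Real.dist_eq, ← (hs1 n i).tsum_sub (hs2 i)]
  have hbase := (h3 (rr n / c1) (by positivity)).const_mul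
    ((|B| + δ / (4 * W * c2) * (c2 * rr n)) * CH i)
  have hE : SumBd (fun z => u i z * Hz σ C (ψ n) i z - u i z * Hz σ C φ i z) _ :=
    hbase.mono fun z => by
      by_cases he : Hz σ C (ψ n) i z = Hz σ C φ i z
      · rw [he, sub_self, abs_zero]; exact abs_nonneg _
      have hz1 := hb n i z he
      have hz0 : Hz σ C φ i z = 0 := by
        by_contra h
        have := hB0 i z h
        have : c1 * wt z ≤ c1 * B0 := by gcongr
        linarith
      have hz2 := hc n i z (fun h => he (by rw [h, hz0]))
      rw [hz0, mul_zero, sub_zero, if_pos (by rw [div_le_iff₀ hc1p]; linarith), abs_mul]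
      refine le_trans ?_ (le_abs_self _)
      have hwz := wt_pos z
      have hCHi := hCH i
      calc |u i z| * |Hz σ C (ψ n) i z|
          ≤ (|B| + δ / (4 * W * c2) * (c2 * rr n)) * (CH i * (1 / wt z ^ (d + 1))) := by
            refine mul_le_mul ((hB z).trans ?_) (ha i n z) (abs_nonneg _) (by positivity)
            have := le_abs_self B
            gcongr
        _ = _ := by simp; ring
  refine hE.abs_tsum_le.trans_lt ?_
  have hCHi := hCH i
  rw [abs_of_nonneg (by positivity)]
  have e : (|B| + δ / (4 * W * c2) * (c2 * rr n)) * CH i * (C3 * (1 / (rr n / c1) ^ (0 + 1))) =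
      (|B| / rr n + δ / (4 * W)) * (CH i * (C3 * c1)) := by
    rw [zero_add, pow_one]; field_simp
  rw [e]
  have hB2 : |B| / rr n ≤ δ / (4 * W) := by
    rw [div_le_div_iff₀ hrp (by positivity)]
    rw [div_lt_iff₀ hδ] at hr2
    linarith
  calc (|B| / rr n + δ / (4 * W)) * (CH i * (C3 * c1)) ≤ (δ / (4 * W) + δ / (4 * W)) * W := by
        gcongr
        rw [hW]; linarith
    _ = δ / 2 := by field_simp; ring
    _ < δ := by linarith

end

end

section
variable {d : ℕ}

structure Green {I N : Type} [Fintype I] [Fintype N] [DecidableEq N] (σ : I → ZZ d)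
    (C : I → I → N → N → ℝ) (G : N → N → ZZ d → ℝ) : Prop where
  symm : ∀ s r i j, C s r i j = C r s j i
  ty : ∀ v i q M, Ty (d - 1) 0 M (fun _ => Df v (G i q))
  eq : ∀ k i z, Hz σ C (fun j => G j k) i z = if z = 0 ∧ i = k then 1 else 0

section
variable {I N : Type} [Fintype I] [Fintype N] [DecidableEq N] {σ : I → ZZ d}
  {C : I → I → N → N → ℝ} {G : N → N → ZZ d → ℝ}

lemma cut_zero (p : ℝ) : cut p (0 : ZZ d) = 1 := by
  by_contra h
  have := cut_ne_one h
  rw [norm_zero, mul_zero] at this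
  linarith [two_le_rr p]

lemma cut_eventually (z : ZZ d) : ∀ᶠ n : ℕ in atTop, cut (n : ℝ) z = 1 := by
  obtain ⟨n0, hn0⟩ := exists_nat_gt (12 * d * ‖z‖)
  filter_upwards [eventually_ge_atTop n0] with n hn
  by_contra h
  have := cut_ne_one h
  have h2 : (n0 : ℝ) ≤ n := by exact_mod_cast hn
  unfold rr at this
  rw [abs_of_nonneg (by positivity)] at this
  linarith

lemma green_test (hd : 1 ≤ d) (hG : Green σ C G) {u : N → ZZ d → ℝ}
    (hu : ∀ i v, Tendsto (Df v (u i)) cofinite (𝓝 0)) (i : N) (l v : ZZ d) :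
    Tendsto (fun n : ℕ => ∑' z, ∑ k, (cut n z * Df (-v) (G k i) (z + -l)) * Hz σ C u k z) atTop
      (𝓝 (Df v (u i) l)) := by
  set φ : N → ZZ d → ℝ := fun k z => Df (-v) (G k i) (z + -l) with hφ
  have hHφ : ∀ k z, Hz σ C φ k z =
      (if z = l + v ∧ k = i then 1 else 0) - (if z = l ∧ k = i then 1 else 0) := fun k z => by
    rw [hφ, Hz_df σ C (fun k => G k i) (-v) (-l) k z]
    simp only [Df, hG.eq]
    have h1 : z + -l + -v = 0 ↔ z = l + v := by
      constructor
      · intro h; have : z = (z + -l + -v) + (l + v) := by abel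
        rw [this, h, zero_add]
      · rintro rfl; abel
    have h2 : z + -l = 0 ↔ z = l := by rw [← sub_eq_add_neg, sub_eq_zero]
    simp only [h1, h2]
  have key := tendsto_pair σ C hd hG.symm (fun i z => u i z - u i 0) φ
    (fun i ε hε => growth (fun w => by
      have : Df w (fun z => u i z - u i 0) = Df w (u i) := by funext z; simp [Df]
      rw [this]; exact hu i w) ε hε)
    (fun k M => (hG.ty (-v) k i M).shift (-l))
    (fun k => by
      refine (Set.toFinite {l + v, l}).subset fun z hz => ?_
      by_contra hcon
      simp only [Set.mem_insert_iff, Set.mem_singleton_iff, not_or] at hcon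
      exact hz (by rw [hHφ]; simp [hcon.1, hcon.2]))
  have hsum : ∑' z, ∑ k, (u k z - u k 0) * Hz σ C φ k z = Df v (u i) l := by
    have : ∀ z, ∑ k, (u k z - u k 0) * Hz σ C φ k z =
        (if z = l + v then (u i z - u i 0) else 0) - (if z = l then (u i z - u i 0) else 0) := by
      intro z
      simp only [hHφ, mul_sub, Finset.sum_sub_distrib, ite_and]
      congr 1
      · by_cases h : z = l + v <;> simp [h]
      · by_cases h : z = l <;> simp [h]
    simp only [this]
    have hs : ∀ a : ZZ d, HasSum (fun z => if z = a then (u i z - u i 0) else 0)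
        (u i a - u i 0) := fun a => by
      have := hasSum_single (f := fun z => if z = a then (u i z - u i 0) else 0) a
        (fun z hz => if_neg hz)
      simpa using this
    rw [((hs (l + v)).sub (hs l)).tsum_eq]
    simp [Df]
  rw [hsum] at key
  simpa only [Hz_sub_const] using key

lemma tendsto_of_bd {a : ℕ} (ha : 1 ≤ a) {f : ZZ d → ℝ} (hf : Bd a 0 (fun _ => f)) :
    Tendsto f cofinite (𝓝 0) := by
  obtain ⟨B, hB, h⟩ := hf
  rw [Metric.tendsto_nhds]
  intro ε hε
  rw [eventually_cofinite]
  obtain ⟨n, hn⟩ := exists_nat_gt (B / ε)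
  refine (Finset.finite_toSet (box d n)).subset fun z hz => ?_
  simp only [Finset.mem_coe, mem_box]
  have hz2 : ε ≤ |f z| := by simpa using hz
  have h2 := h 0 z
  have hw := one_le_wt z
  have h3 : wt z ≤ wt z ^ a := by
    calc wt z = wt z ^ 1 := (pow_one _).symm
      _ ≤ _ := pow_le_pow_right₀ hw ha
  have h4 : B * (lg z ^ 0 / wt z ^ a) ≤ B / wt z := by
    rw [pow_zero, mul_one_div]; gcongr
  have h5 : ε ≤ B / wt z := by linarith
  rw [le_div_iff₀ (wt_pos z)] at h5
  rw [div_lt_iff₀ hε] at hn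
  rw [wt_eq_nn] at h5
  have : ε * nn z < ε * n := by nlinarith
  have := lt_of_mul_lt_mul_left this hε.le
  have : nn z < n := by exact_mod_cast this
  omega

lemma green_refl (hd : 2 ≤ d) (hG : Green σ C G) (i j : N) (x v : ZZ d) :
    Df v (G i j) x = G j i (-x - v) - G j i (-x) := by
  have h1 := green_test (by omega) hG (u := fun k => G k j)
    (fun k w => tendsto_of_bd (by omega) (hG.ty w k j 0).bd) i x v
  have h2 : ∀ n : ℕ, ∑' z, ∑ k, (cut n z * Df (-v) (G k i) (z + -x)) *
      Hz σ C (fun k => G k j) k z = G j i (-x - v) - G j i (-x) := fun n => by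
    rw [tsum_eq_single 0]
    · simp [hG.eq, cut_zero, Df, sub_eq_add_neg]
    · intro z hz
      simp [hG.eq, hz]
  simp only [h2] at h1
  exact (tendsto_nhds_unique h1 tendsto_const_nhds)

theorem green_repr (hd : 2 ≤ d) (hG : Green σ C G) {u : N → ZZ d → ℝ}
    (hu : ∀ i v, Tendsto (Df v (u i)) cofinite (𝓝 0)) (F : I → N → ZZ d → ℝ)
    (hF : ∀ s q, Summable (F s q))
    (hH : ∀ i z, Hz σ C u i z = ∑ s, Df (-σ s) (F s i) z) (i : N) (z : ZZ d) :
    u i z = (u i 0 - ∑ s, ∑ q, conv (Df (-σ s) (G i q)) (F s q) 0) +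
      ∑ s, ∑ q, conv (Df (-σ s) (G i q)) (F s q) z := by
  set φ : N → ZZ d → ℝ := fun k m => Df (-z) (G k i) (m + -0) with hφ
  have h1 := green_test (by omega) hG hu i 0 z
  have hb : ∀ s k, ∃ B, ∀ (n : ℕ) m, |Df (σ s) (fun m => cut n m * φ k m) m| ≤ B := fun s k => by
    have hT : Ty (d - 1) 0 1 (fun p m => cut p m * φ k m) :=
      ((Ty_cut 1).mul ((hG.ty (-z) k i 1).shift (-0))).mono (by omega) le_rfl le_rfl
    obtain ⟨B, hB, h⟩ := (hT.df (σ s)).bd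
    refine ⟨B, fun n m => (h n m).trans ?_⟩
    have := one_le_wt m
    rw [pow_zero]
    refine mul_le_of_le_one_right hB ?_
    rw [div_le_one (by positivity)]
    exact one_le_pow₀ this
  have h2 : ∀ n : ℕ, ∑' m, ∑ k, (cut n m * φ k m) * Hz σ C u k m =
      ∑ k, ∑ s, ∑' m, Df (σ s) (fun m => cut n m * φ k m) m * F s k m := fun n => by
    simp only [hH, Finset.mul_sum]
    have hsm : ∀ k s, Summable fun m => cut n m * φ k m * Df (-σ s) (F s k) m := fun k s =>
      summable_finsupp_mul (cut_supp_finite n (φ k))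
    rw [Summable.tsum_finsetSum fun k _ => summable_sum fun s _ => hsm k s]
    refine Finset.sum_congr rfl fun k _ => ?_
    rw [Summable.tsum_finsetSum fun s _ => hsm k s]
    refine Finset.sum_congr rfl fun s _ => ?_
    rw [Df_by_parts (cut_supp_finite n (φ k)), neg_neg]
  have h3 : Tendsto (fun n : ℕ => ∑ k, ∑ s, ∑' m, Df (σ s) (fun m => cut n m * φ k m) m * F s k m)
      atTop (𝓝 (∑ k, ∑ s, ∑' m, Df (σ s) (φ k) m * F s k m)) := by
    refine tendsto_finsetSum _ fun k _ => tendsto_finsetSum _ fun s _ => ?_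
    obtain ⟨B, hB⟩ := hb s k
    refine tendsto_tsum_of_dominated_convergence (bound := fun m => B * |F s k m|)
      ((hF s k).abs.mul_left B) (fun m => ?_) (Eventually.of_forall fun n m => ?_)
    · refine tendsto_const_nhds.congr' ?_
      filter_upwards [cut_eventually m, cut_eventually (m + σ s)] with n e1 e2
      simp [Df, e1, e2]
    · rw [norm_mul, Real.norm_eq_abs, Real.norm_eq_abs]
      exact mul_le_mul_of_nonneg_right (hB n m) (abs_nonneg _)
  simp only [← h2] at h3
  have h4 := tendsto_nhds_unique h1 h3
  have h5 : ∀ k s, ∑' m, Df (σ s) (φ k) m * F s k m =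
      conv (Df (-σ s) (G i k)) (F s k) z - conv (Df (-σ s) (G i k)) (F s k) 0 := fun k s => by
    have hbd : Bounded1 (Df (-σ s) (G i k)) := Bounded1.of_bd (hG.ty (-σ s) i k 0).bd
    simp only [conv]
    rw [← (summable_bdd_mul hbd (hF s k) z).tsum_sub (summable_bdd_mul hbd (hF s k) 0)]
    refine tsum_congr fun m => ?_
    rw [← sub_mul]
    congr 1
    rw [green_refl hd hG, green_refl hd hG]
    simp only [hφ, Df]
    have e1 : m + σ s + -0 + -z = -(z - m) - -σ s := by abel
    have e2 : m + σ s + -0 = -(0 - m) - -σ s := by abel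
    have e3 : m + -0 + -z = -(z - m) := by abel
    have e4 : m + -0 = -(0 - m) := by abel
    rw [e1, e2, e3, e4]; ring
  simp only [h5, Finset.sum_sub_distrib] at h4
  rw [Finset.sum_comm (f := fun k s => conv (Df (-σ s) (G i k)) (F s k) z),
    Finset.sum_comm (f := fun k s => conv (Df (-σ s) (G i k)) (F s k) 0)] at h4
  have h6 : Df z (u i) 0 = u i z - u i 0 := by simp [Df]
  rw [h6] at h4
  linarith

end

end

section
variable {d : ℕ}

lemma tail_small {f : ZZ d → ℝ} (hf : Summable f) (h0 : ∀ z, 0 ≤ f z) (τ : ℝ) (hτ : 0 < τ) :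
    ∃ R : ℝ, 0 < R ∧ Summable (fun z => if R ≤ wt z then f z else 0) ∧
      ∑' z, (if R ≤ wt z then f z else 0) ≤ τ := by
  obtain ⟨s, hs⟩ := (summable_iff_vanishing_norm.1 hf) τ hτ
  refine ⟨∑ z ∈ s, wt z + 1, ?_, ?_, ?_⟩
  · have : 0 ≤ ∑ z ∈ s, wt z := Finset.sum_nonneg fun z _ => (wt_pos z).le
    linarith
  · refine Summable.of_nonneg_of_le (fun z => ?_) (fun z => ?_) hf
    · split_ifs <;> [exact h0 z; exact le_rfl]
    · split_ifs <;> [exact le_rfl; exact h0 z]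
  · refine Real.tsum_le_of_sum_le (fun z => ?_) fun A => ?_
    · split_ifs <;> [exact h0 z; exact le_rfl]
    rw [← Finset.sum_filter]
    have hdis : Disjoint (A.filter fun z => ∑ z ∈ s, wt z + 1 ≤ wt z) s := by
      rw [Finset.disjoint_left]
      intro z hz hzs
      have h1 := (Finset.mem_filter.1 hz).2
      have h2 : wt z ≤ ∑ z ∈ s, wt z :=
        Finset.single_le_sum (f := fun z => wt z) (fun z _ => (wt_pos z).le) hzs
      linarith
    have := hs _ hdis
    exact (le_abs_self _).trans this.le

theorem initial_decay (hd : 1 ≤ d) {ω χ : ZZ d → ℝ} (hω0 : ∀ z, 0 ≤ ω z) (hχ0 : ∀ z, 0 ≤ χ z)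
    (hω : Summable fun z => ω z ^ 2) (hχ : χ.support.Finite) {C : ℝ} (hC : 0 ≤ C)
    (h : ∀ z, ω z ≤ C * ∑' m, 1 / wt (z - m) ^ d * (ω m ^ 2 + χ m)) :
    ∃ C', 0 ≤ C' ∧ ∀ z, ω z ≤ C' * (1 / wt z ^ d) := by
  have hχs : Summable χ := summable_of_hasFiniteSupport hχ
  have hχs2 : Summable fun z => χ z * wt z ^ d := summable_finsupp_mul hχ
  obtain ⟨W, hW⟩ : ∃ W, ∀ z, ω z ≤ W := by
    refine ⟨∑' z, ω z ^ 2 + 1, fun z => ?_⟩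
    have := hω.le_tsum z (fun _ _ => sq_nonneg _)
    nlinarith [sq_nonneg (ω z - 1)]
  have hs2d := summable_wt (d := d) hd (d - 1)
  have hs2d' : ∀ z : ZZ d, HasSum (fun m => 1 / wt (z - m) ^ (d + (d - 1 + 1)))
      (∑' m : ZZ d, 1 / wt m ^ (d + (d - 1 + 1))) := fun z =>
    (Equiv.subLeft z).hasSum_iff (f := fun m : ZZ d => 1 / wt m ^ (d + (d - 1 + 1)))
      |>.2 hs2d.hasSum
  set A2 : ℝ := ∑' m : ZZ d, 1 / wt m ^ (d + (d - 1 + 1)) with hA2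
  have hA20 : 0 ≤ A2 := tsum_nonneg fun m => by have := wt_pos m; positivity
  set η : ℝ := 1 / (2 * (C * 2 ^ d * A2 + 1)) with hη
  have hηp : 0 < η := by positivity
  obtain ⟨R, hR, hts, htl⟩ := tail_small hω (fun z => sq_nonneg _) (η / (2 * (C * 2 ^ d + 1)))
    (by positivity)
  set τ := ∑' z, (if R ≤ wt z then ω z ^ 2 else 0) with hτ
  set C1 : ℝ := C * (4 ^ d * ((∑' z, ω z ^ 2) + ∑' z, χ z) + 2 ^ d * ∑' z, χ z * wt z ^ d) +
    |W| * (2 * R) ^ d with hC1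
  have ht0 : 0 ≤ ∑' z, ω z ^ 2 := tsum_nonneg fun z => sq_nonneg _
  have ht1 : 0 ≤ ∑' z, χ z := tsum_nonneg hχ0
  have ht2 : 0 ≤ ∑' z, χ z * wt z ^ d := tsum_nonneg fun z => by
    have := wt_pos z; have := hχ0 z; positivity
  have hC10 : 0 ≤ C1 := by positivity
  have key : ∀ T : ℝ, 0 < T → ∀ z, ω z * min (wt z ^ d) T ≤ 2 * C1 := by
    intro T hT
    set S := ⨆ z, ω z * min (wt z ^ d) T with hS
    have hbdd : BddAbove (Set.range fun z => ω z * min (wt z ^ d) T) := by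
      refine ⟨|W| * T, ?_⟩
      rintro _ ⟨z, rfl⟩
      have := wt_pos z
      exact mul_le_mul ((hW z).trans (le_abs_self _)) (min_le_right _ _)
        (le_min (by positivity) hT.le) (abs_nonneg _)
    have hle : ∀ z, ω z * min (wt z ^ d) T ≤ S := fun z => le_ciSup hbdd z
    have hv0 : ∀ z : ZZ d, 0 ≤ min (wt z ^ d) T := fun z => by
      have := wt_pos z; exact le_min (by positivity) hT.le
    have hS0 : 0 ≤ S := (mul_nonneg (hω0 0) (hv0 0)).trans (hle 0)
    have hstep : ∀ z, ω z * min (wt z ^ d) T ≤ C1 + S / 2 := by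
      intro z
      have hwz := wt_pos z
      by_cases hz : wt z < 2 * R
      · have h1 : ω z * min (wt z ^ d) T ≤ |W| * (2 * R) ^ d := by
          refine mul_le_mul ((hW z).trans (le_abs_self _)) ((min_le_left _ _).trans ?_) (hv0 z)
            (abs_nonneg _)
          gcongr
        have h2 : 0 ≤ C * (4 ^ d * ((∑' z, ω z ^ 2) + ∑' z, χ z) +
          2 ^ d * ∑' z, χ z * wt z ^ d) := by positivity
        rw [hC1]
        linarith
      push Not at hz
      set v := min (wt z ^ d) T with hv
      have hpt : ∀ m, v * (1 / wt (z - m) ^ d * (ω m ^ 2 + χ m)) ≤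
          (4 ^ d * (ω m ^ 2 + χ m) + 2 ^ d * (χ m * wt m ^ d)) +
          2 ^ d * S * (η / 2 * (1 / wt (z - m) ^ (d + (d - 1 + 1))) +
            1 / (2 * η) * (if R ≤ wt m then ω m ^ 2 else 0)) := by
        intro m
        have hwm := wt_pos m
        have hwzm := wt_pos (z - m)
        have hχm := hχ0 m
        have hωm := hω0 m
        by_cases hm : wt z / 4 ≤ wt (z - m)
        · have h1 : v * (1 / wt (z - m) ^ d) ≤ 4 ^ d := by
            rw [mul_one_div, div_le_iff₀ (by positivity), ← mul_pow]
            refine (min_le_left _ _).trans ?_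
            gcongr
            linarith
          have h2 : v * (1 / wt (z - m) ^ d * (ω m ^ 2 + χ m)) ≤ 4 ^ d * (ω m ^ 2 + χ m) := by
            rw [← mul_assoc]; gcongr
          have h3 : 0 ≤ 2 ^ d * (χ m * wt m ^ d) := by positivity
          have h4 : 0 ≤ 2 ^ d * S * (η / 2 * (1 / wt (z - m) ^ (d + (d - 1 + 1))) +
            1 / (2 * η) * (if R ≤ wt m then ω m ^ 2 else 0)) := by
            have : (0:ℝ) ≤ (if R ≤ wt m then ω m ^ 2 else 0) := by split_ifs <;> positivity
            positivity
          linarith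
        · push Not at hm
          have hmz : wt z ≤ 2 * wt m := by
            have : ‖z‖ ≤ ‖z - m‖ + ‖m‖ := by simpa using norm_add_le (z - m) m
            unfold wt at *; linarith [norm_nonneg m]
          have hvm : v ≤ 2 ^ d * min (wt m ^ d) T := by
            rw [hv, mul_min_of_nonneg _ _ (by positivity : (0:ℝ) ≤ 2 ^ d), ← mul_pow]
            refine min_le_min (by gcongr) ?_
            exact le_mul_of_one_le_left hT.le (one_le_pow₀ (by norm_num))
          have hone : 1 / wt (z - m) ^ d ≤ 1 := by
            rw [div_le_one (by positivity)]; exact one_le_pow₀ (one_le_wt _)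
          have hχpart : v * (1 / wt (z - m) ^ d * χ m) ≤ 2 ^ d * (χ m * wt m ^ d) := by
            have h5 : v ≤ 2 ^ d * wt m ^ d :=
              hvm.trans (by gcongr; exact min_le_left _ _)
            calc v * (1 / wt (z - m) ^ d * χ m) ≤ (2 ^ d * wt m ^ d) * (1 * χ m) := by
                  gcongr
              _ = _ := by ring
          rw [if_pos (by linarith)]
          have hamgm : 1 / wt (z - m) ^ d * ω m ≤
              η / 2 * (1 / wt (z - m) ^ (d + (d - 1 + 1))) + 1 / (2 * η) * ω m ^ 2 := by
            have e : 1 / wt (z - m) ^ (d + (d - 1 + 1)) = (1 / wt (z - m) ^ d) ^ 2 := by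
              rw [show d + (d - 1 + 1) = d * 2 by omega, pow_mul, one_div_pow]
            rw [e]
            set a := 1 / wt (z - m) ^ d
            have : 0 ≤ 1 / (2 * η) * (η * a - ω m) ^ 2 := by positivity
            have e2 : 1 / (2 * η) * (η * a - ω m) ^ 2 =
                η / 2 * a ^ 2 + 1 / (2 * η) * ω m ^ 2 - a * ω m := by
              field_simp; ring
            linarith
          have hωpart : v * (1 / wt (z - m) ^ d * ω m ^ 2) ≤
              2 ^ d * S * (η / 2 * (1 / wt (z - m) ^ (d + (d - 1 + 1))) +
                1 / (2 * η) * ω m ^ 2) := by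
            calc v * (1 / wt (z - m) ^ d * ω m ^ 2)
                ≤ (2 ^ d * min (wt m ^ d) T) * (1 / wt (z - m) ^ d * ω m ^ 2) := by gcongr
              _ = 2 ^ d * (ω m * min (wt m ^ d) T) * (1 / wt (z - m) ^ d * ω m) := by ring
              _ ≤ 2 ^ d * S * (1 / wt (z - m) ^ d * ω m) := by
                  have := hle m; gcongr
              _ ≤ _ := by gcongr
          have h6 : 0 ≤ (4:ℝ) ^ d * (ω m ^ 2 + χ m) := by positivity
          rw [mul_add, mul_add]
          linarith
      have hHS : HasSum (fun m => (4 ^ d * (ω m ^ 2 + χ m) + 2 ^ d * (χ m * wt m ^ d)) +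
          2 ^ d * S * (η / 2 * (1 / wt (z - m) ^ (d + (d - 1 + 1))) +
            1 / (2 * η) * (if R ≤ wt m then ω m ^ 2 else 0)))
          ((4 ^ d * ((∑' z, ω z ^ 2) + ∑' z, χ z) + 2 ^ d * ∑' z, χ z * wt z ^ d) +
            2 ^ d * S * (η / 2 * A2 + 1 / (2 * η) * τ)) :=
        (((hω.hasSum.add hχs.hasSum).mul_left _).add (hχs2.hasSum.mul_left _)).add
          ((((hs2d' z).mul_left _).add (hts.hasSum.mul_left _)).mul_left _)
      have h7 : v * ∑' m, 1 / wt (z - m) ^ d * (ω m ^ 2 + χ m) ≤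
          ((4 ^ d * ((∑' z, ω z ^ 2) + ∑' z, χ z) + 2 ^ d * ∑' z, χ z * wt z ^ d) +
            2 ^ d * S * (η / 2 * A2 + 1 / (2 * η) * τ)) := by
        rw [← tsum_mul_left, ← hHS.tsum_eq]
        refine Summable.tsum_le_tsum hpt (Summable.of_nonneg_of_le (fun m => ?_) hpt hHS.summable)
          hHS.summable
        have := hv0 z; have := wt_pos (z - m); have := hχ0 m; positivity
      have h8 : ω z * v ≤ C * ((4 ^ d * ((∑' z, ω z ^ 2) + ∑' z, χ z) +
          2 ^ d * ∑' z, χ z * wt z ^ d) + 2 ^ d * S * (η / 2 * A2 + 1 / (2 * η) * τ)) := by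
        calc ω z * v ≤ (C * ∑' m, 1 / wt (z - m) ^ d * (ω m ^ 2 + χ m)) * v := by
              have := h z; have := hv0 z; gcongr
          _ = C * (v * ∑' m, 1 / wt (z - m) ^ d * (ω m ^ 2 + χ m)) := by ring
          _ ≤ _ := by gcongr
      have h9 : C * 2 ^ d * (η / 2 * A2) ≤ 1 / 4 := by
        rw [hη]
        have hp : 0 ≤ C * 2 ^ d * A2 := by positivity
        have : C * 2 ^ d * (1 / (2 * (C * 2 ^ d * A2 + 1)) / 2 * A2) =
            (C * 2 ^ d * A2) / (4 * (C * 2 ^ d * A2 + 1)) := by field_simp; ring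
        rw [this, div_le_iff₀ (by positivity)]; linarith
      have h10 : C * 2 ^ d * (1 / (2 * η) * τ) ≤ 1 / 4 := by
        calc C * 2 ^ d * (1 / (2 * η) * τ) ≤
              C * 2 ^ d * (1 / (2 * η) * (η / (2 * (C * 2 ^ d + 1)))) := by gcongr
          _ = (C * 2 ^ d) / (4 * (C * 2 ^ d + 1)) := by field_simp; ring
          _ ≤ 1 / 4 := by rw [div_le_iff₀ (by positivity)]; linarith
      have h11 : C * (2 ^ d * S * (η / 2 * A2 + 1 / (2 * η) * τ)) ≤ S / 2 := by
        calc C * (2 ^ d * S * (η / 2 * A2 + 1 / (2 * η) * τ)) =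
            S * (C * 2 ^ d * (η / 2 * A2) + C * 2 ^ d * (1 / (2 * η) * τ)) := by ring
          _ ≤ S * (1 / 4 + 1 / 4) := by gcongr
          _ = S / 2 := by ring
      have h12 : 0 ≤ |W| * (2 * R) ^ d := by positivity
      rw [hC1]
      rw [mul_add C] at h8
      linarith
    have : S ≤ C1 + S / 2 := ciSup_le hstep
    intro z
    have := hle z
    linarith
  refine ⟨2 * C1, by positivity, fun z => ?_⟩
  have hwz := wt_pos z
  have := key (wt z ^ d) (by positivity) z
  rw [min_self] at this
  rw [mul_one_div, le_div_iff₀ (by positivity)]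
  exact this

end

section
variable {d : ℕ}

def TF {I N : Type} [Fintype I] [Fintype N] (σ : I → ZZ d) (G : N → N → ZZ d → ℝ)
    (F : I → N → ZZ d → ℝ) (i : N) (z : ZZ d) : ℝ :=
  ∑ s, ∑ q, conv (Df (-σ s) (G i q)) (F s q) z

section
variable {I N : Type} [Fintype I] [Fintype N] [DecidableEq N] {σ : I → ZZ d}
  {C : I → I → N → N → ℝ} {G : N → N → ZZ d → ℝ}

lemma TF_mp (hd : 2 ≤ d) (hG : Green σ C G) (q : ℕ) (F : I → N → ZZ d → ℝ)
    (hF : ∀ s k, Bd (d + (q + 1)) 0 (fun _ => F s k)) :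
    ∃ (κ : Type) (_ : Fintype κ) (c : κ → ℝ) (vs : κ → List (ZZ d)) (kk : κ → N),
      (∀ a, vs a ≠ []) ∧ ∀ M, (∀ s k, Ty (d + (q + 1)) 0 M (fun _ => F s k)) → ∀ i,
        Ty (d + q) 1 (M + 1) (fun _ z => TF σ G F i z - ∑ a, c a * Dl (vs a) (G i (kk a)) z) := by
  obtain ⟨κ, _, ws, -, hml⟩ := multipole_lemma (d := d) (by omega) q
  choose c hc using fun s k => hml (F s k) (hF s k)
  refine ⟨κ × I × N, inferInstance, fun a => c a.2.1 a.2.2 a.1,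
    fun a => (-σ a.2.1) :: (ws a.1).map eb, fun a => a.2.2, fun a => by simp, fun M hM i => ?_⟩
  have h1 : Ty (d + q) 1 (M + 1) (fun _ z => ∑ s, ∑ k, (conv (Df (-σ s) (G i k)) (F s k) z -
      ∑ a, c s k a * Db (ws a) (Df (-σ s) (G i k)) z)) :=
    Ty.sum fun s _ => Ty.sum fun k _ => hc s k M (hM s k) _ (hG.ty (-σ s) i k)
  refine h1.congr fun _ z => ?_
  simp only [TF, Finset.sum_sub_distrib]
  congr 1
  rw [Fintype.sum_prod_type_right, Fintype.sum_prod_type]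
  rfl

lemma Green.dl (hG : Green σ C G) (v : ZZ d) (vs : List (ZZ d)) (i q : N) (M : ℕ) :
    Ty (d - 1 + vs.length) 0 M (fun _ => Dl (v :: vs) (G i q)) := by
  exact Ty.dl vs (hG.ty v i q (M + vs.length))

lemma Green.dl' (hG : Green σ C G) {vs : List (ZZ d)} (hvs : vs ≠ []) (i q : N) (M : ℕ) :
    Ty (d - 1) 0 M (fun _ => Dl vs (G i q)) := by
  obtain ⟨v, ws, rfl⟩ := List.exists_cons_of_ne_nil hvs
  exact (hG.dl v ws i q M).mono (by omega) le_rfl le_rfl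

end

/-- the nonlinear problem in coordinates -/
structure Prob {I N : Type} [Fintype I] [Fintype N] [DecidableEq N] (σ : I → ZZ d)
    (C : I → I → N → N → ℝ) (G : N → N → ZZ d → ℝ) (u : N → ZZ d → ℝ) (g : I → N → ZZ d → ℝ)
    (n : ℕ) (f : I → N → I × N → I × N → (I × N → ℝ) → ℝ) : Prop where
  green : Green σ C G
  tend : ∀ i v, Tendsto (Df v (u i)) cofinite (𝓝 0)
  l2 : ∀ s q, Summable fun z => (Df (σ s) (u q) z) ^ 2
  gsupp : ∀ s q, (g s q).support.Finite
  smooth : ∀ s q a b, ContDiff ℝ n (f s q a b)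
  eqn : ∀ i z, Hz σ C u i z = ∑ s, Df (-σ s) (fun z => g s i z -
    ∑ a, ∑ b, Df (σ a.1) (u a.2) z * Df (σ b.1) (u b.2) z *
      f s i a b (fun a => Df (σ a.1) (u a.2) z)) z

section
variable {I N : Type} [Fintype I] [Fintype N] [DecidableEq N] {σ : I → ZZ d}
  {C : I → I → N → N → ℝ} {G : N → N → ZZ d → ℝ} {u : N → ZZ d → ℝ} {g : I → N → ZZ d → ℝ}
  {n : ℕ} {f : I → N → I × N → I × N → (I × N → ℝ) → ℝ}

def XX (σ : I → ZZ d) (u : N → ZZ d → ℝ) (a : I × N) (z : ZZ d) : ℝ := Df (σ a.1) (u a.2) z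

def FF (σ : I → ZZ d) (u : N → ZZ d → ℝ) (g : I → N → ZZ d → ℝ)
    (f : I → N → I × N → I × N → (I × N → ℝ) → ℝ) (s : I) (q : N) (z : ZZ d) : ℝ :=
  g s q z - ∑ a, ∑ b, XX σ u a z * XX σ u b z * f s q a b (fun a => XX σ u a z)

lemma FF_ty (P : Prob σ C G u g n f) (M : ℕ) (hM : M ≤ n)
    (hX : ∀ a, Ty d 0 M (fun _ => XX σ u a)) (s : I) (q : N) :
    Ty (2 * d) 0 M (fun _ => FF σ u g f s q) := by
  refine (Ty.of_finsupp (P.gsupp s q) (2 * d) 0 M).sub (Ty.sum fun a _ => Ty.sum fun b _ => ?_)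
  have h1 := Ty.comp M (f s q a b) ((P.smooth s q a b).of_le (by exact_mod_cast hM))
    (fun a _ => XX σ u a) (fun a => (hX a).mono (Nat.zero_le _) le_rfl le_rfl)
  exact (((hX a).mul (hX b)).mul h1).mono (by omega) (by omega) le_rfl

lemma Prob.fbound (P : Prob σ C G u g n f) : ∃ B, 0 ≤ B ∧ ∀ s q a b z,
    |f s q a b (fun a => XX σ u a z)| ≤ B := by
  have hX : ∀ a, ∃ W, ∀ z, |XX σ u a z| ≤ W := fun a => by
    refine ⟨∑' z, (XX σ u a z) ^ 2 + 1, fun z => ?_⟩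
    have := (P.l2 a.1 a.2).le_tsum z (fun _ _ => sq_nonneg _)
    have h2 : |XX σ u a z| ^ 2 ≤ ∑' z, (XX σ u a z) ^ 2 := by rw [sq_abs]; exact this
    nlinarith [sq_nonneg (|XX σ u a z| - 1)]
  choose W hW using hX
  have : ∀ s q a b, ∃ B, ∀ z, |f s q a b (fun a => XX σ u a z)| ≤ B := fun s q a b => by
    have hcp : IsCompact (Set.pi Set.univ fun a : I × N => Set.Icc (-W a) (W a)) :=
      isCompact_univ_pi fun a => isCompact_Icc
    obtain ⟨B, hB⟩ := hcp.exists_bound_of_continuousOn (P.smooth s q a b).continuous.continuousOn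
    exact ⟨B, fun z => hB _ fun a _ => abs_le.1 (hW a z)⟩
  choose B hB using this
  refine ⟨∑ s, ∑ q, ∑ a, ∑ b, |B s q a b|, by positivity, fun s q a b z =>
    (hB s q a b z).trans ((le_abs_self _).trans ?_)⟩
  calc |B s q a b| ≤ ∑ b, |B s q a b| :=
        Finset.single_le_sum (f := fun b => |B s q a b|) (fun _ _ => abs_nonneg _)
          (Finset.mem_univ b)
    _ ≤ ∑ a, ∑ b, |B s q a b| :=
        Finset.single_le_sum (f := fun a => ∑ b, |B s q a b|)
          (fun _ _ => by positivity) (Finset.mem_univ a)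
    _ ≤ ∑ q, ∑ a, ∑ b, |B s q a b| :=
        Finset.single_le_sum (f := fun q => ∑ a, ∑ b, |B s q a b|)
          (fun _ _ => by positivity) (Finset.mem_univ q)
    _ ≤ _ := Finset.single_le_sum (f := fun s => ∑ q, ∑ a, ∑ b, |B s q a b|)
          (fun _ _ => by positivity) (Finset.mem_univ s)

/-- pointwise bound of the right-hand side -/
lemma Prob.Fbound (P : Prob σ C G u g n f) : ∃ B, 0 ≤ B ∧ ∀ s q z,
    |FF σ u g f s q z| ≤ B * ((∑ a, |XX σ u a z|) ^ 2 + ∑ s, ∑ q, |g s q z|) := by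
  obtain ⟨B, hB, h⟩ := P.fbound
  refine ⟨B + 1, by positivity, fun s q z => ?_⟩
  have h1 : |g s q z| ≤ ∑ s, ∑ q, |g s q z| :=
    (Finset.single_le_sum (f := fun q => |g s q z|) (fun _ _ => abs_nonneg _)
      (Finset.mem_univ q)).trans
    (Finset.single_le_sum (f := fun s => ∑ q, |g s q z|) (fun _ _ => by positivity)
      (Finset.mem_univ s))
  have h2 : |∑ a, ∑ b, XX σ u a z * XX σ u b z * f s q a b (fun a => XX σ u a z)| ≤
      B * (∑ a, |XX σ u a z|) ^ 2 := by
    calc _ ≤ ∑ a, ∑ b, |XX σ u a z * XX σ u b z * f s q a b (fun a => XX σ u a z)| :=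
          (Finset.abs_sum_le_sum_abs _ _).trans
            (Finset.sum_le_sum fun a _ => Finset.abs_sum_le_sum_abs _ _)
      _ ≤ ∑ a, ∑ b, B * (|XX σ u a z| * |XX σ u b z|) := by
          refine Finset.sum_le_sum fun a _ => Finset.sum_le_sum fun b _ => ?_
          rw [abs_mul, abs_mul, mul_comm B]
          exact mul_le_mul_of_nonneg_left (h s q a b z) (by positivity)
      _ = _ := by rw [sq, Finset.sum_mul_sum, Finset.mul_sum]; simp only [Finset.mul_sum]
  have h3 : 0 ≤ (∑ a, |XX σ u a z|) ^ 2 := sq_nonneg _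
  have h4 : 0 ≤ ∑ s, ∑ q, |g s q z| := by positivity
  unfold FF
  refine (abs_sub _ _).trans ?_
  nlinarith [mul_nonneg hB h4]

lemma Prob.omega_sq (P : Prob σ C G u g n f) : Summable fun z => (∑ a, |XX σ u a z|) ^ 2 := by
  have h1 : Summable fun z => (Fintype.card (I × N) : ℝ) * ∑ a, (XX σ u a z) ^ 2 :=
    (summable_sum fun a _ => P.l2 a.1 a.2).mul_left _
  refine Summable.of_nonneg_of_le (fun z => sq_nonneg _) (fun z => ?_) h1
  have := sq_sum_le_card_mul_sum_sq (s := (Finset.univ : Finset (I × N)))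
    (f := fun a => |XX σ u a z|)
  simpa only [sq_abs, Finset.card_univ] using this

lemma Prob.Fsum (P : Prob σ C G u g n f) (s : I) (q : N) : Summable (FF σ u g f s q) := by
  obtain ⟨B, hB, h⟩ := P.Fbound
  refine Summable.of_norm_bounded (g := fun z => B * ((∑ a, |XX σ u a z|) ^ 2 +
    ∑ s, ∑ q, |g s q z|)) ((P.omega_sq.add (summable_sum fun s _ => summable_sum fun q _ =>
      (summable_of_hasFiniteSupport (P.gsupp s q)).abs)).mul_left B) (fun z => h s q z)

lemma Prob.repr (P : Prob σ C G u g n f) (hd : 2 ≤ d) : ∃ c : N → ℝ, ∀ i z,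
    u i z = c i + TF σ G (FF σ u g f) i z :=
  ⟨_, fun i z => green_repr hd P.green P.tend (FF σ u g f) P.Fsum P.eqn i z⟩

lemma Prob.decay (P : Prob σ C G u g n f) (hd : 2 ≤ d) (a : I × N) :
    Bd d 0 (fun _ => XX σ u a) := by
  obtain ⟨c, hc⟩ := P.repr hd
  obtain ⟨B, hB, hF⟩ := P.Fbound
  set ω : ZZ d → ℝ := fun z => ∑ a, |XX σ u a z| with hω
  set χ : ZZ d → ℝ := fun z => ∑ s, ∑ q, |g s q z| with hχ
  have hχsum : Summable χ := summable_sum fun s _ => summable_sum fun q _ =>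
      (summable_of_hasFiniteSupport (P.gsupp s q)).abs
  have hχfin : χ.support.Finite := by
    refine (Set.finite_iUnion fun s => Set.finite_iUnion fun q => P.gsupp s q).subset
      fun z hz => ?_
    by_contra hcon
    simp only [Set.mem_iUnion, not_exists, Function.mem_support, not_not] at hcon
    exact hz (by simp [hχ, hcon])
  have hk : ∀ (b : I × N) s q, ∃ A, 0 ≤ A ∧ ∀ x, |Df (σ b.1) (Df (-σ s) (G b.2 q)) x| ≤
      A * (1 / wt x ^ d) := fun b s q => by
    obtain ⟨A, hA, h⟩ := ((P.green.ty (-σ s) b.2 q 1).df (σ b.1)).bd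
    refine ⟨A, hA, fun x => ?_⟩
    have := h 0 x
    rwa [pow_zero, show d - 1 + 1 = d by omega] at this
  choose A hA hk using hk
  have hsummand : ∀ z, Summable fun m => 1 / wt (z - m) ^ d * (ω m ^ 2 + χ m) := fun z => by
    refine Summable.of_nonneg_of_le (fun m => ?_) (fun m => ?_) (P.omega_sq.add hχsum)
    · have := wt_pos (z - m); have : 0 ≤ χ m := by positivity
      positivity
    · refine mul_le_of_le_one_left (by have : 0 ≤ χ m := by positivity
                                       positivity) ?_
      rw [div_le_one (by have := wt_pos (z - m); positivity)]
      exact one_le_pow₀ (one_le_wt _)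
  have hmain : ∀ z, ω z ≤ (∑ b, ∑ s, ∑ q, A b s q * B) *
      ∑' m, 1 / wt (z - m) ^ d * (ω m ^ 2 + χ m) := by
    intro z
    simp only [hω, Finset.sum_mul]
    refine Finset.sum_le_sum fun b _ => ?_
    have e : XX σ u b z = ∑ s, ∑ q, conv (Df (σ b.1) (Df (-σ s) (G b.2 q))) (FF σ u g f s q) z := by
      have : u b.2 = fun z => c b.2 + TF σ G (FF σ u g f) b.2 z := funext (hc b.2)
      rw [XX, this]
      have hcv : ∀ s q, conv (Df (σ b.1) (Df (-σ s) (G b.2 q))) (FF σ u g f s q) z =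
          Df (σ b.1) (conv (Df (-σ s) (G b.2 q)) (FF σ u g f s q)) z := fun s q => by
        rw [Df_conv (Bounded1.of_bd (P.green.ty (-σ s) b.2 q 0).bd) (P.Fsum s q)]
      simp only [hcv, Df, TF, Finset.sum_sub_distrib]
      ring
    rw [e]
    refine (Finset.abs_sum_le_sum_abs _ _).trans (Finset.sum_le_sum fun s _ => ?_)
    refine (Finset.abs_sum_le_sum_abs _ _).trans (Finset.sum_le_sum fun q _ => ?_)
    rw [← tsum_mul_left]
    have hpt : ∀ m, ‖Df (σ b.1) (Df (-σ s) (G b.2 q)) (z - m) * FF σ u g f s q m‖ ≤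
        A b s q * B * (1 / wt (z - m) ^ d * (ω m ^ 2 + χ m)) := fun m => by
      rw [norm_mul, Real.norm_eq_abs, Real.norm_eq_abs]
      have := hA b s q
      have := wt_pos (z - m)
      calc _ ≤ (A b s q * (1 / wt (z - m) ^ d)) * (B * (ω m ^ 2 + χ m)) :=
            mul_le_mul (hk b s q _) (hF s q m) (abs_nonneg _) (by positivity)
        _ = _ := by ring
    exact tsum_of_norm_bounded ((hsummand z).mul_left _).hasSum hpt
  obtain ⟨C', hC', hfin⟩ := initial_decay (by omega) (ω := ω) (χ := χ) (fun z => by positivity)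
    (fun z => by positivity) P.omega_sq hχfin
    (C := ∑ b, ∑ s, ∑ q, A b s q * B)
    (Finset.sum_nonneg fun b _ => Finset.sum_nonneg fun s _ => Finset.sum_nonneg fun q _ =>
      mul_nonneg (hA b s q) hB) hmain
  refine ⟨C', hC', fun _ z => ?_⟩
  rw [pow_zero]
  exact (Finset.single_le_sum (f := fun a => |XX σ u a z|) (fun _ _ => abs_nonneg _)
    (Finset.mem_univ a)).trans (hfin z)

end

end

section
variable {d : ℕ}

section
variable {I N : Type} [Fintype I] [Fintype N] [DecidableEq N] {σ : I → ZZ d}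
  {C : I → I → N → N → ℝ} {G : N → N → ZZ d → ℝ} {u : N → ZZ d → ℝ} {g : I → N → ZZ d → ℝ}
  {n : ℕ} {f : I → N → I × N → I × N → (I × N → ℝ) → ℝ}

lemma Prob.boot_step (P : Prob σ C G u g n f) (hd : 2 ≤ d) (c : N → ℝ)
    (hc : ∀ i z, u i z = c i + TF σ G (FF σ u g f) i z) (M : ℕ)
    (hF : ∀ s q, Ty (2 * d - 1) 0 M (fun _ => FF σ u g f s q)) (i : N) :
    Ty (d - 1) 0 (M + 1) (fun _ z => u i z - c i) := by
  have e : d + (d - 2 + 1) = 2 * d - 1 := by omega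
  obtain ⟨κ, _, b, vs, kk, hvs, h⟩ := TF_mp hd P.green (d - 2) (FF σ u g f)
    (fun s k => by rw [e]; exact (hF s k).bd)
  have h1 := h M (by rw [e]; exact hF) i
  have e2 : d + (d - 2) = (2 * d - 3) + 1 := by omega
  rw [e2] at h1
  have h2 := h1.trade.mono (b := d - 1) (by omega) le_rfl le_rfl
  have h3 : Ty (d - 1) 0 (M + 1) (fun _ z => ∑ a, b a * Dl (vs a) (G i (kk a)) z) :=
    Ty.sum fun a _ => (P.green.dl' (hvs a) i (kk a) (M + 1)).const_mul (b a)
  refine (h2.add h3).congr fun _ z => ?_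
  simp only [hc i z]; ring

lemma XX_ty_of (hd : 2 ≤ d) {c : N → ℝ} {M : ℕ}
    (h : ∀ i, Ty (d - 1) 0 (M + 1) (fun _ z => u i z - c i)) (a : I × N) :
    Ty d 0 M (fun _ => XX σ u a) := by
  have := (h a.2).df (σ a.1)
  have e : d - 1 + 1 = d := by omega
  rw [e] at this
  refine this.congr fun _ z => ?_
  simp only [XX, Df]; ring

lemma Prob.boot (P : Prob σ C G u g n f) (hd : 2 ≤ d) (c : N → ℝ)
    (hc : ∀ i z, u i z = c i + TF σ G (FF σ u g f) i z) (M : ℕ) (hM : M ≤ n + 1) :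
    ∀ i, Ty (d - 1) 0 (M + 1) (fun _ z => u i z - c i) := by
  induction M with
  | zero =>
    refine P.boot_step hd c hc 0 fun s q => ?_
    exact (FF_ty P 0 (Nat.zero_le _) (fun a => Ty_zero (P.decay hd a)) s q).mono
      (by omega) le_rfl le_rfl
  | succ M ih =>
    refine P.boot_step hd c hc (M + 1) fun s q => ?_
    have h1 := FF_ty P M (by omega) (fun a => XX_ty_of hd (ih (by omega)) a) s q
    have e : 2 * d = 2 * d - 1 + 1 := by omega
    rw [e] at h1
    exact h1.loss

end

end

section
variable {d : ℕ}

lemma split_nl {I : Type} [Fintype I] [DecidableEq I] {X X' : I → ZZ d → ℝ} {k e : ℕ}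
    (hX : ∀ i, Ty d 0 k (fun _ => X i)) (hX' : ∀ i M, Ty d 0 M (fun _ => X' i))
    (hY : ∀ i, Ty e 0 k (fun _ z => X i z - X' i z)) :
    ∀ (T a : ℕ) (_ : a ≤ e) (_ : a ≤ d * T) (f : (I → ℝ) → ℝ)
      (_ : ContDiff ℝ ((k + T : ℕ) : WithTop ℕ∞) f),
      ∃ P : ZZ d → ℝ, (∀ M, Ty 0 0 M (fun _ => P)) ∧
        Ty a 0 k (fun _ z => f (fun i => X i z) - P z) := by
  intro T
  induction T with
  | zero =>
    intro a _ ha f hf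
    have ha0 : a = 0 := by simpa using ha
    subst ha0
    refine ⟨fun _ => 0, fun M => Ty.zero_fun, ?_⟩
    have := Ty.comp k f (by simpa using hf) (fun i _ => X i)
      (fun i => (hX i).mono (Nat.zero_le _) le_rfl le_rfl)
    exact this.congr fun _ z => by simp
  | succ T ih =>
    intro a hae ha f hf
    obtain ⟨F, hFc, hFe, -⟩ := hadamard_zero (k + T) f (by exact_mod_cast hf)
    have := fun i => ih (a - d) (by omega) (by rw [Nat.mul_succ] at ha; omega) (F i)
      (by exact_mod_cast hFc i)
    choose P hP hPF using this
    refine ⟨fun z => f 0 + ∑ i, X' i z * P i z, fun M => ?_, ?_⟩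
    · exact (Ty.const (f 0)).add (Ty.sum fun i _ => ((hX' i M).mul (hP i M)).mono
        (Nat.zero_le _) (by omega) le_rfl)
    · have h1 : Ty a 0 k (fun _ z => ∑ i, (X i z * (F i (fun i => X i z) - P i z) +
          (X i z - X' i z) * P i z)) :=
        Ty.sum fun i _ => (((hX i).mul (hPF i)).mono (by omega) (by omega) le_rfl).add
          (((hY i).mul (hP i k)).mono (by omega) (by omega) le_rfl)
      refine h1.congr fun _ z => ?_
      simp only [hFe (fun i => X i z)]
      rw [add_sub_add_left_eq_sub, ← Finset.sum_sub_distrib]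
      exact Finset.sum_congr rfl fun i _ => by ring

end

section
variable {d : ℕ}

lemma mem_closure_eb (z : ZZ d) : z ∈ AddSubgroup.closure (Set.range (eb : Fin d → ZZ d)) := by
  have : z = ∑ i, z i • eb i := by
    funext j
    simp [Finset.sum_apply, eb, Pi.single_apply]
  rw [this]
  exact sum_mem fun i _ => zsmul_mem (AddSubgroup.subset_closure (Set.mem_range_self i)) _

section
variable {N : Type}

def MP (G : N → N → ZZ d → ℝ) (h : N → ZZ d → ℝ) : Prop :=
  ∃ (κ : Type) (_ : Fintype κ) (c : κ → ℝ) (vs : κ → List (Fin d)) (kk : κ → N),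
    (∀ a, 1 ≤ (vs a).length ∧ (vs a).length ≤ d) ∧
    ∀ i M, Ty (2 * d - 1) 1 M (fun _ z => h i z - ∑ a, c a * Db (vs a) (G i (kk a)) z)

variable {G : N → N → ZZ d → ℝ}

lemma MP.congr {h h' : N → ZZ d → ℝ} (H : MP G h) (e : ∀ i z, h' i z = h i z) : MP G h' := by
  have : h' = h := by funext i z; exact e i z
  rwa [this]

lemma MP.of_ty {h : N → ZZ d → ℝ} (H : ∀ i M, Ty (2 * d - 1) 1 M (fun _ => h i)) : MP G h :=
  ⟨Empty, inferInstance, fun a => a.elim, fun a => a.elim, fun a => a.elim, fun a => a.elim,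
    fun i M => (H i M).congr fun _ z => by simp⟩

lemma MP.add {h h' : N → ZZ d → ℝ} (H : MP G h) (H' : MP G h') :
    MP G (fun i z => h i z + h' i z) := by
  obtain ⟨κ, _, c, vs, kk, h1, h2⟩ := H
  obtain ⟨κ', _, c', vs', kk', h1', h2'⟩ := H'
  refine ⟨κ ⊕ κ', inferInstance, Sum.elim c c', Sum.elim vs vs', Sum.elim kk kk', ?_, ?_⟩
  · rintro (a | a)
    · exact h1 a
    · exact h1' a
  · intro i M
    refine ((h2 i M).add (h2' i M)).congr fun _ z => ?_
    simp only [Fintype.sum_sum_type, Sum.elim_inl, Sum.elim_inr]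
    ring

lemma MP.const_mul {h : N → ZZ d → ℝ} (b : ℝ) (H : MP G h) : MP G (fun i z => b * h i z) := by
  obtain ⟨κ, _, c, vs, kk, h1, h2⟩ := H
  refine ⟨κ, inferInstance, fun a => b * c a, vs, kk, h1, fun i M => ?_⟩
  refine ((h2 i M).const_mul b).congr fun _ z => ?_
  rw [mul_sub, Finset.mul_sum]
  simp only [mul_assoc]

lemma MP.zero : MP G (fun _ (_ : ZZ d) => 0) := MP.of_ty fun _ _ => Ty.zero_fun

lemma MP.sum {ι : Type*} {s : Finset ι} {h : ι → N → ZZ d → ℝ} (H : ∀ a ∈ s, MP G (h a)) :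
    MP G (fun i z => ∑ a ∈ s, h a i z) := by
  classical
  induction s using Finset.induction_on with
  | empty => exact MP.zero.congr fun i z => by simp
  | insert a s ha ih =>
    exact ((H a (by simp)).add (ih fun b hb => H b (by simp [hb]))).congr fun i z => by
      rw [Finset.sum_insert ha]

end

section
variable {I N : Type} [Fintype I] [Fintype N] [DecidableEq N] {σ : I → ZZ d}
  {C : I → I → N → N → ℝ} {G : N → N → ZZ d → ℝ}

lemma Green.MP_dl_long (hG : Green σ C G) {ws : List (ZZ d)} (hw : d + 1 ≤ ws.length) (q : N) :
    MP G (fun i => Dl ws (G i q)) := by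
  refine MP.of_ty fun i M => ?_
  obtain ⟨v, ws', rfl⟩ := List.exists_cons_of_length_pos (l := ws) (by omega)
  refine (hG.dl v ws' i q M).mono ?_ (Nat.zero_le _) le_rfl
  simp only [List.length_cons] at hw; omega

lemma Df_add_dir (a b : ZZ d) (f : ZZ d → ℝ) (z : ZZ d) :
    Df (a + b) f z = Df a f z + Df b f z + Df a (Df b f) z := by
  simp only [Df, ← add_assoc]; ring

lemma Df_neg_dir (a : ZZ d) (f : ZZ d → ℝ) (z : ZZ d) :
    Df (-a) f z = (-1) * Df a f z + (-1) * Df a (Df (-a) f) z := by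
  simp only [Df]
  rw [show z + a + -a = z by abel]; ring

lemma Dl_cons_add (a b : ZZ d) (l : List (ZZ d)) (f : ZZ d → ℝ) (z : ZZ d) :
    Dl ((a + b) :: l) f z = Dl (a :: l) f z + Dl (b :: l) f z + Dl (b :: a :: l) f z := by
  simp only [Dl]
  have : Df (a + b) f = fun z => Df a f z + Df b f z + Df a (Df b f) z :=
    funext fun z => Df_add_dir a b f z
  rw [this, Dl_add, Dl_add]

lemma Dl_cons_neg (a : ZZ d) (l : List (ZZ d)) (f : ZZ d → ℝ) (z : ZZ d) :
    Dl ((-a) :: l) f z = (-1) * Dl (a :: l) f z + (-1) * Dl (-a :: a :: l) f z := by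
  simp only [Dl]
  have : Df (-a) f = fun z => (-1) * Df a f z + (-1) * Df a (Df (-a) f) z :=
    funext fun z => Df_neg_dir a f z
  conv_lhs => rw [this, Dl_add, Dl_const_mul, Dl_const_mul]

lemma Dl_cons_zero (l : List (ZZ d)) (f : ZZ d → ℝ) (z : ZZ d) :
    Dl ((0 : ZZ d) :: l) f z = 0 := by
  simp only [Dl]
  have : Df 0 f = fun z => 0 * f z := funext fun z => by simp [Df]
  rw [this, Dl_const_mul]; simp

lemma Green.MP_dl_aux (hG : Green σ C G) (q : N) (t : ℕ) :
    ∀ ws : List (ZZ d), ws ≠ [] → d + 1 ≤ ws.length + t → MP G (fun i => Dl ws (G i q)) := by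
  induction t with
  | zero => exact fun ws _ h => hG.MP_dl_long (by omega) q
  | succ t ih =>
    have key : ∀ (ws : List (ZZ d)) (bs : List (Fin d)), 1 ≤ bs.length + ws.length →
        bs.length + ws.length ≤ d → d + 1 ≤ bs.length + ws.length + (t + 1) →
        MP G (fun i => Dl (ws ++ bs.map eb) (G i q)) := by
      intro ws
      induction ws with
      | nil =>
        intro bs h1 h2 _
        refine ⟨Unit, inferInstance, fun _ => 1, fun _ => bs, fun _ => q, fun _ => ?_, fun i M => ?_⟩
        · simpa using ⟨h1, h2⟩
        · exact Ty.zero_fun.congr fun _ z => by simp [Db]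
      | cons v ws ihw =>
        intro bs h1 h2 h3
        simp only [List.length_cons] at h1 h2 h3
        simp only [List.cons_append]
        induction mem_closure_eb v using AddSubgroup.closure_induction with
        | mem x hx =>
          obtain ⟨j, rfl⟩ := hx
          refine (ihw (j :: bs) (by simp only [List.length_cons]; omega)
            (by simp only [List.length_cons]; omega)
            (by simp only [List.length_cons]; omega)).congr fun i z => ?_
          rw [Dl_perm]
          simp only [List.map_cons]
          exact List.perm_middle.symm
        | zero => exact MP.zero.congr fun i z => Dl_cons_zero _ _ _
        | add a b _ _ ha hb =>
          refine ((ha.add hb).add (ih (b :: a :: (ws ++ bs.map eb)) (by simp) ?_)).congr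
            fun i z => Dl_cons_add _ _ _ _ _
          simp only [List.length_cons, List.length_append, List.length_map]; omega
        | neg a _ ha =>
          refine ((ha.const_mul (-1)).add ((ih (-a :: a :: (ws ++ bs.map eb)) (by simp)
            ?_).const_mul (-1))).congr fun i z => Dl_cons_neg _ _ _ _
          simp only [List.length_cons, List.length_append, List.length_map]; omega
    intro ws hws hlen
    by_cases hl : ws.length ≤ d
    · have hp := List.length_pos_iff.2 hws
      exact (key ws [] (by simp only [List.length_nil]; omega) (by simpa using hl)
        (by simpa using hlen)).congr fun i z => by simp
    · exact hG.MP_dl_long (by omega) q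

lemma Green.MP_dl (hG : Green σ C G) {ws : List (ZZ d)} (hw : ws ≠ []) (q : N) :
    MP G (fun i => Dl ws (G i q)) :=
  hG.MP_dl_aux q (d + 1) ws hw (by omega)

lemma Green.MP_ty (hG : Green σ C G) (hd : 2 ≤ d) {h : N → ZZ d → ℝ} (H : MP G h) (i : N) (M : ℕ) :
    Ty (d - 1) 0 M (fun _ => h i) := by
  obtain ⟨κ, _, c, vs, kk, h1, h2⟩ := H
  have h3 := h2 i M
  have e : 2 * d - 1 = 2 * d - 2 + 1 := by omega
  rw [e] at h3
  have h4 : Ty (d - 1) 0 M (fun _ z => ∑ a, c a * Db (vs a) (G i (kk a)) z) :=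
    Ty.sum fun a _ => (hG.dl' (vs := (vs a).map eb) (by
      intro hh; have := h1 a; simp at hh; simp [hh] at this) i (kk a) M).const_mul (c a)
  exact ((h3.trade.mono (by omega) le_rfl le_rfl).add h4).congr fun _ z => by ring

end

end

section
variable {d : ℕ}

section
variable {I N : Type} [Fintype I] [Fintype N] [DecidableEq I] [DecidableEq N] {σ : I → ZZ d}
  {C : I → I → N → N → ℝ} {G : N → N → ZZ d → ℝ} {u : N → ZZ d → ℝ} {g : I → N → ZZ d → ℝ}
  {n : ℕ} {f : I → N → I × N → I × N → (I × N → ℝ) → ℝ}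

lemma summable_of_bd (hd : 2 ≤ d) {q : ℕ} {F : ZZ d → ℝ} (h : Bd (d + (q + 1)) 0 (fun _ => F)) :
    Summable F := by
  obtain ⟨B, hB, h⟩ := h
  refine Summable.of_norm_bounded (g := fun m => B * (1 / wt m ^ (d + (q + 1))))
    ((summable_wt (by omega) q).mul_left B) fun m => ?_
  simpa using h 0 m

lemma TF_add (hG : Green σ C G) {F F1 F2 : I → N → ZZ d → ℝ}
    (h1 : ∀ s q, Summable (F1 s q)) (h2 : ∀ s q, Summable (F2 s q))
    (e : ∀ s q z, F s q z = F1 s q z + F2 s q z) (i : N) (z : ZZ d) :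
    TF σ G F i z = TF σ G F1 i z + TF σ G F2 i z := by
  simp only [TF, ← Finset.sum_add_distrib]
  refine Finset.sum_congr rfl fun s _ => Finset.sum_congr rfl fun q _ => ?_
  have hb : Bounded1 (Df (-σ s) (G i q)) := Bounded1.of_bd (hG.ty (-σ s) i q 0).bd
  simp only [conv]
  rw [← (summable_bdd_mul hb (h1 s q) z).tsum_add (summable_bdd_mul hb (h2 s q) z)]
  exact tsum_congr fun m => by rw [e]; ring

lemma Prob.iter_step (P : Prob σ C G u g n f) (hd : 2 ≤ d) (c : N → ℝ)
    (hc : ∀ i z, u i z = c i + TF σ G (FF σ u g f) i z) (m T p k : ℕ) (hn : m + T ≤ n)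
    (hp : p ≤ d * T + d) (hk : k + 1 ≤ p)
    (hu : ∀ i, Ty (d - 1) 0 (m + 1) (fun _ z => u i z - c i)) (h : N → ZZ d → ℝ) (hMP : MP G h)
    (hr : ∀ i, Ty (d - 1 + k) 1 (m + 1) (fun _ z => u i z - c i - h i z)) :
    ∃ h', MP G h' ∧ ∀ i, Ty (d - 1 + (k + 1)) 1 (m + 1) (fun _ z => u i z - c i - h' i z) := by
  have hX : ∀ a, Ty d 0 m (fun _ => XX σ u a) := fun a => XX_ty_of hd hu a
  have hX' : ∀ a M, Ty d 0 M (fun _ => XX σ h a) := fun a M =>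
    XX_ty_of (c := fun _ => 0) hd
      (fun i => (P.green.MP_ty hd hMP i (M + 1)).congr fun _ z => by simp) a
  have hY : ∀ a, Ty (d + k - 1) 0 m (fun _ z => XX σ u a z - XX σ h a z) := fun a => by
    have h1 := (hr a.2).df (σ a.1)
    rw [show d - 1 + k + 1 = d + k - 1 + 1 by omega] at h1
    exact h1.trade.congr fun _ z => by simp only [XX, Df]; ring
  have := fun s q a b => split_nl hX hX' hY T (k + 1 - d) (by omega) (by omega) (f s q a b)
    ((P.smooth s q a b).of_le (by exact_mod_cast hn))
  choose Q hQ hQf using this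
  set F1 : I → N → ZZ d → ℝ := fun s q z =>
    g s q z - ∑ a, ∑ b, XX σ h a z * XX σ h b z * Q s q a b z with hF1
  set F2 : I → N → ZZ d → ℝ := fun s q z =>
    -1 * ∑ a, ∑ b, ((XX σ u a z * (XX σ u b z - XX σ h b z) +
      (XX σ u a z - XX σ h a z) * XX σ h b z) * f s q a b (fun a => XX σ u a z) +
      XX σ h a z * XX σ h b z * (f s q a b (fun a => XX σ u a z) - Q s q a b z)) with hF2
  have t1 : ∀ M s q, Ty (d + (d - 1 + 1)) 0 M (fun _ => F1 s q) := fun M s q =>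
    (Ty.of_finsupp (P.gsupp s q) _ 0 M).sub (Ty.sum fun a _ => Ty.sum fun b _ =>
      (((hX' a M).mul (hX' b M)).mul (hQ s q a b M)).mono (by omega) (by omega) le_rfl)
  have t2 : ∀ s q, Ty (d + (k + 1)) 0 m (fun _ => F2 s q) := fun s q => by
    refine Ty.const_mul (-1) (Ty.sum fun a _ => Ty.sum fun b _ => Ty.add ?_ ?_)
    · have hf := Ty.comp m (f s q a b) ((P.smooth s q a b).of_le (by exact_mod_cast (by omega)))
        (fun a _ => XX σ u a) (fun a => (hX a).mono (Nat.zero_le _) le_rfl le_rfl)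
      have h1 := ((hX a).mul (hY b)).mono (b := d + (k + 1)) (m := 0) (by omega) (by omega) le_rfl
      have h2 := ((hY a).mul (hX' b m)).mono (b := d + (k + 1)) (m := 0) (by omega) (by omega) le_rfl
      exact ((h1.add h2).mul hf).mono (by omega) (by omega) le_rfl
    · exact (((hX' a m).mul (hX' b m)).mul (hQf s q a b)).mono (by omega) (by omega) le_rfl
  have hFe : ∀ s q z, FF σ u g f s q z = F1 s q z + F2 s q z := fun s q z => by
    simp only [FF, hF1, hF2]
    rw [sub_eq_add_neg, sub_eq_add_neg, add_assoc, neg_one_mul, ← neg_add,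
      ← Finset.sum_add_distrib]
    congr 2
    refine Finset.sum_congr rfl fun a _ => ?_
    rw [← Finset.sum_add_distrib]
    exact Finset.sum_congr rfl fun b _ => by ring
  obtain ⟨κ1, _, c1, vs1, kk1, hv1, H1⟩ := TF_mp hd P.green (d - 1) F1 (fun s q => (t1 0 s q).bd)
  obtain ⟨κ2, _, c2, vs2, kk2, hv2, H2⟩ := TF_mp hd P.green k F2 (fun s q => (t2 s q).bd)
  refine ⟨fun i z => ((TF σ G F1 i z - ∑ a, c1 a * Dl (vs1 a) (G i (kk1 a)) z) +
    ∑ a, c1 a * Dl (vs1 a) (G i (kk1 a)) z) + ∑ a, c2 a * Dl (vs2 a) (G i (kk2 a)) z,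
    (MP.add (MP.of_ty fun i M => ?_) (MP.sum fun a _ => (P.green.MP_dl (hv1 a) _).const_mul _)).add
      (MP.sum fun a _ => (P.green.MP_dl (hv2 a) _).const_mul _), fun i => ?_⟩
  · exact (H1 M (t1 M) i).mono (by omega) le_rfl (by omega)
  · have h3 := H2 m t2 i
    rw [show d - 1 + (k + 1) = d + k by omega]
    refine h3.congr fun _ z => ?_
    rw [hc i z, TF_add P.green (fun s q => summable_of_bd hd (t1 0 s q).bd)
      (fun s q => summable_of_bd hd (t2 s q).bd) hFe]
    ring

lemma Prob.expand (P : Prob σ C G u g n f) (hd : 2 ≤ d) (m T p : ℕ) (hn : m + T ≤ n)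
    (hp : p ≤ d * T + d) : ∃ (c : N → ℝ) (h : N → ZZ d → ℝ), MP G h ∧
      ∀ i, Ty (d - 1 + p) 1 (m + 1) (fun _ z => u i z - c i - h i z) := by
  obtain ⟨c, hc⟩ := P.repr hd
  have hu := P.boot hd c hc m (by omega)
  have : ∀ k ≤ p, ∃ h : N → ZZ d → ℝ, MP G h ∧
      ∀ i, Ty (d - 1 + k) 1 (m + 1) (fun _ z => u i z - c i - h i z) := by
    intro k
    induction k with
    | zero =>
      intro _
      exact ⟨fun _ _ => 0, MP.zero, fun i => ((hu i).mono le_rfl (Nat.zero_le _) le_rfl).congr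
        fun _ z => by simp⟩
    | succ k ih =>
      intro hk
      obtain ⟨h, hM, hr⟩ := ih (by omega)
      exact P.iter_step hd c hc m T p k hn hp hk hu h hM hr
  obtain ⟨h, hM, hr⟩ := this p le_rfl
  exact ⟨c, h, hM, hr⟩

end

end

section
/-! ### Band-limited interpolation kernels -/

section kernels
open scoped FourierTransform ContDiff

def q0 (z : ℂ) : ℂ := dslope Complex.exp 0 z

lemma q0_eq (z : ℂ) : z * q0 z = Complex.exp z - 1 := by
  have := sub_smul_dslope Complex.exp 0 z
  simpa [q0] using this

lemma q0_diff : Differentiable ℂ q0 := by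
  have := (Complex.differentiableOn_dslope (f := Complex.exp) (c := 0)
    (s := Set.univ) Filter.univ_mem).2 Complex.differentiable_exp.differentiableOn
  exact differentiableOn_univ.1 this

def q1 (x : ℝ) : ℂ := q0 (2 * Real.pi * Complex.I * x)

lemma q1_smooth : ContDiff ℝ ∞ q1 := by
  have h1 : ContDiff ℝ ∞ q0 := (q0_diff.contDiff (n := ∞)).restrict_scalars ℝ
  refine h1.comp ?_
  exact contDiff_const.mul Complex.ofRealCLM.contDiff

lemma q1_ne {x : ℝ} (hx : |x| < 1) : q1 x ≠ 0 := by
  intro h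
  by_cases hx0 : x = 0
  · subst hx0
    simp [q1, q0, dslope_same] at h
  · have h2 := q0_eq (2 * Real.pi * Complex.I * x)
    unfold q1 at h
    rw [h, mul_zero] at h2
    have h3 : Complex.exp (2 * Real.pi * Complex.I * x) = 1 := by linear_combination -h2
    rw [Complex.exp_eq_one_iff] at h3
    obtain ⟨n, hn⟩ := h3
    have h4 : (2 * Real.pi * Complex.I) * ((x : ℂ) - n) = 0 := by linear_combination hn
    have h5 : (x : ℂ) - n = 0 := by
      rcases mul_eq_zero.1 h4 with h | h
      · exact absurd h Complex.two_pi_I_ne_zero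
      · exact h
    have h6 : x = n := by exact_mod_cast sub_eq_zero.1 h5
    rw [h6] at hx hx0
    have : |n| < 1 := by exact_mod_cast hx
    rw [Int.abs_lt_one_iff] at this
    simp [this] at hx0

def th (x : ℝ) : ℝ := Real.smoothTransition (3 * x - 1)

lemma th_smooth : ContDiff ℝ ∞ th :=
  Real.smoothTransition.contDiff.comp ((contDiff_const.mul contDiff_id).sub contDiff_const)

lemma th_zero {x : ℝ} (h : x ≤ 1 / 3) : th x = 0 :=
  Real.smoothTransition.zero_of_nonpos (by linarith)
lemma th_one {x : ℝ} (h : 2 / 3 ≤ x) : th x = 1 :=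
  Real.smoothTransition.one_of_one_le (by linarith)

def bb (x : ℝ) : ℝ := th (x + 1) - th x

lemma bb_smooth : ContDiff ℝ ∞ bb :=
  (th_smooth.comp (contDiff_id.add contDiff_const)).sub th_smooth

lemma bb_zero {x : ℝ} (h : 2 / 3 ≤ |x|) : bb x = 0 := by
  unfold bb
  rcases le_abs.1 h with h | h
  · rw [th_one h, th_one (by linarith)]; simp
  · rw [th_zero (by linarith), th_zero (by linarith)]; simp

def psi (j : ℕ) (x : ℝ) : ℂ := (bb x : ℂ) * ((q1 x)⁻¹) ^ j

lemma psi_smooth (j : ℕ) : ContDiff ℝ ∞ (psi j) := by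
  rw [contDiff_iff_contDiffAt]
  intro x
  by_cases hx : |x| < 1
  · refine ContDiffAt.mul (Complex.ofRealCLM.contDiff.comp bb_smooth).contDiffAt ?_
    exact (q1_smooth.contDiffAt.inv (q1_ne hx)).pow j
  · have : psi j =ᶠ[𝓝 x] fun _ => 0 := by
      have : ∀ᶠ y in 𝓝 x, 2 / 3 < |y| :=
        continuous_abs.continuousAt.eventually (lt_mem_nhds (by linarith [not_lt.1 hx]))
      filter_upwards [this] with y hy
      simp [psi, bb_zero hy.le]
    exact contDiffAt_const.congr_of_eventuallyEq this

lemma psi_zero (j : ℕ) {x : ℝ} (h : 2 / 3 ≤ |x|) : psi j x = 0 := by simp [psi, bb_zero h]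

lemma psi_cs (j : ℕ) : HasCompactSupport (psi j) := by
  refine HasCompactSupport.of_support_subset_isCompact (isCompact_Icc (a := (-1 : ℝ)) (b := 1)) ?_
  intro x hx
  by_contra hcon
  refine hx (psi_zero j ?_)
  by_contra hh
  push Not at hh
  have := abs_lt.1 hh
  exact hcon ⟨by linarith, by linarith⟩

lemma psi_rec (j : ℕ) (x : ℝ) : (-2 * Real.pi * Complex.I * x) * psi j x =
    psi (j + 1) x - Complex.exp (2 * Real.pi * Complex.I * x) * psi (j + 1) x := by
  by_cases hx : |x| < 1
  · have h1 := q1_ne hx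
    have h2 := q0_eq (2 * Real.pi * Complex.I * x)
    change _ * q1 x = _ at h2
    have h3 : Complex.exp (2 * Real.pi * Complex.I * x) = 1 + 2 * Real.pi * Complex.I * x * q1 x := by
      rw [h2]; ring
    rw [h3]
    unfold psi
    rw [pow_succ]
    field_simp
    ring
  · have := not_lt.1 hx
    rw [psi_zero j (by linarith), psi_zero (j + 1) (by linarith)]; ring

def phiC (j : ℕ) : ℝ → ℂ := 𝓕 (psi j)

lemma psi_int (j : ℕ) : Integrable (psi j) :=
  (psi_smooth j).continuous.integrable_of_hasCompactSupport (psi_cs j)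

lemma phiC_deriv (j : ℕ) (x : ℝ) : HasDerivAt (phiC j) (phiC (j + 1) x - phiC (j + 1) (x - 1)) x := by
  have hint : Integrable (fun x : ℝ => x • psi j x) :=
    (continuous_id.smul (psi_smooth j).continuous).integrable_of_hasCompactSupport
      ((psi_cs j).smul_left)
  have h := Real.hasDerivAt_fourier (psi_int j) hint x
  refine HasDerivAt.congr_deriv h (Eq.symm ?_)
  change 𝓕 (psi (j + 1)) x - 𝓕 (psi (j + 1)) (x - 1) = _
  simp only [Real.fourier_real_eq_integral_exp_smul, smul_eq_mul]
  have key : ∀ y : ℝ, Integrable (fun v : ℝ => Complex.exp (↑(-2 * Real.pi * v * y) * Complex.I) *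
      psi (j + 1) v) := fun y => by
    refine Continuous.integrable_of_hasCompactSupport ?_ ((psi_cs (j + 1)).mul_left)
    exact Continuous.mul (by fun_prop) (psi_smooth (j + 1)).continuous
  rw [← integral_sub (key x) (key (x - 1))]
  congr 1
  funext v
  rw [psi_rec j v]
  have : Complex.exp (↑(-2 * Real.pi * v * (x - 1)) * Complex.I) =
      Complex.exp (↑(-2 * Real.pi * v * x) * Complex.I) *
        Complex.exp (2 * Real.pi * Complex.I * v) := by
    rw [← Complex.exp_add]; congr 1; push_cast; ring
  rw [this]; ring

lemma phiC_decay (j N : ℕ) : ∃ C : ℝ, ∀ x, (1 + |x|) ^ N * ‖phiC j x‖ ≤ C := by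
  set S : SchwartzMap ℝ ℂ := (psi_cs j).toSchwartzMap (psi_smooth j) with hS
  have hF : ∀ x, (𝓕 S : SchwartzMap ℝ ℂ) x = phiC j x := fun x => by
    rw [SchwartzMap.fourier_coe]; rfl
  have := SchwartzMap.one_add_le_sup_seminorm_apply (𝕜 := ℝ) (m := (N, 0)) (k := N) (n := 0)
    le_rfl le_rfl (𝓕 S)
  refine ⟨2 ^ N * ((Finset.Iic (N, 0)).sup fun m => SchwartzMap.seminorm ℝ m.1 m.2) (𝓕 S),
    fun x => ?_⟩
  have h := this x
  simp only [norm_iteratedFDeriv_zero, hF, Real.norm_eq_abs] at h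
  exact h

lemma phiC_int (k : ℤ) : phiC 0 k = if k = 0 then 1 else 0 := by
  simp only [phiC, Real.fourier_real_eq_integral_exp_smul, smul_eq_mul]
  set e : ℝ → ℂ := fun v => Complex.exp (↑(-2 * Real.pi * v * (k : ℝ)) * Complex.I) with he
  have hec : Continuous e := by simp only [he]; fun_prop
  have hper : ∀ v, e (v + 1) = e v := fun v => by
    simp only [he]
    rw [Complex.exp_eq_exp_iff_exists_int]
    exact ⟨-k, by push_cast; ring⟩
  change ∫ v : ℝ, e v * psi 0 v = _
  have hps : ∀ v, psi 0 v = (bb v : ℂ) := fun v => by simp [psi]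
  simp only [hps]
  have hthc : Continuous fun v => (th v : ℂ) := Complex.continuous_ofReal.comp th_smooth.continuous
  have hbbc : Continuous fun v => (bb v : ℂ) := Complex.continuous_ofReal.comp bb_smooth.continuous
  have hsub : (Function.support fun v => e v * (bb v : ℂ)) ⊆ Set.Ioc (-1) 1 := by
    intro v hv
    by_contra hcon
    refine hv ?_
    have : bb v = 0 := bb_zero (by
      by_contra hh
      push Not at hh
      have := abs_lt.1 hh
      exact hcon ⟨by linarith, by linarith⟩)
    simp [this]
  rw [← intervalIntegral.integral_eq_integral_of_support_subset hsub]
  have hc : Continuous fun v => e v * (bb v : ℂ) := hec.mul hbbc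
  rw [← intervalIntegral.integral_add_adjacent_intervals (b := 0)
    (hc.intervalIntegrable _ _) (hc.intervalIntegrable _ _)]
  have h1 : ∫ v in (-1 : ℝ)..0, e v * (bb v : ℂ) = ∫ v in (0 : ℝ)..1, e v * (th v : ℂ) := by
    have := intervalIntegral.integral_comp_add_right (a := (-1 : ℝ)) (b := 0)
      (fun v => e v * (th v : ℂ)) 1
    norm_num at this
    rw [← this]
    refine intervalIntegral.integral_congr fun v hv => ?_
    rw [Set.uIcc_of_le (by norm_num)] at hv
    simp only [hper, bb, th_zero (show v ≤ 1 / 3 by linarith [hv.2])]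
    simp
  have h2 : ∫ v in (0 : ℝ)..1, e v * (bb v : ℂ) = ∫ v in (0 : ℝ)..1, (e v - e v * (th v : ℂ)) := by
    refine intervalIntegral.integral_congr fun v hv => ?_
    rw [Set.uIcc_of_le (by norm_num)] at hv
    simp only [bb, th_one (show 2 / 3 ≤ v + 1 by linarith [hv.1])]
    push_cast; ring
  have hc2 : Continuous fun v => e v * (th v : ℂ) := hec.mul hthc
  rw [h1, h2, intervalIntegral.integral_sub (hec.intervalIntegrable _ _)
    (hc2.intervalIntegrable _ _)]
  rw [add_sub_cancel]
  by_cases hk : k = 0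
  · simp [he, hk]
  · rw [if_neg hk]
    have hcne : ((-2 * Real.pi * k : ℝ) : ℂ) * Complex.I ≠ 0 := by
      refine mul_ne_zero ?_ Complex.I_ne_zero
      have : (k : ℝ) ≠ 0 := by exact_mod_cast hk
      exact_mod_cast mul_ne_zero (mul_ne_zero (by norm_num) Real.pi_ne_zero) this
    have h3 := integral_exp_mul_complex (a := 0) (b := 1) hcne
    have h4 : ∀ v : ℝ, e v = Complex.exp (((-2 * Real.pi * k : ℝ) : ℂ) * Complex.I * v) := fun v => by
      simp only [he]; congr 1; push_cast; ring
    simp only [h4]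
    rw [h3]
    have h5 : Complex.exp (((-2 * Real.pi * k : ℝ) : ℂ) * Complex.I * ((1 : ℝ) : ℂ)) = 1 := by
      rw [Complex.exp_eq_one_iff]
      exact ⟨-k, by push_cast; ring⟩
    rw [h5]; simp

lemma exists_kernels : ∃ φ : ℕ → ℝ → ℝ,
    (∀ j x, HasDerivAt (φ j) (φ (j + 1) x - φ (j + 1) (x - 1)) x) ∧
    (∀ j N, ∃ C : ℝ, 0 ≤ C ∧ ∀ x, |φ j x| ≤ C / (1 + |x|) ^ N) ∧
    ∀ k : ℤ, φ 0 k = if k = 0 then 1 else 0 := by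
  refine ⟨fun j x => (phiC j x).re, fun j x => ?_, fun j N => ?_, fun k => ?_⟩
  · have := Complex.reCLM.hasFDerivAt.comp_hasDerivAt x (phiC_deriv j x)
    simp only [map_sub, Complex.reCLM_apply] at this
    exact this
  · obtain ⟨C, hC⟩ := phiC_decay j N
    refine ⟨C, le_trans (by positivity) (hC 0), fun x => ?_⟩
    rw [le_div_iff₀ (by positivity), mul_comm]
    exact (mul_le_mul_of_nonneg_left (Complex.abs_re_le_norm _) (by positivity)).trans (hC x)
  · simp only [phiC_int]; split_ifs <;> simp

end kernels

end

section
variable {d : ℕ}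

structure Ker (φ : ℕ → ℝ → ℝ) : Prop where
  der : ∀ j x, HasDerivAt (φ j) (φ (j + 1) x - φ (j + 1) (x - 1)) x
  dec : ∀ j N, ∃ C : ℝ, 0 ≤ C ∧ ∀ x, |φ j x| ≤ C / (1 + |x|) ^ N
  int : ∀ k : ℤ, φ 0 k = if k = 0 then 1 else 0

def Ph (φ : ℕ → ℝ → ℝ) (β : Fin d → ℕ) (y : Fin d → ℝ) : ℝ := ∏ i, φ (β i) (y i)

def cst (m : ZZ d) : Fin d → ℝ := fun i => (m i : ℝ)

lemma cst_add (m n : ZZ d) : cst (m + n) = cst m + cst n := by funext i; simp [cst]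

def UU (φ : ℕ → ℝ → ℝ) (β : Fin d → ℕ) (w : ZZ d → ℝ) (x : Fin d → ℝ) : ℝ :=
  ∑' m, w m * Ph φ β (x - cst m)

def near (x : Fin d → ℝ) (z : ZZ d) : Prop := ∀ i, |x i - z i| ≤ 2

def up (β : Fin d → ℕ) (i : Fin d) : Fin d → ℕ := Function.update β i (β i + 1)

variable {φ : ℕ → ℝ → ℝ}

lemma Ker.Ph_decay (hφ : Ker φ) (β : Fin d → ℕ) (N : ℕ) : ∃ C : ℝ, 0 ≤ C ∧
    ∀ (x : Fin d → ℝ) (z m : ZZ d), near x z → |Ph φ β (x - cst m)| ≤ C / wt (z - m) ^ N := by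
  choose C hC h using fun i => hφ.dec (β i) N
  refine ⟨(∏ i, C i) * 4 ^ N, mul_nonneg (Finset.prod_nonneg fun i _ => hC i) (by positivity),
    fun x z m hz => ?_⟩
  set y := x - cst m with hy
  set P := ∏ i, (1 + |y i|) with hP
  have hP1 : 1 ≤ P := by
    rw [hP]
    calc (1 : ℝ) = ∏ i : Fin d, (1 : ℝ) := by simp
      _ ≤ _ := Finset.prod_le_prod (fun _ _ => by norm_num) fun i _ => by linarith [abs_nonneg (y i)]
  have hPi : ∀ i, 1 + |y i| ≤ P := fun i => by
    rw [hP, ← Finset.mul_prod_erase _ _ (Finset.mem_univ i)]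
    have h1 : 1 ≤ ∏ j ∈ Finset.univ.erase i, (1 + |y j|) := by
      calc (1 : ℝ) = ∏ j ∈ Finset.univ.erase i, (1 : ℝ) := by simp
        _ ≤ _ := Finset.prod_le_prod (fun _ _ => by norm_num)
          fun i _ => by linarith [abs_nonneg (y i)]
    exact le_mul_of_one_le_right (by positivity) h1
  have hwt : wt (z - m) ≤ 4 * P := by
    unfold wt
    have : ‖z - m‖ ≤ P + 1 := by
      rw [pi_norm_le_iff_of_nonneg (by linarith)]
      intro i
      rw [Int.norm_eq_abs]
      have h1 : (((z - m) i : ℤ) : ℝ) = y i - (x i - z i) := by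
        simp [hy, cst]
      rw [h1]
      have := abs_sub (y i) (x i - z i)
      linarith [hz i, hPi i]
    linarith
  have h1 : |Ph φ β y| ≤ (∏ i, C i) / P ^ N := by
    rw [Ph, Finset.abs_prod, hP, ← Finset.prod_pow, ← Finset.prod_div_distrib]
    exact Finset.prod_le_prod (fun _ _ => abs_nonneg _) fun i _ => h i (y i)
  refine h1.trans ?_
  rw [div_le_div_iff₀ (by positivity) (pow_pos (wt_pos _) _), mul_assoc, ← mul_pow]
  exact mul_le_mul_of_nonneg_left (pow_le_pow_left₀ (wt_pos _).le hwt N)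
    (Finset.prod_nonneg fun i _ => hC i)

lemma summable_wt_sub (hd : 1 ≤ d) (z : ZZ d) :
    Summable (fun m : ZZ d => 1 / wt (z - m) ^ (d + 1)) := by
  have := (Equiv.subLeft z).summable_iff.2 (summable_wt hd 0)
  exact this

lemma tsum_wt_sub (z : ZZ d) :
    ∑' m : ZZ d, 1 / wt (z - m) ^ (d + 1) = ∑' m : ZZ d, 1 / wt m ^ (d + 1) :=
  (Equiv.subLeft z).tsum_eq (fun m : ZZ d => 1 / wt m ^ (d + 1))

lemma Ker.summ (hφ : Ker φ) (hd : 1 ≤ d) (β : Fin d → ℕ) {w : ZZ d → ℝ} (hw : Bounded1 w)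
    (x : Fin d → ℝ) (z : ZZ d) (hz : near x z) :
    Summable (fun m => w m * Ph φ β (x - cst m)) := by
  obtain ⟨W, hW⟩ := hw
  obtain ⟨C, hC, h⟩ := hφ.Ph_decay β (d + 1)
  refine Summable.of_norm_bounded (g := fun m => W * C * (1 / wt (z - m) ^ (d + 1)))
    ((summable_wt_sub hd z).mul_left _) fun m => ?_
  rw [norm_mul, mul_assoc, mul_one_div]
  exact mul_le_mul (hW m) (h x z m hz) (norm_nonneg _) ((abs_nonneg _).trans (hW m))

def fl (x : Fin d → ℝ) : ZZ d := fun i => ⌊x i⌋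

lemma near_fl (x : Fin d → ℝ) : near x (fl x) := fun i => by
  simp only [fl]
  rw [abs_of_nonneg (by linarith [Int.floor_le (x i)])]
  linarith [Int.lt_floor_add_one (x i)]

lemma Ker.UU_bound (hφ : Ker φ) (hd : 1 ≤ d) (β : Fin d → ℕ) {w : ZZ d → ℝ} {a n : ℕ}
    (hw : Bd a n (fun _ => w)) : ∃ C : ℝ, 0 ≤ C ∧ ∀ x z, near x z →
      |UU φ β w x| ≤ C * (lg z ^ n / wt z ^ a) := by
  obtain ⟨W, hW0, hW⟩ := hw
  obtain ⟨C, hC, h⟩ := hφ.Ph_decay β (a + n + (d + 1))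
  refine ⟨W * C * ∑' m : ZZ d, 1 / wt m ^ (d + 1),
    mul_nonneg (by positivity) (tsum_nonneg fun m => by have := wt_pos m; positivity),
    fun x z hz => ?_⟩
  have key : ∀ m, ‖w m * Ph φ β (x - cst m)‖ ≤
      W * C * (lg z ^ n / wt z ^ a) * (1 / wt (z - m) ^ (d + 1)) := fun m => by
    have e1 : z + (m - z) = m := by abel
    have e2 : m + (z - m) = z := by abel
    have e3 : ‖m - z‖ = ‖z - m‖ := norm_sub_rev _ _
    have b1 : lg m ≤ lg z * wt (z - m) := by
      have := lg_add_le z (m - z)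
      rw [e1, e3] at this
      refine this.trans (mul_le_mul_of_nonneg_left ?_ (lg_pos z).le)
      unfold wt; linarith
    have b2 : wt z ≤ wt m * wt (z - m) := by
      have := wt_add_le m (z - m)
      rw [e2] at this
      refine this.trans (mul_le_mul_of_nonneg_left ?_ (wt_pos m).le)
      unfold wt; linarith
    have pm := wt_pos m
    have pz := wt_pos z
    have pzm := wt_pos (z - m)
    have lz := lg_pos z
    have lm := lg_pos m
    have b3 : lg m ^ n / wt m ^ a ≤ lg z ^ n / wt z ^ a * wt (z - m) ^ (a + n) := by
      rw [div_mul_eq_mul_div, div_le_div_iff₀ (by positivity) (by positivity)]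
      calc lg m ^ n * wt z ^ a ≤ (lg z * wt (z - m)) ^ n * (wt m * wt (z - m)) ^ a := by gcongr
        _ = _ := by rw [mul_pow, mul_pow, pow_add]; ring
    rw [norm_mul]
    calc ‖w m‖ * ‖Ph φ β (x - cst m)‖ ≤
        (W * (lg z ^ n / wt z ^ a * wt (z - m) ^ (a + n))) *
          (C / wt (z - m) ^ (a + n + (d + 1))) :=
          mul_le_mul ((hW 0 m).trans (mul_le_mul_of_nonneg_left b3 hW0)) (h x z m hz)
            (norm_nonneg _) (by positivity)
      _ = _ := by rw [pow_add _ (a + n) (d + 1)]; field_simp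
  have hs := (summable_wt_sub hd z).mul_left (W * C * (lg z ^ n / wt z ^ a))
  have := tsum_of_norm_bounded hs.hasSum key
  rw [Real.norm_eq_abs, tsum_mul_left, tsum_wt_sub] at this
  refine this.trans (le_of_eq (by ring))

lemma Ph_up (β : Fin d → ℕ) (i : Fin d) (y : Fin d → ℝ) :
    Ph φ (up β i) y = φ (β i + 1) (y i) * ∏ j ∈ Finset.univ.erase i, φ (β j) (y j) := by
  rw [Ph, ← Finset.mul_prod_erase _ _ (Finset.mem_univ i)]
  congr 1
  · simp [up]
  · refine Finset.prod_congr rfl fun j hj => ?_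
    simp [up, Finset.ne_of_mem_erase hj]

lemma Ker.Ph_deriv (hφ : Ker φ) (β : Fin d → ℕ) (y : Fin d → ℝ) :
    HasFDerivAt (Ph φ β) (∑ i, (Ph φ (up β i) y - Ph φ (up β i) (y - cst (eb i))) •
      (ContinuousLinearMap.proj (R := ℝ) (φ := fun _ : Fin d => ℝ) i)) y := by
  have h1 : ∀ i ∈ (Finset.univ : Finset (Fin d)), HasFDerivAt (fun y : Fin d → ℝ => φ (β i) (y i))
      ((φ (β i + 1) (y i) - φ (β i + 1) (y i - 1)) •
        (ContinuousLinearMap.proj (R := ℝ) (φ := fun _ : Fin d => ℝ) i)) y := fun i _ =>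
    (hφ.der (β i) (y i)).comp_hasFDerivAt y
      (ContinuousLinearMap.proj (R := ℝ) (φ := fun _ : Fin d => ℝ) i).hasFDerivAt
  have h2 := HasFDerivAt.finsetProd h1
  refine h2.congr_fderiv ?_
  refine Finset.sum_congr rfl fun i _ => ?_
  rw [smul_smul]
  congr 1
  rw [Ph_up, Ph_up]
  have : ∏ j ∈ Finset.univ.erase i, φ (β j) ((y - cst (eb i)) j) =
      ∏ j ∈ Finset.univ.erase i, φ (β j) (y j) := by
    refine Finset.prod_congr rfl fun j hj => ?_
    simp [cst, eb, Finset.ne_of_mem_erase hj]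
  rw [this]
  simp [cst, eb]
  ring

def bd1 (i : Fin d) (w : ZZ d → ℝ) (m : ZZ d) : ℝ := w m - w (m - eb i)

lemma Bounded1.bd1 {w : ZZ d → ℝ} (hw : Bounded1 w) (i : Fin d) : Bounded1 (bd1 i w) := by
  obtain ⟨C, hC⟩ := hw
  refine ⟨C + C, fun m => ?_⟩
  have := abs_sub (w m) (w (m - eb i))
  simp only [Defect.bd1]; linarith [hC m, hC (m - eb i)]

def prj (i : Fin d) : (Fin d → ℝ) →L[ℝ] ℝ :=
  ContinuousLinearMap.proj (R := ℝ) (φ := fun _ : Fin d => ℝ) i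

lemma Ker.term_deriv (hφ : Ker φ) (β : Fin d → ℕ) (c : ℝ) (m : ZZ d) (y : Fin d → ℝ) :
    HasFDerivAt (fun y => c * Ph φ β (y - cst m))
      (∑ i, (c * Ph φ (up β i) (y - cst m) - c * Ph φ (up β i) (y - cst (m + eb i))) • prj i) y := by
  have hsub : ∀ (i : Fin d), y - cst m - cst (eb i) = y - cst (m + eb i) :=
    fun i => by rw [cst_add]; abel
  have h1 := (hφ.Ph_deriv β (y - cst m)).comp y ((hasFDerivAt_id y).sub_const (cst m))
  have h2 := h1.const_mul c
  refine h2.congr_fderiv ?_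
  rw [ContinuousLinearMap.comp_id, Finset.smul_sum]
  refine Finset.sum_congr rfl fun i _ => ?_
  rw [smul_smul, hsub, mul_sub]
  rfl

lemma near_ball (x : Fin d → ℝ) : ∀ y ∈ Metric.ball x 1, near y (fl x) := fun y hy i => by
  have h1 : |y i - x i| ≤ 1 := by
    have := norm_le_pi_norm (y - x) i
    rw [Metric.mem_ball, dist_eq_norm] at hy
    simp only [Pi.sub_apply, Real.norm_eq_abs] at this
    linarith
  have h2 : |x i - fl x i| ≤ 1 := by
    simp only [fl]
    rw [abs_of_nonneg (by linarith [Int.floor_le (x i)])]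
    linarith [Int.lt_floor_add_one (x i)]
  have := abs_add_le (y i - x i) (x i - fl x i)
  rw [sub_add_sub_cancel] at this
  linarith

lemma summable_wt_sub2 (hd : 1 ≤ d) (x : Fin d → ℝ) (i : Fin d) :
    Summable (fun m : ZZ d => 1 / wt (fl x - (m + eb i)) ^ (d + 1)) := by
  have h := (Equiv.addRight (eb i)).summable_iff.2 (summable_wt_sub hd (fl x))
  have e : (fun m : ZZ d => 1 / wt (fl x - m) ^ (d + 1)) ∘ (Equiv.addRight (eb i)) =
    fun m : ZZ d => 1 / wt (fl x - (m + eb i)) ^ (d + 1) := by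
    funext m; simp only [Function.comp_apply, Equiv.coe_addRight]
  rwa [e] at h

lemma Ker.UU_deriv_aux (hφ : Ker φ) (hd : 1 ≤ d) (β : Fin d → ℕ) {w : ZZ d → ℝ} (hw : Bounded1 w)
    (x : Fin d → ℝ) : HasFDerivAt (fun y => ∑' m, w m * Ph φ β (y - cst m))
      (∑' m, ∑ i, (w m * Ph φ (up β i) (x - cst m) -
        w m * Ph φ (up β i) (x - cst (m + eb i))) • prj i) x := by
  have hw' := hw
  obtain ⟨W, hW⟩ := hw
  have hW0 : 0 ≤ W := (abs_nonneg _).trans (hW 0)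
  choose C hC0 hC using fun i => hφ.Ph_decay (up β i) (d + 1)
  have hs2 : ∀ i, Summable (fun m : ZZ d => 1 / wt (fl x - (m + eb i)) ^ (d + 1)) := fun i =>
    summable_wt_sub2 hd x i
  have hsum : Summable (fun m : ZZ d => ∑ i, (W * C i * (1 / wt (fl x - m) ^ (d + 1)) +
      W * C i * (1 / wt (fl x - (m + eb i)) ^ (d + 1))) * ‖prj i‖) :=
    summable_sum fun i _ => (((summable_wt_sub hd (fl x)).mul_left _).add
      ((hs2 i).mul_left _)).mul_right _
  have hbd : ∀ (m : ZZ d) (y : Fin d → ℝ), y ∈ Metric.ball x 1 →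
      ‖∑ i, (w m * Ph φ (up β i) (y - cst m) -
        w m * Ph φ (up β i) (y - cst (m + eb i))) • prj i‖ ≤
      ∑ i, (W * C i * (1 / wt (fl x - m) ^ (d + 1)) +
      W * C i * (1 / wt (fl x - (m + eb i)) ^ (d + 1))) * ‖prj i‖ := by
    intro m y hy
    refine (norm_sum_le _ _).trans (Finset.sum_le_sum fun i _ => ?_)
    rw [norm_smul]
    refine mul_le_mul_of_nonneg_right ?_ (norm_nonneg _)
    refine (norm_sub_le _ _).trans (add_le_add ?_ ?_)
    · rw [norm_mul, mul_assoc, mul_one_div]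
      exact mul_le_mul (hW m) (hC i y _ m (near_ball x y hy)) (norm_nonneg _) hW0
    · rw [norm_mul, mul_assoc, mul_one_div]
      exact mul_le_mul (hW m) (hC i y _ _ (near_ball x y hy)) (norm_nonneg _) hW0
  have hder : ∀ (m : ZZ d) (y : Fin d → ℝ), y ∈ Metric.ball x 1 → HasFDerivAt
      (fun y => w m * Ph φ β (y - cst m)) (∑ i, (w m * Ph φ (up β i) (y - cst m) -
        w m * Ph φ (up β i) (y - cst (m + eb i))) • prj i) y :=
    fun m y _ => hφ.term_deriv β (w m) m y
  exact hasFDerivAt_tsum_of_isPreconnected hsum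
    Metric.isOpen_ball (convex_ball x 1).isPreconnected hder hbd
    (Metric.mem_ball_self one_pos) (hφ.summ hd β hw' x _ (near_fl x))
    (Metric.mem_ball_self one_pos)

lemma Ker.UU_deriv (hφ : Ker φ) (hd : 1 ≤ d) (β : Fin d → ℕ) {w : ZZ d → ℝ} (hw : Bounded1 w)
    (x : Fin d → ℝ) : HasFDerivAt (UU φ β w) (∑ i, UU φ (up β i) (bd1 i w) x • prj i) x := by
  refine HasFDerivAt.congr_fderiv (hφ.UU_deriv_aux hd β hw x) ?_
  obtain ⟨W, hW⟩ := hw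
  refine HasSum.tsum_eq (hasSum_sum fun i _ => HasSum.smul_const ?_ _)
  have s1 := hφ.summ hd (up β i) ⟨W, hW⟩ x _ (near_fl x)
  have s2 : Summable (fun m => w (m - eb i) * Ph φ (up β i) (x - cst m)) :=
    hφ.summ hd (up β i) (w := fun m => w (m - eb i)) ⟨W, fun m => hW _⟩ x _ (near_fl x)
  have e : UU φ (up β i) (bd1 i w) x = ∑' m, w m * Ph φ (up β i) (x - cst m) -
      ∑' m, w (m - eb i) * Ph φ (up β i) (x - cst m) := by
    rw [← s1.tsum_sub s2]
    exact tsum_congr fun m => by simp only [bd1]; ring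
  rw [e]
  refine s1.hasSum.sub ?_
  have h3 := (Equiv.addRight (eb i)).hasSum_iff.2 s2.hasSum
  have e : (fun m => w (m - eb i) * Ph φ (up β i) (x - cst m)) ∘ (Equiv.addRight (eb i)) =
      fun m => w m * Ph φ (up β i) (x - cst (m + eb i)) := by
    funext m; simp only [Function.comp_apply, Equiv.coe_addRight, add_sub_cancel_right]
  rwa [e] at h3

end

section
variable {d : ℕ} {φ : ℕ → ℝ → ℝ}

lemma bounded1_of_ty {w : ZZ d → ℝ} {a n : ℕ} (hna : n ≤ a) (h : ∀ M, Ty a n M (fun _ => w)) :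
    Bounded1 w := by
  obtain ⟨C, hC, hb⟩ := (h 0).bd
  refine ⟨C, fun x => (hb 0 x).trans ?_⟩
  have h1 : lg x ^ n / wt x ^ a ≤ 1 := by
    rw [div_le_one (pow_pos (wt_pos x) _)]
    exact (pow_le_pow_left₀ (lg_pos x).le (lg_le_wt x) n).trans
      (pow_le_pow_right₀ (one_le_wt x) hna)
  calc C * (lg x ^ n / wt x ^ a) ≤ C * 1 := by gcongr
    _ = C := mul_one C

lemma bd1_ty {w : ZZ d → ℝ} {a n : ℕ} (h : ∀ M, Ty a n M (fun _ => w)) (i : Fin d) (M : ℕ) :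
    Ty (a + 1) n M (fun _ => bd1 i w) := by
  have h1 := (Ty.df (h (M + 1)) (-eb i)).neg
  refine h1.congr fun p z => ?_
  simp only [bd1, Df, sub_eq_add_neg, neg_add_rev, neg_neg]

lemma Ker.UU_fderiv (hφ : Ker φ) (hd : 1 ≤ d) (β : Fin d → ℕ) {w : ZZ d → ℝ} (hw : Bounded1 w) :
    fderiv ℝ (UU φ β w) = fun x => ∑ i, (ContinuousLinearMap.toSpanSingleton ℝ (prj (d := d) i))
      (UU φ (up β i) (bd1 i w) x) := by
  funext x
  rw [(hφ.UU_deriv hd β hw x).fderiv]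
  rfl

lemma Ker.UU_main (hφ : Ker φ) (hd : 1 ≤ d) (n : ℕ) : ∀ (j a : ℕ) (β : Fin d → ℕ) (w : ZZ d → ℝ),
    n ≤ a → (∀ M, Ty a n M (fun _ => w)) → ContDiff ℝ j (UU φ β w) ∧ ∃ C : ℝ, 0 ≤ C ∧
      ∀ x z, near x z → ‖iteratedFDeriv ℝ j (UU φ β w) x‖ ≤ C * (lg z ^ n / wt z ^ (a + j)) := by
  intro j
  induction j with
  | zero =>
    intro a β w hna hw
    have hB := bounded1_of_ty hna hw
    refine ⟨?_, ?_⟩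
    · have : Continuous (UU φ β w) := continuous_iff_continuousAt.2 fun x =>
        (hφ.UU_deriv hd β hB x).continuousAt
      exact contDiff_zero.2 this
    · obtain ⟨C, hC, h⟩ := hφ.UU_bound hd β (hw 0).bd
      refine ⟨C, hC, fun x z hz => ?_⟩
      rw [norm_iteratedFDeriv_zero]
      exact h x z hz
  | succ j ih =>
    intro a β w hna hw
    have hB := bounded1_of_ty hna hw
    have hfd := hφ.UU_fderiv hd β hB
    have hih := fun i => ih (a + 1) (up β i) (bd1 i w) (by omega) (bd1_ty hw i)
    have hcd : ∀ i : Fin d, ContDiff ℝ j (fun x => (ContinuousLinearMap.toSpanSingleton ℝ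
        (prj (d := d) i)) (UU φ (up β i) (bd1 i w) x)) := fun i =>
      (ContinuousLinearMap.contDiff _).comp (hih i).1
    refine ⟨?_, ?_⟩
    · have := (contDiff_succ_iff_fderiv (𝕜 := ℝ) (n := (j : WithTop ℕ∞)) (f := UU φ β w)).2
        ⟨fun x => (hφ.UU_deriv hd β hB x).differentiableAt, by simp, by
          rw [hfd]; exact ContDiff.sum fun i _ => hcd i⟩
      exact_mod_cast this
    · choose C hC h using fun i => (hih i).2
      refine ⟨∑ i, ‖ContinuousLinearMap.toSpanSingleton ℝ (prj (d := d) i)‖ * C i,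
        Finset.sum_nonneg fun i _ => mul_nonneg (ContinuousLinearMap.opNorm_nonneg _) (hC i), fun x z hz => ?_⟩
      rw [← norm_iteratedFDeriv_fderiv, hfd, iteratedFDeriv_sum fun i _ => hcd i, Finset.sum_apply]
      refine (norm_sum_le _ _).trans ?_
      rw [Finset.sum_mul]
      refine Finset.sum_le_sum fun i _ => ?_
      have h1 := ContinuousLinearMap.norm_iteratedFDeriv_comp_left
        (ContinuousLinearMap.toSpanSingleton ℝ (prj (d := d) i))
        ((hih i).1.contDiffAt (x := x)) (le_refl _)
      refine h1.trans ?_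
      rw [mul_assoc]
      refine mul_le_mul_of_nonneg_left ?_ (ContinuousLinearMap.opNorm_nonneg _)
      have := h i x z hz
      rwa [show a + 1 + j = a + (j + 1) by ring] at this

lemma Ker.UU_int (hφ : Ker φ) (w : ZZ d → ℝ) (m : ZZ d) : UU φ 0 w (cst m) = w m := by
  unfold UU
  rw [tsum_eq_single m]
  · have : Ph φ 0 (cst m - cst m) = 1 := by
      rw [Ph]
      refine Finset.prod_eq_one fun i _ => ?_
      have := hφ.int 0
      simpa using this
    rw [this, mul_one]
  · intro k hk
    obtain ⟨i, hi⟩ := Function.ne_iff.1 hk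
    have : Ph φ 0 (cst m - cst k) = 0 := by
      rw [Ph]
      refine Finset.prod_eq_zero (Finset.mem_univ i) ?_
      have h := hφ.int (m i - k i)
      rw [if_neg (by omega)] at h
      simpa [cst] using h
    rw [this, mul_zero]

/-- smooth interpolation of a lattice function with decaying differences -/
lemma exists_interp (hd : 1 ≤ d) {w : ZZ d → ℝ} {a n : ℕ} (hna : n ≤ a)
    (hw : ∀ M, Ty a n M (fun _ => w)) : ∃ U : (Fin d → ℝ) → ℝ, ContDiff ℝ (⊤ : ℕ∞) U ∧
      (∀ m, U (cst m) = w m) ∧ ∀ j : ℕ, ∃ C : ℝ, 0 ≤ C ∧ ∀ x,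
        ‖iteratedFDeriv ℝ j U x‖ ≤ C * (lg (fl x) ^ n / wt (fl x) ^ (a + j)) := by
  obtain ⟨φ, h1, h2, h3⟩ := exists_kernels
  have hφ : Ker φ := ⟨h1, h2, h3⟩
  refine ⟨UU φ 0 w, contDiff_infty.2 fun j => (hφ.UU_main hd n j a 0 w hna hw).1,
    hφ.UU_int w, fun j => ?_⟩
  obtain ⟨C, hC, h⟩ := (hφ.UU_main hd n j a 0 w hna hw).2
  exact ⟨C, hC, fun x => h x _ (near_fl x)⟩

end

section
variable {d : ℕ}

lemma Dl_closed {α : Type} [DecidableEq α] (ρ : α → ZZ d) : ∀ (l : List α) (_ : l.Nodup)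
    (f : ZZ d → ℝ) (z : ZZ d), Dl (l.map ρ) f z =
      ∑ S ∈ l.toFinset.powerset, (-1 : ℝ) ^ (l.length - S.card) * f (z + ∑ i ∈ S, ρ i) := by
  intro l
  induction l with
  | nil => intro _ f z; simp [Dl]
  | cons a l ih =>
    intro hl f z
    obtain ⟨ha, hl⟩ := List.nodup_cons.1 hl
    have ha' : a ∉ l.toFinset := by simpa using ha
    rw [List.map_cons, Dl, ih hl, List.toFinset_cons, Finset.sum_powerset_insert ha',
      ← Finset.sum_add_distrib]
    refine Finset.sum_congr rfl fun S hS => ?_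
    have hS' := Finset.mem_powerset.1 hS
    have haS : a ∉ S := fun h => ha' (hS' h)
    have hc : S.card ≤ l.length := (Finset.card_le_card hS').trans (List.toFinset_card_le l)
    rw [Finset.card_insert_of_notMem haS, Finset.sum_insert haS, List.length_cons,
      Nat.add_sub_add_right, Nat.succ_sub hc, pow_succ, Df,
      show z + (ρ a + ∑ i ∈ S, ρ i) = z + ∑ i ∈ S, ρ i + ρ a by abel]
    ring

lemma Dl_ofFn {j : ℕ} (ρ : Fin j → ZZ d) (f : ZZ d → ℝ) (z : ZZ d) :
    Dl (List.ofFn ρ) f z =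
      ∑ S : Finset (Fin j), (-1 : ℝ) ^ (j - S.card) * f (z + ∑ i ∈ S, ρ i) := by
  have h := Dl_closed ρ (List.finRange j) (List.nodup_finRange j) f z
  rw [← List.ofFn_eq_map, List.length_finRange] at h
  rw [h]
  congr 1
  rw [List.toFinset_finRange]
  exact Finset.powerset_univ

lemma Df_add_dir' (a b : ZZ d) (f : ZZ d → ℝ) :
    Df (a + b) f = fun z => Df a f (z + b) + Df b f z := by
  funext z; simp only [Df]; rw [show z + (a + b) = z + b + a by abel]; ring

lemma Df_neg_dir' (a : ZZ d) (f : ZZ d → ℝ) :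
    Df (-a) f = fun z => (-1) * Df a f (z + (-a)) := by
  funext z; simp only [Df]; rw [show z + -a + a = z by abel]; ring

/-- decay in a generating set of directions -/
def GQ (S : Set (ZZ d)) (a : ℕ) (f : ZZ d → ℝ) : Prop :=
  ∀ us : List (ZZ d), (∀ u ∈ us, u ∈ S) → Bd (a + us.length) 0 (fun _ => Dl us f)

lemma GQ.step {S : Set (ZZ d)} (hS : ∀ z, z ∈ AddSubgroup.closure S) {a : ℕ} {f : ZZ d → ℝ}
    (h : ∀ r ∈ S, GQ S a (Df r f)) (w : ZZ d) : GQ S a (Df w f) := by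
  refine AddSubgroup.closure_induction (p := fun w _ => GQ S a (Df w f)) (fun r hr => h r hr)
    ?_ ?_ ?_ (hS w)
  · intro us hus
    have := Bd.const_mul 0 ((Ty.of_finsupp (d := d) (f := fun _ => 0) (by simp) (a + us.length) 0 0).bd)
    refine this.congr fun p z => ?_
    have := Dl_cons_zero us f z
    rw [Dl] at this
    rw [this]; ring
  · intro x y _ _ hx hy us hus
    rw [Df_add_dir', Dl_add, Dl_shift us y (Df x f)]
    exact ((hx us hus).shift y).add (hy us hus)
  · intro x _ hx us hus
    rw [Df_neg_dir', Dl_const_mul, Dl_shift us (-x) (Df x f)]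
    exact ((hx us hus).shift (-x)).const_mul (-1)

lemma GQ.next {S : Set (ZZ d)} {a : ℕ} {f : ZZ d → ℝ} (h : GQ S a f) : ∀ r ∈ S, GQ S (a + 1) (Df r f) := by
  intro r hr us hus
  have := h (r :: us) (by simpa using ⟨hr, hus⟩)
  rw [List.length_cons] at this
  rwa [show a + 1 + us.length = a + (us.length + 1) by ring]

lemma ty_of_gen {S : Set (ZZ d)} (hS : ∀ z, z ∈ AddSubgroup.closure S) {a : ℕ} {f : ZZ d → ℝ}
    (h : ∀ r ∈ S, GQ S a (Df r f)) (v : ZZ d) (M : ℕ) : Ty a 0 M (fun _ => Df v f) := by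
  have key : ∀ (vs : List (ZZ d)) (a : ℕ) (f : ZZ d → ℝ), GQ S a f →
      Bd (a + vs.length) 0 (fun _ => Dl vs f) := by
    intro vs
    induction vs with
    | nil => intro a f h; exact h [] (by simp)
    | cons v vs ih =>
      intro a f h
      have := ih (a + 1) (Df v f) (GQ.step hS h.next v)
      rwa [show a + 1 + vs.length = a + (v :: vs).length by simp; ring] at this
  exact fun vs _ => key vs a _ (GQ.step hS h v)

lemma tendsto_of_gen {S : Set (ZZ d)} (hS : ∀ z, z ∈ AddSubgroup.closure S) {f : ZZ d → ℝ}
    (h : ∀ r ∈ S, Tendsto (Df r f) cofinite (𝓝 0)) (v : ZZ d) :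
    Tendsto (Df v f) cofinite (𝓝 0) := by
  have hsh : ∀ (x y : ZZ d), Tendsto (Df x f) cofinite (𝓝 0) →
      Tendsto (fun z => Df x f (z + y)) cofinite (𝓝 0) := fun x y hx =>
    hx.comp (add_left_injective y).tendsto_cofinite
  refine AddSubgroup.closure_induction (p := fun w _ => Tendsto (Df w f) cofinite (𝓝 0))
    (fun r hr => h r hr) ?_ ?_ ?_ (hS v)
  · have : Df (0 : ZZ d) f = fun _ => 0 := by funext z; simp [Df]
    rw [this]; exact tendsto_const_nhds
  · intro x y _ _ hx hy
    rw [Df_add_dir']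
    simpa using (hsh x y hx).add hy
  · intro x _ hx
    rw [Df_neg_dir']
    simpa using (hsh x (-x) hx).const_mul (-1)

lemma cmp_log (c : ℝ) (hc : 1 ≤ c) (M q : ℕ) : ∃ C : ℝ, 0 ≤ C ∧ ∀ t a : ℝ, 2 ≤ t → 2 ≤ a →
    t ≤ c * a → a ≤ c * t → (1 + Real.log t) ^ 1 / t ^ M ≤ C * (Real.log a ^ (q + 1) / a ^ M) := by
  have hl2 : 0 < Real.log 2 := Real.log_pos (by norm_num)
  have hlc : 0 ≤ Real.log c := Real.log_nonneg hc
  refine ⟨((1 + Real.log c) / Real.log 2 + 1) / Real.log 2 ^ q * c ^ M, by positivity,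
    fun t a ht ha hta hat => ?_⟩
  have hla : Real.log 2 ≤ Real.log a := Real.log_le_log (by norm_num) ha
  have hla0 : 0 < Real.log a := hl2.trans_le hla
  have h1 : 1 + Real.log t ≤ ((1 + Real.log c) / Real.log 2 + 1) * Real.log a := by
    have h2 : Real.log t ≤ Real.log c + Real.log a := by
      rw [← Real.log_mul (by linarith) (by linarith)]
      exact Real.log_le_log (by linarith) hta
    have h3 : 1 + Real.log c ≤ (1 + Real.log c) / Real.log 2 * Real.log a := by
      rw [div_mul_eq_mul_div, le_div_iff₀ hl2]
      exact mul_le_mul_of_nonneg_left hla (by linarith)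
    linarith
  have h4 : Real.log a ≤ Real.log a ^ (q + 1) / Real.log 2 ^ q := by
    rw [le_div_iff₀ (by positivity), pow_succ, mul_comm]
    gcongr
  have h5 : 1 / t ^ M ≤ c ^ M / a ^ M := by
    rw [div_le_div_iff₀ (by positivity) (by positivity), one_mul, ← mul_pow]
    gcongr
  calc (1 + Real.log t) ^ 1 / t ^ M = (1 + Real.log t) * (1 / t ^ M) := by rw [pow_one]; ring
    _ ≤ (((1 + Real.log c) / Real.log 2 + 1) * (Real.log a ^ (q + 1) / Real.log 2 ^ q)) *
        (c ^ M / a ^ M) := by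
        refine mul_le_mul (h1.trans ?_) h5 (by positivity) (by positivity)
        gcongr
    _ = _ := by ring

lemma enorm_nonneg {n : ℕ} (v : Vec n) : 0 ≤ enorm v := Real.sqrt_nonneg _

lemma abs_le_enorm {n : ℕ} (v : Vec n) (i : Fin n) : |v i| ≤ enorm v := by
  rw [enorm]
  refine Real.le_sqrt_of_sq_le ?_
  rw [sq_abs]
  exact Finset.single_le_sum (f := fun i => v i ^ 2) (fun i _ => sq_nonneg _) (Finset.mem_univ i)

lemma sqrt_sum_sq_le {α : Type} (T : Finset α) (f : α → ℝ) (hf : ∀ a ∈ T, 0 ≤ f a) :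
    Real.sqrt (∑ a ∈ T, f a ^ 2) ≤ ∑ a ∈ T, f a := by
  rw [Real.sqrt_le_left (Finset.sum_nonneg hf)]
  exact Finset.sum_sq_le_sq_sum_of_nonneg hf

lemma enorm_le_sum {n : ℕ} (v : Vec n) : enorm v ≤ ∑ i, |v i| := by
  have := sqrt_sum_sq_le Finset.univ (fun i => |v i|) (fun i _ => abs_nonneg _)
  simp only [sq_abs] at this
  exact this

lemma norm_le_enorm {n : ℕ} (v : Vec n) : ‖v‖ ≤ enorm v :=
  (pi_norm_le_iff_of_nonneg (enorm_nonneg v)).2 fun i => abs_le_enorm v i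

lemma enorm_le_norm {n : ℕ} (v : Vec n) : enorm v ≤ n * ‖v‖ := by
  refine (enorm_le_sum v).trans ?_
  calc ∑ i, |v i| ≤ ∑ _i : Fin n, ‖v‖ := Finset.sum_le_sum fun i _ => norm_le_pi_norm v i
    _ = _ := by simp

lemma two_le_ang {n : ℕ} (v : Vec n) : 2 ≤ ang v := by
  have := enorm_nonneg v
  unfold ang; linarith

lemma cmp_ang (e : (Fin d → ℝ) ≃L[ℝ] Vec d) : ∃ c : ℝ, 1 ≤ c ∧ ∀ x,
    ‖x‖ + 2 ≤ c * ang (e x) ∧ ang (e x) ≤ c * (‖x‖ + 2) := by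
  set E1 := ‖(e : (Fin d → ℝ) →L[ℝ] Vec d)‖
  set E2 := ‖(e.symm : Vec d →L[ℝ] (Fin d → ℝ))‖
  have p1 : 0 ≤ E1 := norm_nonneg _
  have p2 : 0 ≤ E2 := norm_nonneg _
  have hd : (0 : ℝ) ≤ d := Nat.cast_nonneg d
  refine ⟨1 + E2 + d * E1, by nlinarith [mul_nonneg hd p1], fun x => ⟨?_, ?_⟩⟩
  · have h1 : ‖x‖ ≤ E2 * ‖e x‖ := by
      have := (e.symm : Vec d →L[ℝ] (Fin d → ℝ)).le_opNorm (e x)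
      simpa using this
    have h2 := norm_le_enorm (e x)
    have h3 := enorm_nonneg (e x)
    have h4 : 0 ≤ (d : ℝ) * E1 := by positivity
    unfold ang
    nlinarith [mul_le_mul_of_nonneg_left h2 p2, mul_nonneg h4 h3]
  · have h1 : ‖e x‖ ≤ E1 * ‖x‖ := (e : (Fin d → ℝ) →L[ℝ] Vec d).le_opNorm x
    have h2 := enorm_le_norm (e x)
    have h3 := norm_nonneg x
    have h4 : 0 ≤ (d : ℝ) * E1 := by positivity
    unfold ang
    nlinarith [mul_le_mul_of_nonneg_left h1 hd, mul_nonneg p2 h3]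

lemma uniqueDiff_ext (rad : ℝ) (hr : 0 < rad) : UniqueDiffOn ℝ {y : Vec d | rad ≤ enorm y} := by
  intro x hx
  have hx' : rad ≤ enorm x := hx
  set L : Vec d →ₗ[ℝ] ℝ := ∑ i, x i • LinearMap.proj (R := ℝ) (φ := fun _ : Fin d => ℝ) i with hL
  have hLv : ∀ y, L y = ∑ i, x i * y i := fun y => by simp [hL, LinearMap.sum_apply]
  have hLx : L x = enorm x ^ 2 := by
    rw [hLv, enorm, Real.sq_sqrt (Finset.sum_nonneg fun i _ => sq_nonneg _)]
    exact Finset.sum_congr rfl fun i _ => by ring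
  have hpos : 0 < enorm x := hr.trans_le hx'
  set H : Set (Vec d) := {y | L x ≤ L y} with hH
  have hsub : H ⊆ {y : Vec d | rad ≤ enorm y} := by
    intro y hy
    have hy' : L x ≤ L y := hy
    have hcs : L y ≤ enorm x * enorm y := by
      rw [hLv]
      exact Real.sum_mul_le_sqrt_mul_sqrt _ _ _
    have : enorm x * enorm x ≤ enorm x * enorm y := by rw [← sq, ← hLx]; exact hy'.trans hcs
    exact hx'.trans (le_of_mul_le_mul_left this hpos)
  refine UniqueDiffWithinAt.mono ?_ hsub
  refine uniqueDiffWithinAt_convex (convex_halfSpace_ge L.isLinear (L x)) ?_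
    (subset_closure (le_refl (L x)))
  have hc : Continuous L := L.continuous_of_finiteDimensional
  refine ⟨(2 : ℝ) • x, interior_maximal (s := H) (t := {y | L x < L y}) (fun y (hy : L x < L y) => show L x ≤ L y from le_of_lt hy)
    (isOpen_lt continuous_const hc) ?_⟩
  show L x < L ((2 : ℝ) • x)
  rw [map_smul, smul_eq_mul, hLx]
  nlinarith [pow_pos hpos 2]

end

section
variable {d : ℕ}

structure Crd (A : Matrix (Fin d) (Fin d) ℝ) (s : Fin d → Vec d)
    (e : (Fin d → ℝ) ≃L[ℝ] Vec d) (τ : ZZ d ≃ ZZ d) : Prop where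
  es : ∀ x, e x = ∑ i, x i • s i
  lat : ∀ z, e (cst z) = latticePt d A (τ z)

lemma cst_inj : Function.Injective (cst (d := d)) := fun a b h => by
  funext i
  have := congrFun h i
  simpa [cst] using this

lemma latticePt_inj {A : Matrix (Fin d) (Fin d) ℝ} (hA : IsUnit A.det) :
    Function.Injective (latticePt d A) := by
  have h1 : Function.Injective A.mulVec :=
    Matrix.mulVec_injective_of_isUnit ((Matrix.isUnit_iff_isUnit_det A).2 hA)
  intro a b h
  exact cst_inj (h1 h)

lemma exists_crd {A : Matrix (Fin d) (Fin d) ℝ} (hA : IsUnit A.det)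
    (s : Fin d → Vec d) (hslat : ∀ i, s i ∈ Lattice d A)
    (hsind : LinearIndependent ℝ s)
    (hsspan : ∀ x ∈ Lattice d A, ∃ z : Fin d → ℤ, x = ∑ i, (z i : ℝ) • s i) :
    ∃ e τ, Crd A s e τ := by
  set b := basisOfLinearIndependentOfCardEqFinrank' s hsind (by simp) with hb
  set e := b.equivFun.symm.toContinuousLinearEquiv with he
  have hes : ∀ x, e x = ∑ i, x i • s i := fun x => by
    have : e x = b.equivFun.symm x := rfl
    rw [this, Module.Basis.equivFun_symm_apply]
    simp [hb]
  choose w hw using hslat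
  have hex : ∀ z : ZZ d, ∃ y : ZZ d, latticePt d A y = e (cst z) := fun z => by
    refine ⟨fun j => ∑ i, z i * w i j, ?_⟩
    rw [hes]
    funext k
    simp only [latticePt, Finset.sum_apply, Pi.smul_apply, smul_eq_mul, cst, ← hw]
    push_cast
    simp only [Finset.mul_sum]
    rw [Finset.sum_comm]
    exact Finset.sum_congr rfl fun i _ => Finset.sum_congr rfl fun j _ => by ring
  choose τ hτ using hex
  have hinj : Function.Injective τ := fun a b h => by
    have : e (cst a) = e (cst b) := by rw [← hτ, ← hτ, h]
    exact cst_inj (e.injective this)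
  have hsurj : Function.Surjective τ := fun y => by
    obtain ⟨z, hz⟩ := hsspan (latticePt d A y) ⟨y, rfl⟩
    refine ⟨z, latticePt_inj hA ?_⟩
    rw [hτ, hes, hz]
    rfl
  exact ⟨e, Equiv.ofBijective τ ⟨hinj, hsurj⟩, hes, fun z => (hτ z).symm⟩

variable {A : Matrix (Fin d) (Fin d) ℝ} {s : Fin d → Vec d}
    {e : (Fin d → ℝ) ≃L[ℝ] Vec d} {τ : ZZ d ≃ ZZ d}

def io (e : (Fin d → ℝ) ≃L[ℝ] Vec d) (z : ZZ d) : Vec d := e (cst z)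

lemma io_add (z w : ZZ d) : io e (z + w) = io e z + io e w := by
  rw [io, cst_add, map_add]; rfl

lemma cst_neg (z : ZZ d) : cst (-z) = - cst z := by funext i; simp [cst]

lemma io_neg (z : ZZ d) : io e (-z) = - io e z := by
  rw [io, cst_neg, map_neg]; rfl

lemma io_zero : io e (0 : ZZ d) = 0 := by
  have : cst (0 : ZZ d) = 0 := by funext i; simp [cst]
  rw [io, this, map_zero]

lemma io_sum {α : Type} (T : Finset α) (f : α → ZZ d) : io e (∑ i ∈ T, f i) = ∑ i ∈ T, io e (f i) := by
  classical
  induction T using Finset.induction_on with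
  | empty => simp [io_zero]
  | insert a T ha ih => rw [Finset.sum_insert ha, Finset.sum_insert ha, io_add, ih]

lemma io_zsmul (n : ℤ) (z : ZZ d) : io e (n • z) = (n : ℝ) • io e z := by
  have : cst (n • z) = (n : ℝ) • cst z := by funext i; simp [cst]
  rw [io, this, map_smul]; rfl

lemma io_inj : Function.Injective (io e) := fun a b h => cst_inj (e.injective h)

lemma Crd.io_eb (h : Crd A s e τ) (i : Fin d) : io e (eb i) = s i := by
  rw [io, h.es, Finset.sum_eq_single i]
  · simp [cst, eb]
  · intro j _ hj; simp [cst, eb, hj]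
  · simp

lemma Crd.exists_dir (h : Crd A s e τ) (R : Finset (Vec d)) (hRlat : ∀ ρ ∈ R, ρ ∈ Lattice d A)
    (hRspan : ∀ x ∈ Lattice d A, ∃ c : Vec d → ℤ, x = ∑ ρ ∈ R, (c ρ : ℝ) • ρ) :
    ∃ σ : {x // x ∈ R} → ZZ d, (∀ ρ, io e (σ ρ) = ρ) ∧
      ∀ z, z ∈ AddSubgroup.closure (Set.range σ) := by
  have hex : ∀ ρ : {x // x ∈ R}, ∃ y, io e y = ρ := fun ρ => by
    obtain ⟨w, hw⟩ := hRlat ρ ρ.2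
    refine ⟨τ.symm w, ?_⟩
    rw [io, h.lat, Equiv.apply_symm_apply, hw]
  choose σ hσ using hex
  refine ⟨σ, hσ, fun z => ?_⟩
  obtain ⟨c, hc⟩ := hRspan (io e z) ⟨τ z, (h.lat z).symm⟩
  have : z = ∑ ρ : {x // x ∈ R}, c ρ • σ ρ := by
    apply io_inj (e := e)
    rw [io_sum, hc, ← Finset.sum_coe_sort]
    exact Finset.sum_congr rfl fun ρ _ => by rw [io_zsmul, hσ]
  rw [this]
  exact AddSubgroup.sum_mem _ fun ρ _ => AddSubgroup.zsmul_mem _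
    (AddSubgroup.subset_closure (Set.mem_range_self ρ)) _

lemma Dmulti_io {n j : ℕ} (ρs : Fin j → Vec d) (σs : Fin j → ZZ d) (hσ : ∀ i, io e (σs i) = ρs i)
    (u : Vec d → Vec n) (z : ZZ d) (k : Fin n) :
    Dmulti ρs u (io e z) k = Dl (List.ofFn σs) (fun z => u (io e z) k) z := by
  rw [Dl_ofFn, Dmulti, Finset.sum_apply]
  refine Finset.sum_congr rfl fun S _ => ?_
  rw [io_add, io_sum]
  simp only [hσ, Pi.smul_apply, smul_eq_mul]

lemma D1_io {n : ℕ} (ρ : Vec d) (σ : ZZ d) (hσ : io e σ = ρ)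
    (u : Vec d → Vec n) (z : ZZ d) (k : Fin n) :
    D1 ρ u (io e z) k = Df σ (fun z => u (io e z) k) z := by
  simp only [D1, Df, io_add, hσ, Pi.sub_apply]

lemma le_DnormJ {n j : ℕ} (R : Finset (Vec d)) (u : Vec d → Vec n) (ℓ : Vec d)
    (ρs : Fin j → {x // x ∈ R}) (k : Fin n) :
    |Dmulti (fun i => (ρs i : Vec d)) u ℓ k| ≤ DnormJ R j u ℓ := by
  refine (abs_le_enorm _ k).trans ?_
  rw [DnormJ]
  refine Real.le_sqrt_of_sq_le ?_
  exact Finset.single_le_sum (f := fun ρs : Fin j → {x // x ∈ R} =>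
    enorm (Dmulti (fun i => (ρs i : Vec d)) u ℓ) ^ 2) (fun i _ => sq_nonneg _) (Finset.mem_univ ρs)

lemma DnormJ_le {n j : ℕ} (R : Finset (Vec d)) (u : Vec d → Vec n) (ℓ : Vec d) :
    DnormJ R j u ℓ ≤ ∑ ρs : Fin j → {x // x ∈ R}, ∑ k,
      |Dmulti (fun i => (ρs i : Vec d)) u ℓ k| := by
  rw [DnormJ]
  refine (sqrt_sum_sq_le _ _ fun _ _ => enorm_nonneg _).trans ?_
  exact Finset.sum_le_sum fun ρs _ => enorm_le_sum _

lemma DnormJ_nonneg {n j : ℕ} (R : Finset (Vec d)) (u : Vec d → Vec n) (ℓ : Vec d) :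
    0 ≤ DnormJ R j u ℓ := Real.sqrt_nonneg _

/-- decay classes give bounds on `DnormJ` -/
lemma DnormJ_of_ty {R : Finset (Vec d)} {σ : {x // x ∈ R} → ZZ d} (hσ : ∀ ρ, io e (σ ρ) = ρ)
    {u : Vec d → Vec d} {a J j : ℕ} (c : Fin d → ℝ) (hj : 1 ≤ j) (hjJ : j ≤ J)
    (h : ∀ k, Ty a 1 J (fun _ z => u (io e z) k - c k)) :
    ∃ C : ℝ, 0 ≤ C ∧ ∀ z, DnormJ R j u (io e z) ≤ C * (lg z ^ 1 / wt z ^ (a + j)) := by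
  have h1 : ∀ (ρs : Fin j → {x // x ∈ R}) (k : Fin d), ∃ C : ℝ, 0 ≤ C ∧ ∀ z,
      |Dmulti (fun i => (ρs i : Vec d)) u (io e z) k| ≤ C * (lg z ^ 1 / wt z ^ (a + j)) := by
    intro ρs k
    obtain ⟨C, hC, hb⟩ := h k (List.ofFn fun i => σ (ρs i)) (by simpa using hjJ)
    refine ⟨C, hC, fun z => ?_⟩
    rw [Dmulti_io (e := e) _ (fun i => σ (ρs i)) (fun i => hσ _)]
    have := hb 0 z
    rw [List.length_ofFn] at this
    beta_reduce at this
    rw [Dl_sub] at this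
    have h0 : Dl (List.ofFn fun i => σ (ρs i)) (fun _ => c k) z = 0 := by
      obtain ⟨j, rfl⟩ : ∃ i, j = i + 1 := ⟨j - 1, by omega⟩
      rw [List.ofFn_succ, Dl]
      have : Df (σ (ρs 0)) (fun _ : ZZ d => c k) = fun _ => 0 := by funext z; simp [Df]
      rw [this]
      have := congrFun (Dl_const_mul (List.ofFn fun i => σ (ρs (Fin.succ i))) 0 (fun _ => 0)) z
      simpa using this
    simpa [h0] using this
  choose C hC hb using h1
  refine ⟨∑ ρs, ∑ k, C ρs k, Finset.sum_nonneg fun _ _ => Finset.sum_nonneg fun _ _ => hC _ _,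
    fun z => (DnormJ_le R u _).trans ?_⟩
  simp only [Finset.sum_mul]
  exact Finset.sum_le_sum fun ρs _ => Finset.sum_le_sum fun k _ => hb ρs k z

lemma Green_ty {R : Finset (Vec d)} (he : Crd A s e τ) (hd : 2 ≤ d)
    {σ : {x // x ∈ R} → ZZ d} (hσ : ∀ ρ, io e (σ ρ) = ρ)
    (hcl : ∀ z, z ∈ AddSubgroup.closure (Set.range σ)) {G : Vec d → Fin d → Fin d → ℝ}
    (hG : ∀ j : ℕ, 1 ≤ j → ∃ cj : ℝ, ∀ z : Fin d → ℤ,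
      DnormJmat R j G (latticePt d A z) ≤
        cj * ang (latticePt d A z) ^ ((2 : ℝ) - d - j)) (v : ZZ d) (i q : Fin d) (M : ℕ) :
    Ty (d - 1) 0 M (fun _ => Df v (fun z => G (io e z) i q)) := by
  refine ty_of_gen hcl ?_ v M
  rintro _ ⟨ρ, rfl⟩ us hus
  obtain ⟨c, hc1, hc⟩ := cmp_ang e
  obtain ⟨ρl, hρl⟩ : ∃ ρl : List {x // x ∈ R}, ρl.map σ = us := by
    have h : us ∈ Set.range (List.map σ) := by
      rw [Set.range_list_map]; exact hus
    exact h
  set L := ρ :: ρl with hL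
  obtain ⟨cj, hcj⟩ := hG L.length (by simp [hL])
  have hlen : L.length = us.length + 1 := by rw [← hρl]; simp [hL]
  refine ⟨|cj| * c ^ (d - 1 + us.length), by positivity, fun _ z => ?_⟩
  have h1 : |Dmulti (fun i => ((L.get i : {x // x ∈ R}) : Vec d)) (col G q) (io e z) i| ≤
      DnormJmat R L.length G (io e z) := by
    refine (le_DnormJ R _ _ (fun i => L.get i) i).trans ?_
    rw [DnormJmat]
    refine Real.le_sqrt_of_sq_le ?_
    exact Finset.single_le_sum (f := fun k => DnormJ R L.length (col G k) (io e z) ^ 2)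
      (fun i _ => sq_nonneg _) (Finset.mem_univ q)
  rw [Dmulti_io (e := e) _ (fun i => σ (L.get i)) (fun i => hσ _)] at h1
  have h2 : (List.ofFn fun i => σ (L.get i)) = σ ρ :: us := by
    rw [← hρl, ← List.map_cons, ← hL]
    exact (List.ofFn_get (L.map σ) ▸ by simp [List.ofFn_eq_map] )
  rw [h2, Dl] at h1
  have h3 : ang (io e z) ^ ((2 : ℝ) - d - L.length) = 1 / ang (io e z) ^ (d - 1 + us.length) := by
    rw [one_div, ← Real.rpow_natCast, ← Real.rpow_neg (by linarith [two_le_ang (io e z)])]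
    congr 1
    rw [hlen]
    push_cast [Nat.cast_sub (show 1 ≤ d by omega)]
    ring
  have h4 := hcj (τ z)
  rw [← he.lat] at h4
  change DnormJmat R L.length G (io e z) ≤ cj * ang (io e z) ^ ((2 : ℝ) - d - L.length) at h4
  rw [h3] at h4
  refine h1.trans (h4.trans ?_)
  have hang := two_le_ang (io e z)
  have hwt := wt_pos z
  have h5 : wt z ≤ c * ang (io e z) := by
    have := (hc (cst z)).1
    have e1 : ‖cst z‖ = ‖z‖ := by
      refine le_antisymm ((pi_norm_le_iff_of_nonneg (norm_nonneg _)).2 fun i => ?_)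
        ((pi_norm_le_iff_of_nonneg (norm_nonneg _)).2 fun i => ?_)
      · exact norm_le_pi_norm z i
      · exact norm_le_pi_norm (cst z) i
    rwa [e1] at this
  calc cj * (1 / ang (io e z) ^ (d - 1 + us.length)) ≤
      |cj| * (1 / ang (io e z) ^ (d - 1 + us.length)) := by
        gcongr
        exact le_abs_self cj
    _ ≤ |cj| * (c ^ (d - 1 + us.length) / wt z ^ (d - 1 + us.length)) := by
        refine mul_le_mul_of_nonneg_left ?_ (abs_nonneg _)
        rw [div_le_div_iff₀ (by positivity) (by positivity), one_mul, ← mul_pow]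
        gcongr
    _ = _ := by rw [pow_zero]; ring

end

section
variable {d : ℕ} {A : Matrix (Fin d) (Fin d) ℝ} {s : Fin d → Vec d}
    {e : (Fin d → ℝ) ≃L[ℝ] Vec d} {τ : ZZ d ≃ ZZ d} {R : Finset (Vec d)}

abbrev sg (ρ : {x // x ∈ R}) (i : Fin d) : {x // x ∈ R} → Vec d := Pi.single ρ (Pi.single i 1)

lemma CofV_eq (V : ({x // x ∈ R} → Vec d) → ℝ) (ρ r : {x // x ∈ R}) (i j : Fin d) :
    CofV R V ρ r i j = fderiv ℝ (fderiv ℝ V) 0 (sg ρ i) (sg r j) := by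
  rw [CofV, dif_pos ρ.2, dif_pos r.2, iteratedFDeriv_two_apply]
  rfl

lemma CofV_symm (V : ({x // x ∈ R} → Vec d) → ℝ) (hV : ContDiff ℝ 2 V) (ρ r : {x // x ∈ R})
    (i j : Fin d) : CofV R V ρ r i j = CofV R V r ρ j i := by
  rw [CofV_eq, CofV_eq]
  exact (hV.contDiffAt.isSymmSndFDerivAt (by simp [minSmoothness_of_isRCLikeNormedField])) _ _

lemma Hop_io {σ : {x // x ∈ R} → ZZ d} (hσ : ∀ ρ, io e (σ ρ) = ρ)
    (C : Vec d → Vec d → Fin d → Fin d → ℝ) (u : Vec d → Vec d) (z : ZZ d) (i : Fin d) :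
    Hop d d R C u (io e z) i =
      Hz σ (fun s r i j => C s r i j) (fun j z => u (io e z) j) i z := by
  rw [Hop, Finset.sum_apply, ← Finset.sum_coe_sort]
  refine Finset.sum_congr rfl fun ρ _ => ?_
  rw [Finset.sum_apply, ← Finset.sum_coe_sort]
  refine Finset.sum_congr rfl fun r _ => ?_
  have h1 : io e z - (ρ : Vec d) = io e (z + -σ ρ) := by
    rw [io_add, io_neg, hσ]; abel
  rw [Pi.sub_apply, mulV, mulV, h1, ← Finset.sum_sub_distrib]
  refine Finset.sum_congr rfl fun j _ => ?_
  rw [D1_io (e := e) _ (σ r) (hσ r), D1_io (e := e) _ (σ r) (hσ r)]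
  conv_rhs => rw [Df]
  ring

lemma green_build (he : Crd A s e τ) (hd : 2 ≤ d)
    {σ : {x // x ∈ R} → ZZ d} (hσ : ∀ ρ, io e (σ ρ) = ρ)
    (hcl : ∀ z, z ∈ AddSubgroup.closure (Set.range σ)) {G : Vec d → Fin d → Fin d → ℝ}
    {V : ({x // x ∈ R} → Vec d) → ℝ} (hV : ContDiff ℝ 2 V)
    (hG : IsLatticeGreen d d A R (CofV R V) G) :
    Green σ (fun s r i j => CofV R V s r i j) (fun i q z => G (io e z) i q) where
  symm := fun s r i j => CofV_symm V hV s r i j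
  ty := fun v i q M => Green_ty he hd hσ hcl hG.2 v i q M
  eq := fun k i z => by
    have h1 := congrFun (hG.1 k (τ z)) i
    rw [← he.lat] at h1
    change Hop d d R (CofV R V) (col G k) (io e z) i = _ at h1
    rw [Hop_io hσ] at h1
    refine h1.trans ?_
    have h2 : e (cst z) = 0 ↔ z = 0 :=
      ⟨fun h => io_inj (e := e) (by rw [io_zero]; exact h), fun h => by rw [h]; exact io_zero⟩
    by_cases hz : z = 0
    · rw [if_pos (h2.2 hz)]
      by_cases hi : i = k
      · simp [hz, hi]
      · simp [hi]
    · rw [if_neg (fun h => hz (h2.1 h)), if_neg (fun h => hz h.1)]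
      rfl

/-- currying as a continuous linear map -/
def cur (α β : Type) [Fintype α] [Fintype β] : (α × β → ℝ) →L[ℝ] (α → β → ℝ) :=
  ContinuousLinearMap.pi fun a => ContinuousLinearMap.pi fun b =>
    ContinuousLinearMap.proj (R := ℝ) (φ := fun _ : α × β => ℝ) (a, b)

lemma cur_single (r : {x // x ∈ R}) (j : Fin d) :
    cur {x // x ∈ R} (Fin d) (Pi.single (r, j) 1) = sg r j := by
  funext a b
  show Pi.single (M := fun _ => ℝ) (r, j) 1 (a, b) = _
  by_cases ha : a = r
  · subst ha
    by_cases hb : b = j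
    · subst hb; simp [sg]
    · simp [sg, Pi.single_apply, hb]
  · simp [sg, Pi.single_apply, ha]

lemma nl_expand {V : ({x // x ∈ R} → Vec d) → ℝ} {n : ℕ} (hV : ContDiff ℝ (n + 3 : ℕ) V) :
    ∃ f : {x // x ∈ R} → Fin d → {x // x ∈ R} × Fin d → {x // x ∈ R} × Fin d →
        ({x // x ∈ R} × Fin d → ℝ) → ℝ,
      (∀ s q a b, ContDiff ℝ n (f s q a b)) ∧ ∀ (ρ : {x // x ∈ R}) (i : Fin d)
        (y : {x // x ∈ R} × Fin d → ℝ),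
        gradV R V ρ (cur _ _ y) i = gradV R V ρ 0 i + ∑ r : {x // x ∈ R}, ∑ j, CofV R V ρ r i j * y (r, j) +
          ∑ a, ∑ b, y a * y b * f ρ i a b y := by
  set P : {x // x ∈ R} → Fin d → ({x // x ∈ R} × Fin d → ℝ) → ℝ := fun ρ i y =>
    gradV R V ρ (cur _ _ y) i with hP
  have hVd : ContDiff ℝ (n + 1 + 1 : ℕ) (fderiv ℝ V) :=
    hV.fderiv_right (by norm_cast)
  have hPc : ∀ ρ i, ContDiff ℝ (n + 1 + 1 : ℕ) (P ρ i) := fun ρ i =>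
    (hVd.comp (cur _ _).contDiff).clm_apply contDiff_const
  choose F hF1 hF2 hF3 using fun ρ i => hadamard_zero (n + 1) (P ρ i) (hPc ρ i)
  choose f hf1 hf2 hf3 using fun ρ i b => hadamard_zero n (F ρ i b) (hF1 ρ i b)
  refine ⟨fun ρ i a b => f ρ i a b, fun ρ i a b => hf1 ρ i a b, fun ρ i y => ?_⟩
  have hC : ∀ ρ i r j, F ρ i (r, j) 0 = CofV R V ρ r i j := fun ρ i r j => by
    rw [hF3, CofV_symm V (hV.of_le (by norm_cast; omega)), CofV_eq]
    have hdV : DifferentiableAt ℝ (fderiv ℝ V) (cur _ _ 0) :=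
      hVd.differentiable (by norm_cast) _
    have h1 : HasFDerivAt (fun y => fderiv ℝ V (cur _ _ y)) ((fderiv ℝ (fderiv ℝ V)
        (cur _ _ 0)).comp (cur _ _)) (0 : {x // x ∈ R} × Fin d → ℝ) :=
      hdV.hasFDerivAt.comp 0 (cur _ _).hasFDerivAt
    have h2 := h1.clm_apply (hasFDerivAt_const (sg ρ i) _)
    have h3 : fderiv ℝ (P ρ i) 0 = _ := h2.fderiv
    rw [h3]
    simp [cur_single]
  have h0 : P ρ i 0 = gradV R V ρ 0 i := by simp [hP]
  change P ρ i y = _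
  rw [hF2, h0]
  have : ∀ a, y a * F ρ i a y = CofV R V ρ a.1 i a.2 * y a + ∑ b, y a * y b * f ρ i a b y := by
    intro a
    rw [hf2, hC ρ i a.1 a.2, mul_add, Finset.mul_sum]
    congr 1
    · ring
    · exact Finset.sum_congr rfl fun b _ => by ring
  simp only [this]
  rw [Finset.sum_add_distrib, Fintype.sum_prod_type]
  ring

end

section
variable {d : ℕ} {A : Matrix (Fin d) (Fin d) ℝ} {s : Fin d → Vec d}
    {e : (Fin d → ℝ) ≃L[ℝ] Vec d} {τ : ZZ d ≃ ZZ d} {R : Finset (Vec d)}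

lemma norm_cst (z : ZZ d) : ‖cst z‖ = ‖z‖ := by
  refine le_antisymm ((pi_norm_le_iff_of_nonneg (norm_nonneg _)).2 fun i => ?_)
    ((pi_norm_le_iff_of_nonneg (norm_nonneg _)).2 fun i => ?_)
  · exact norm_le_pi_norm z i
  · exact norm_le_pi_norm (cst z) i

lemma finite_enorm_lt (e : (Fin d → ℝ) ≃L[ℝ] Vec d) (rad : ℝ) :
    {z : ZZ d | enorm (io e z) < rad}.Finite := by
  obtain ⟨c, hc1, hc⟩ := cmp_ang e
  refine (isCompact_closedBall (0 : ZZ d) (c * (rad + 2))).finite_of_discrete.subset fun z hz => ?_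
  have hz' : enorm (io e z) < rad := hz
  have := (hc (cst z)).1
  rw [norm_cst] at this
  rw [mem_closedBall_zero_iff]
  have h2 : ang (e (cst z)) ≤ rad + 2 := by
    have : enorm (e (cst z)) < rad := hz'
    unfold ang; linarith
  nlinarith [mul_le_mul_of_nonneg_left h2 (by linarith : (0 : ℝ) ≤ c)]

def dlt (x0 : Vec d) (i : Fin d) : Vec d → Vec d := fun ℓ =>
  haveI := Classical.dec (ℓ = x0)
  if ℓ = x0 then Pi.single i 1 else 0

lemma dlt_hc (A : Matrix (Fin d) (Fin d) ℝ) (x0 : Vec d) (i : Fin d) : InHc A R (dlt x0 i) := by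
  refine ⟨enorm x0 + 1 + ∑ ρ ∈ R, enorm (x0 - ρ), fun z hz ρ hρ => ?_⟩
  have h1 : enorm (x0 - ρ) ≤ ∑ ρ ∈ R, enorm (x0 - ρ) :=
    Finset.single_le_sum (f := fun ρ => enorm (x0 - ρ)) (fun _ _ => enorm_nonneg _) hρ
  have h2 := enorm_nonneg x0
  have h3 := enorm_nonneg (x0 - ρ)
  have n1 : latticePt d A z ≠ x0 := fun h => by rw [h] at hz; linarith
  have n2 : latticePt d A z + ρ ≠ x0 := fun h => by
    have h4 : x0 - ρ = latticePt d A z := by rw [← h, add_sub_cancel_right]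
    rw [h4] at h1
    linarith
  simp [D1, dlt, n1, n2]

lemma tsum_dlt {σ : {x // x ∈ R} → ZZ d} (hσ : ∀ ρ, io e (σ ρ) = ρ)
    (q : ZZ d → {x // x ∈ R} → Vec d) (z0 : ZZ d) (i : Fin d) :
    ∑' z, ∑ ρ ∈ R.attach, dotV (q z ρ) (D1 (ρ : Vec d) (dlt (io e z0) i) (io e z)) =
      ∑ ρ, Df (-σ ρ) (fun z => q z ρ i) z0 := by
  classical
  refine HasSum.tsum_eq ?_
  rw [show (Finset.univ : Finset {x // x ∈ R}) = R.attach from rfl]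
  refine hasSum_sum fun ρ _ => ?_
  have e1 : ∀ z, dotV (q z ρ) (D1 (ρ : Vec d) (dlt (io e z0) i) (io e z)) =
      (if z = z0 + -σ ρ then q z ρ i else 0) - (if z = z0 then q z ρ i else 0) := fun z => by
    have hdl : ∀ w : ZZ d, ∑ k, q z ρ k * dlt (io e z0) i (io e w) k =
        if w = z0 then q z ρ i else 0 := fun w => by
      by_cases h : w = z0
      · subst h
        simp [dlt, Pi.single_apply]
      · have : io e w ≠ io e z0 := fun h' => h (io_inj h')
        simp [dlt, this, h]
    rw [dotV]
    simp only [D1, Pi.sub_apply, mul_sub, Finset.sum_sub_distrib]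
    rw [hdl z, ← hσ ρ, ← io_add, hdl]
    congr 1
    have : z + σ ρ = z0 ↔ z = z0 + -σ ρ := by
      constructor
      · intro h; rw [← h]; abel
      · intro h; rw [h]; abel
    simp only [this]
  simp only [e1]
  have h1 : HasSum (fun z => if z = z0 + -σ ρ then q z ρ i else 0) (q (z0 + -σ ρ) ρ i) := by
    have := hasSum_single (f := fun z => if z = z0 + -σ ρ then q z ρ i else 0) (z0 + -σ ρ)
      (fun z hz => if_neg hz)
    simpa using this
  have h2 : HasSum (fun z => if z = z0 then q z ρ i else 0) (q z0 ρ i) := by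
    have := hasSum_single (f := fun z => if z = z0 then q z ρ i else 0) z0
      (fun z hz => if_neg hz)
    simpa using this
  exact h1.sub h2

lemma Crd.tsum_lat (he : Crd A s e τ) (F : Vec d → ℝ) :
    ∑' z : Fin d → ℤ, F (latticePt d A z) = ∑' z, F (io e z) := by
  rw [← τ.tsum_eq]
  exact tsum_congr fun z => by rw [← he.lat]; rfl

lemma l2_build (he : Crd A s e τ) {σ : {x // x ∈ R} → ZZ d} (hσ : ∀ ρ, io e (σ ρ) = ρ)
    {ubar : Vec d → Vec d} (hubar : InH1 A R ubar) (ρ : {x // x ∈ R}) (q : Fin d) :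
    Summable fun z => (Df (σ ρ) (fun z => ubar (io e z) q) z) ^ 2 := by
  have h1 : Summable fun z => Dnorm1Sq R ubar (io e z) := by
    have := τ.summable_iff.2 hubar
    refine this.congr fun z => ?_
    simp only [Function.comp_apply]
    rw [← he.lat]; rfl
  refine Summable.of_nonneg_of_le (fun z => sq_nonneg _) (fun z => ?_) h1
  rw [← D1_io (e := e) _ (σ ρ) (hσ ρ), ← sq_abs]
  calc |D1 (ρ : Vec d) ubar (io e z) q| ^ 2 ≤ enorm (D1 (ρ : Vec d) ubar (io e z)) ^ 2 :=
        pow_le_pow_left₀ (abs_nonneg _) (abs_le_enorm _ q) 2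
    _ ≤ _ := Finset.single_le_sum (f := fun ρ : Vec d => enorm (D1 ρ ubar (io e z)) ^ 2)
        (fun _ _ => sq_nonneg _) ρ.2

lemma tend_build (he : Crd A s e τ) {σ : {x // x ∈ R} → ZZ d} (hσ : ∀ ρ, io e (σ ρ) = ρ)
    (hcl : ∀ z, z ∈ AddSubgroup.closure (Set.range σ))
    {ubar : Vec d → Vec d} (hubar : InH1 A R ubar) (q : Fin d) (v : ZZ d) :
    Tendsto (Df v (fun z => ubar (io e z) q)) cofinite (𝓝 0) := by
  refine tendsto_of_gen hcl ?_ v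
  rintro _ ⟨ρ, rfl⟩
  have h1 := (l2_build he hσ hubar ρ q).tendsto_cofinite_zero
  have h2 := (Real.continuous_sqrt.tendsto 0).comp h1
  rw [Real.sqrt_zero] at h2
  rw [tendsto_zero_iff_abs_tendsto_zero]
  refine h2.congr fun z => ?_
  simp [Real.sqrt_sq_eq_abs]

lemma prob_build (he : Crd A s e τ) (hd : 2 ≤ d)
    {σ : {x // x ∈ R} → ZZ d} (hσ : ∀ ρ, io e (σ ρ) = ρ)
    (hcl : ∀ z, z ∈ AddSubgroup.closure (Set.range σ)) {G : Vec d → Fin d → Fin d → ℝ}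
    {V : ({x // x ∈ R} → Vec d) → ℝ} {n : ℕ} (hV : ContDiff ℝ (n + 3 : ℕ) V)
    (hG : IsLatticeGreen d d A R (CofV R V) G)
    (g : Vec d → {x // x ∈ R} → Vec d)
    (hgsupp : ∃ rad : ℝ, ∀ z : Fin d → ℤ, rad ≤ enorm (latticePt d A z) →
      ∀ ρ : {x // x ∈ R}, g (latticePt d A z) ρ = 0)
    (ubar : Vec d → Vec d) (hubar : InH1 A R ubar)
    (hequil : ∀ v : Vec d → Vec d, InHc A R v →
      (∑' z : Fin d → ℤ, deltaEsite R V ubar v (latticePt d A z)) =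
        ∑' z : Fin d → ℤ, ∑ ρ ∈ R.attach,
          dotV (g (latticePt d A z) ρ) (D1 (ρ : Vec d) v (latticePt d A z))) :
    ∃ f, Prob σ (fun s r i j => CofV R V s r i j) (fun i q z => G (io e z) i q)
      (fun i z => ubar (io e z) i) (fun ρ i z => g (io e z) ρ i) n f := by
  obtain ⟨f, hf1, hf2⟩ := nl_expand hV
  refine ⟨f, green_build he hd hσ hcl (hV.of_le (by norm_cast; omega)) hG,
    fun i v => tend_build he hσ hcl hubar i v, fun ρ q => l2_build he hσ hubar ρ q, ?_, hf1, ?_⟩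
  · intro ρ q
    obtain ⟨rad, hrad⟩ := hgsupp
    refine (finite_enorm_lt e rad).subset fun z hz => ?_
    by_contra hcon
    have h1 : rad ≤ enorm (io e z) := not_lt.1 hcon
    refine hz ?_
    have := hrad (τ z) (by rw [← he.lat]; exact h1) ρ
    rw [← he.lat] at this
    exact congrFun this q
  · intro i z
    have h1 := hequil (dlt (io e z) i) (dlt_hc A _ i)
    rw [he.tsum_lat (fun x => deltaEsite R V ubar (dlt (io e z) i) x),
      he.tsum_lat (fun x => ∑ ρ ∈ R.attach,
          dotV (g x ρ) (D1 (ρ : Vec d) (dlt (io e z) i) x)),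
      tsum_dlt hσ (fun z ρ => g (io e z) ρ) z i] at h1
    simp only [deltaEsite] at h1
    rw [tsum_dlt hσ (fun z ρ => gradV R V ρ (Dstencil R ubar (io e z))) z i] at h1
    have h2 : ∀ w, Dstencil R ubar (io e w) =
        cur _ _ (fun a => Df (σ a.1) (fun z => ubar (io e z) a.2) w) := fun w => by
      funext ρ k
      show D1 (ρ : Vec d) ubar (io e w) k = _
      rw [D1_io (e := e) _ (σ ρ) (hσ ρ)]
      rfl
    simp only [h2, hf2] at h1
    have h3 : Hz σ (fun s r i j => CofV R V s r i j) (fun i z => ubar (io e z) i) i z =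
        ∑ ρ : {x // x ∈ R}, Df (-σ ρ) (fun w => ∑ r : {x // x ∈ R}, ∑ j, CofV R V ρ r i j *
          Df (σ r) (fun z => ubar (io e z) j) w) z := by
      refine Finset.sum_congr rfl fun ρ _ => ?_
      conv_rhs => rw [Df]
      rw [← Finset.sum_sub_distrib]
      refine Finset.sum_congr rfl fun r _ => ?_
      rw [← Finset.sum_sub_distrib]
      refine Finset.sum_congr rfl fun j _ => ?_
      conv_lhs => rw [Df]
      ring
    rw [h3]
    rw [← sub_eq_zero, ← Finset.sum_sub_distrib] at h1
    rw [← sub_eq_zero, ← Finset.sum_sub_distrib, ← h1]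
    refine Finset.sum_congr rfl fun ρ _ => ?_
    simp only [Df]
    ring

end

section
variable {d : ℕ} {A : Matrix (Fin d) (Fin d) ℝ} {s : Fin d → Vec d}
    {e : (Fin d → ℝ) ≃L[ℝ] Vec d} {τ : ZZ d ≃ ZZ d} {R : Finset (Vec d)}

def symb {i : ℕ} (b : (Fin i → Fin d) → ℝ) (σv : Fin i → Fin d) : ℝ :=
  ((i.factorial : ℝ))⁻¹ * ∑ π : Equiv.Perm (Fin i), b (σv ∘ π)

lemma symb_sym {i : ℕ} (b : (Fin i → Fin d) → ℝ) : SymArr (symb b) := by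
  intro π σv
  unfold symb
  congr 1
  exact Fintype.sum_equiv (Equiv.mulLeft π) _ _ fun π' => rfl

lemma multipole_symb (he : Crd A s e τ) {i : ℕ} (b : (Fin i → Fin d) → ℝ) (f : Vec d → Vec d)
    (z : ZZ d) (j : Fin d) : multipole d d s i (symb b) f (io e z) j =
      ∑ σv : Fin i → Fin d, b σv * Db (List.ofFn σv) (fun z => f (io e z) j) z := by
  set T : (Fin i → Fin d) → ℝ := fun σv => Db (List.ofFn σv) (fun z => f (io e z) j) z with hT
  have h1 : ∀ σv, Dmulti (fun m => s (σv m)) f (io e z) j = T σv := fun σv => by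
    rw [Dmulti_io (e := e) _ (fun m => eb (σv m)) (fun m => he.io_eb _), hT]
    simp only [Db, List.map_ofFn]
    rfl
  have h2 : ∀ (π : Equiv.Perm (Fin i)) σv, T (σv ∘ π) = T σv := fun π σv => by
    simp only [hT, Db]
    rw [Dl_perm ((Equiv.Perm.ofFn_comp_perm π σv).map eb)]
  rw [multipole, Finset.sum_apply]
  simp only [Pi.smul_apply, smul_eq_mul, h1, symb, mul_assoc, Finset.sum_mul]
  rw [← Finset.mul_sum, Finset.sum_comm]
  have h3 : ∀ π : Equiv.Perm (Fin i), ∑ σv, b (σv ∘ π) * T σv = ∑ σv, b σv * T σv := fun π => by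
    refine Fintype.sum_equiv (Equiv.arrowCongr π.symm (Equiv.refl _)) _ _ fun σv => ?_
    have : (Equiv.arrowCongr π.symm (Equiv.refl (Fin d))) σv = σv ∘ π := by
      funext m; simp [Equiv.arrowCongr]
    rw [this, h2]
  simp only [h3, Finset.sum_const, Finset.card_univ, Fintype.card_perm, Fintype.card_fin,
    nsmul_eq_mul]
  rw [← mul_assoc, inv_mul_cancel₀ (by positivity), one_mul]

open Classical in
def b0 {κ : Type} [Fintype κ] (c : κ → ℝ) (vs : κ → List (Fin d)) (kk : κ → Fin d)
    (i : ℕ) (k : Fin d) (σv : Fin i → Fin d) : ℝ :=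
  ∑ a, if kk a = k ∧ vs a = List.ofFn σv then c a else 0

lemma sum_b0 {κ : Type} [Fintype κ] (c : κ → ℝ) (vs : κ → List (Fin d)) (kk : κ → Fin d)
    (hvs : ∀ a, 1 ≤ (vs a).length) (p : ℕ) (T : List (Fin d) → Fin d → ℝ) :
    ∑ i ∈ Finset.Icc 1 p, ∑ k, ∑ σv : Fin i → Fin d, b0 c vs kk i k σv * T (List.ofFn σv) k =
      ∑ a, if (vs a).length ≤ p then c a * T (vs a) (kk a) else 0 := by
  classical
  simp only [b0, Finset.sum_mul]
  have h1 : ∀ i, ∑ k, ∑ σv : Fin i → Fin d, ∑ a,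
      (if kk a = k ∧ vs a = List.ofFn σv then c a else 0) * T (List.ofFn σv) k =
      ∑ a, if (vs a).length = i then c a * T (vs a) (kk a) else 0 := fun i => by
    have h2 : ∀ k : Fin d, ∑ σv : Fin i → Fin d, ∑ a,
      (if kk a = k ∧ vs a = List.ofFn σv then c a else 0) * T (List.ofFn σv) k =
      ∑ a, ∑ σv : Fin i → Fin d,
      (if kk a = k ∧ vs a = List.ofFn σv then c a else 0) * T (List.ofFn σv) k :=
        fun k => Finset.sum_comm
    simp only [h2]
    rw [Finset.sum_comm]
    refine Finset.sum_congr rfl fun a _ => ?_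
    rw [Finset.sum_eq_single (kk a)]
    · by_cases hi : (vs a).length = i
      · subst hi
        rw [if_pos rfl, Finset.sum_eq_single (vs a).get]
        · simp [List.ofFn_get]
        · intro σv _ hσ
          rw [if_neg, zero_mul]
          rintro ⟨-, h⟩
          apply hσ
          exact List.ofFn_injective (h.symm.trans (List.ofFn_get _).symm)
        · simp
      · rw [if_neg hi]
        refine Finset.sum_eq_zero fun σv _ => ?_
        rw [if_neg, zero_mul]
        rintro ⟨-, h⟩
        exact hi (by rw [h, List.length_ofFn])
    · intro k _ hk
      refine Finset.sum_eq_zero fun σv _ => ?_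
      rw [if_neg, zero_mul]
      rintro ⟨h, -⟩
      exact hk h.symm
    · simp
  simp only [h1]
  rw [Finset.sum_comm]
  refine Finset.sum_congr rfl fun a _ => ?_
  rw [Finset.sum_ite_eq]
  simp [hvs a]

lemma ang_pow (x : Vec d) (q : ℝ) (M : ℕ) (h : q = -(M : ℝ)) : ang x ^ q = 1 / ang x ^ M := by
  rw [h, Real.rpow_neg (by linarith [two_le_ang x]), Real.rpow_natCast, one_div]

lemma exists_uC (e : (Fin d → ℝ) ≃L[ℝ] Vec d) (hd : 2 ≤ d) {w : Fin d → ZZ d → ℝ}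
    (hw : ∀ k M, Ty (2 * d - 1) 1 M (fun _ => w k)) : ∃ U : Vec d → Vec d,
      ContDiff ℝ (⊤ : ℕ∞) U ∧ (∀ z k, U (io e z) k = w k z) ∧ ∀ j : ℕ, ∃ C : ℝ, ∀ x,
        ‖iteratedFDeriv ℝ j U x‖ ≤
          C * ang x ^ ((2 : ℝ) - d - (d + 1 : ℕ) - j) * Real.log (ang x) ^ (d + 1) := by
  choose U hU1 hU2 hU3 using fun k => exists_interp (by omega) (by omega) (hw k)
  set es : Vec d →L[ℝ] (Fin d → ℝ) := (e.symm : Vec d →L[ℝ] (Fin d → ℝ)) with hes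
  set S : Fin d → (ℝ →L[ℝ] Vec d) := fun k =>
    ContinuousLinearMap.toSpanSingleton ℝ (Pi.single k (1 : ℝ)) with hS
  have hc : ∀ k, ContDiff ℝ (⊤ : ℕ∞) (U k ∘ es) := fun k => (hU1 k).comp es.contDiff
  have hcS : ∀ k, ContDiff ℝ (⊤ : ℕ∞) (fun x => (S k ∘ (U k ∘ es)) x) := fun k =>
    (S k).contDiff.comp (hc k)
  refine ⟨fun x => ∑ k, (S k ∘ (U k ∘ es)) x, ContDiff.sum fun k _ => hcS k, fun z k => ?_,
    fun j => ?_⟩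
  · have h1 : es (io e z) = cst z := e.symm_apply_apply _
    simp only [Function.comp_apply, h1, hU2, hS, ContinuousLinearMap.toSpanSingleton_apply,
      Finset.sum_apply, Pi.smul_apply, smul_eq_mul]
    simp [Pi.single_apply]
  · obtain ⟨c, hc1, hcc⟩ := cmp_ang e
    obtain ⟨C', hC', hcmp⟩ := cmp_log (2 * c) (by linarith) (2 * d - 1 + j) d
    choose C hC h using fun k => hU3 k j
    refine ⟨∑ k, ‖S k‖ * (C k * ‖es‖ ^ j * C'), fun x => ?_⟩
    have hjt : ((j : ℕ) : WithTop ℕ∞) ≤ ((⊤ : ℕ∞) : WithTop ℕ∞) := by exact_mod_cast le_top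
    rw [iteratedFDeriv_sum fun k _ => (hcS k).of_le hjt, Finset.sum_apply]
    refine (norm_sum_le _ _).trans ?_
    rw [mul_assoc, Finset.sum_mul]
    refine Finset.sum_le_sum fun k _ => ?_
    have h1 := ContinuousLinearMap.norm_iteratedFDeriv_comp_left (S k)
      ((hc k).contDiffAt (x := x)) hjt
    refine h1.trans ?_
    rw [mul_assoc]
    refine mul_le_mul_of_nonneg_left ?_ (ContinuousLinearMap.opNorm_nonneg _)
    rw [ContinuousLinearMap.iteratedFDeriv_comp_right es (hU1 k) x hjt]
    refine (ContinuousMultilinearMap.norm_compContinuousLinearMap_le _ _).trans ?_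
    rw [Finset.prod_const, Finset.card_univ, Fintype.card_fin]
    set y := es x with hy
    have hey : e y = x := e.apply_symm_apply x
    have hcy := hcc y
    rw [hey] at hcy
    have hf1 : wt (fl y) ≤ 2 * (‖y‖ + 2) := by
      have : ‖fl y‖ ≤ ‖y‖ + 1 := by
        refine (pi_norm_le_iff_of_nonneg (by positivity)).2 fun i => ?_
        have h1 := norm_le_pi_norm y i
        rw [Real.norm_eq_abs] at h1
        rw [Int.norm_eq_abs, fl, abs_le]
        have h2 := Int.floor_le (y i)
        have h3 := Int.lt_floor_add_one (y i)
        have h4 := abs_le.1 h1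
        constructor <;> linarith
      unfold wt; linarith [norm_nonneg y]
    have hf2 : ‖y‖ + 2 ≤ 2 * wt (fl y) := by
      have : ‖y‖ ≤ ‖fl y‖ + 1 := by
        refine (pi_norm_le_iff_of_nonneg (by positivity)).2 fun i => ?_
        have h1 := norm_le_pi_norm (fl y) i
        rw [Int.norm_eq_abs, fl] at h1
        rw [Real.norm_eq_abs, abs_le]
        have h2 := Int.floor_le (y i)
        have h3 := Int.lt_floor_add_one (y i)
        have h4 := abs_le.1 h1
        constructor <;> linarith
      unfold wt; linarith [norm_nonneg (fl y)]
    have hk := hcmp (wt (fl y)) (ang x) (two_le_wt _) (two_le_ang x) (by linarith)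
      (by nlinarith)
    have hexp : ang x ^ ((2 : ℝ) - d - (d + 1 : ℕ) - j) = 1 / ang x ^ (2 * d - 1 + j) := by
      refine ang_pow x _ _ ?_
      push_cast [Nat.cast_sub (show 1 ≤ 2 * d by omega)]
      ring
    rw [hexp]
    calc ‖iteratedFDeriv ℝ j (U k) y‖ * ‖es‖ ^ j ≤
        (C k * (lg (fl y) ^ 1 / wt (fl y) ^ (2 * d - 1 + j))) * ‖es‖ ^ j := by
          gcongr
          exact h k y
      _ ≤ (C k * (C' * (Real.log (ang x) ^ (d + 1) / ang x ^ (2 * d - 1 + j)))) * ‖es‖ ^ j := by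
          refine mul_le_mul_of_nonneg_right (mul_le_mul_of_nonneg_left hk (hC k)) (by positivity)
      _ = _ := by ring

lemma Crd.final_bound (he : Crd A s e τ) (hd : 2 ≤ d) {σ : {x // x ∈ R} → ZZ d}
    (hσ : ∀ ρ, io e (σ ρ) = ρ) {u : Vec d → Vec d} {p J j : ℕ} (c : Fin d → ℝ)
    (hj : 1 ≤ j) (hjJ : j ≤ J) (h : ∀ k, Ty (d - 1 + p) 1 J (fun _ z => u (io e z) k - c k)) :
    ∃ Cj : ℝ, ∀ z : Fin d → ℤ, DnormJ R j u (latticePt d A z) ≤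
      Cj * ang (latticePt d A z) ^ ((1 : ℝ) - d - j - p) *
            Real.log (ang (latticePt d A z)) ^ (p + 1) := by
  obtain ⟨C, hC, hb⟩ := DnormJ_of_ty hσ c hj hjJ h
  obtain ⟨k, hk1, hk⟩ := cmp_ang e
  obtain ⟨C', hC', hcmp⟩ := cmp_log k hk1 (d - 1 + p + j) p
  refine ⟨C * C', fun z => ?_⟩
  have hz : latticePt d A z = io e (τ.symm z) := by
    rw [io, he.lat, Equiv.apply_symm_apply]
  rw [hz]
  set y := τ.symm z
  have hky := hk (cst y)
  rw [norm_cst] at hky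
  rw [ang_pow (io e y) _ (d - 1 + p + j) (by
    push_cast [Nat.cast_sub (show 1 ≤ d by omega)]
    ring)]
  have := hcmp (wt y) (ang (io e y)) (two_le_wt _) (two_le_ang _) hky.1 hky.2
  refine (hb y).trans ((mul_le_mul_of_nonneg_left this hC).trans (le_of_eq (by ring)))

end

section
variable {d : ℕ} {A : Matrix (Fin d) (Fin d) ℝ} {s : Fin d → Vec d}
    {e : (Fin d → ℝ) ≃L[ℝ] Vec d} {τ : ZZ d ≃ ZZ d} {R : Finset (Vec d)}

open Classical in
/-- the only nonzero continuum corrector: index `d + 1`, cut off inside the unit ball -/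
def uCf (U : Vec d → Vec d) (i : ℕ) (x : Vec d) : Vec d :=
  if i = d + 1 ∧ 1 ≤ enorm x then U x else 0

lemma uCf_eqOn (U : Vec d → Vec d) :
    Set.EqOn (uCf U (d + 1)) U {x : Vec d | 1 ≤ enorm x} := fun x hx => by
  have hx' : 1 ≤ enorm x := hx
  simp [uCf, hx']

lemma uCf_ne (U : Vec d → Vec d) {i : ℕ} (hi : i ≠ d + 1) : uCf U i = fun _ => 0 := by
  funext x; simp [uCf, hi]

lemma uCf_contDiff {U : Vec d → Vec d} (hU : ContDiff ℝ (⊤ : ℕ∞) U) (i : ℕ) :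
    ContDiffOn ℝ (⊤ : ℕ∞) (uCf U i) {x : Vec d | 1 ≤ enorm x} := by
  by_cases hi : i = d + 1
  · subst hi
    exact hU.contDiffOn.congr (uCf_eqOn U)
  · rw [uCf_ne U hi]; exact contDiffOn_const

lemma uCf_bound {U : Vec d → Vec d} (hU : ContDiff ℝ (⊤ : ℕ∞) U)
    (hB : ∀ j : ℕ, ∃ C : ℝ, ∀ x, ‖iteratedFDeriv ℝ j U x‖ ≤
          C * ang x ^ ((2 : ℝ) - d - (d + 1 : ℕ) - j) * Real.log (ang x) ^ (d + 1)) (i j : ℕ) :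
    ∃ Cij : ℝ, ∀ x : Vec d, 1 ≤ enorm x →
        ‖iteratedFDerivWithin ℝ j (uCf U i) {y : Vec d | 1 ≤ enorm y} x‖ ≤
          Cij * ang x ^ ((2 : ℝ) - d - i - j) * Real.log (ang x) ^ i := by
  by_cases hi : i = d + 1
  · subst hi
    obtain ⟨C, hC⟩ := hB j
    refine ⟨C, fun x hx => ?_⟩
    rw [iteratedFDerivWithin_congr (uCf_eqOn U) hx,
      iteratedFDerivWithin_eq_iteratedFDeriv (uniqueDiff_ext 1 one_pos)
        (hU.contDiffAt.of_le (by exact_mod_cast le_top)) hx]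
    exact hC x
  · refine ⟨0, fun x hx => ?_⟩
    rw [uCf_ne U hi]
    have : iteratedFDerivWithin ℝ j (fun _ : Vec d => (0 : Vec d)) {y : Vec d | 1 ≤ enorm y} = 0 :=
      iteratedFDerivWithin_zero_fun
    rw [this]
    simp

lemma remainder_ty (he : Crd A s e τ) (hd : 2 ≤ d) {I : Type} [Fintype I] {σ : I → ZZ d}
    {C : I → I → Fin d → Fin d → ℝ} {G : Vec d → Fin d → Fin d → ℝ}
    (hG : Green σ C (fun i q z => G (io e z) i q)) (ubar : Vec d → Vec d)
    {p J : ℕ} {c : Fin d → ℝ} {h : Fin d → ZZ d → ℝ}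
    (hr : ∀ i, Ty (d - 1 + p) 1 J (fun _ z => ubar (io e z) i - c i - h i z))
    {κ : Type} [Fintype κ] {cc : κ → ℝ} {vs : κ → List (Fin d)} {kk : κ → Fin d}
    (hvs : ∀ a, 1 ≤ (vs a).length)
    (hw : ∀ i M, Ty (2 * d - 1) 1 M
      (fun _ z => h i z - ∑ a, cc a * Db (vs a) (fun z => G (io e z) i (kk a)) z))
    {U : Vec d → Vec d}
    (hU : ∀ z k, U (io e z) k =
      h k z - ∑ a, cc a * Db (vs a) (fun z => G (io e z) k (kk a)) z) (j : Fin d) :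
    Ty (d - 1 + p) 1 J (fun _ z => (fun ℓ => ubar ℓ - ∑ i ∈ Finset.Icc (d + 1) p, uCf U i ℓ -
            ∑ i ∈ Finset.Icc 1 p, ∑ k : Fin d,
              multipole d d s i (symb (b0 cc vs kk i k)) (col G k) ℓ) (io e z) j - c j) := by
  have hm : ∀ z, (∑ i ∈ Finset.Icc 1 p, ∑ k : Fin d,
      multipole d d s i (symb (b0 cc vs kk i k)) (col G k) (io e z)) j =
      ∑ a, if (vs a).length ≤ p then cc a * Db (vs a) (fun z => G (io e z) j (kk a)) z else 0 := by
    intro z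
    rw [← sum_b0 cc vs kk hvs p (fun l k => Db l (fun z => G (io e z) j k) z)]
    simp only [Finset.sum_apply]
    refine Finset.sum_congr rfl fun i _ => Finset.sum_congr rfl fun k _ => ?_
    rw [multipole_symb he]
    rfl
  have h1 : Ty (d - 1 + p) 1 J (fun _ z => U (io e z) j -
      (∑ i ∈ Finset.Icc (d + 1) p, uCf U i (io e z)) j) := by
    by_cases hp : p ≤ d
    · rw [Finset.Icc_eq_empty (by omega)]
      refine ((hw j J).mono (b := d - 1 + p) (by omega) le_rfl le_rfl).congr fun _ z => ?_
      simp [hU]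
    · refine Ty.of_finsupp (f := fun z => U (io e z) j -
        (∑ i ∈ Finset.Icc (d + 1) p, uCf U i (io e z)) j)
        ((finite_enorm_lt e 1).subset fun z hz => ?_) _ _ _
      by_contra hz'
      have hz2 : 1 ≤ enorm (io e z) := not_lt.1 hz'
      apply hz
      have : ∑ i ∈ Finset.Icc (d + 1) p, uCf U i (io e z) = U (io e z) := by
        rw [Finset.sum_eq_single (d + 1)]
        · exact uCf_eqOn U hz2
        · intro i _ hi; rw [uCf_ne U hi]
        · intro hn; exact absurd (Finset.mem_Icc.2 ⟨le_rfl, by omega⟩) hn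
      show _ - _ = (0 : ℝ)
      rw [this, sub_self]
  have h2 : Ty (d - 1 + p) 1 J (fun _ z => ∑ a, if (vs a).length ≤ p then 0 else
      cc a * Db (vs a) (fun z => G (io e z) j (kk a)) z) := by
    refine Ty.sum fun a _ => ?_
    by_cases ha : (vs a).length ≤ p
    · simp only [ha, if_true]
      exact (Ty.of_finsupp (f := fun _ : ZZ d => (0 : ℝ)) (by simp) _ _ _)
    · simp only [ha, if_false]
      refine Ty.const_mul _ ?_
      obtain ⟨v, l, hl⟩ := List.exists_cons_of_ne_nil
        (show vs a ≠ [] by intro h0; have := hvs a; simp [h0] at this)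
      have hlen : (vs a).length = l.length + 1 := by rw [hl]; simp
      have := hG.dl (eb v) (l.map eb) j (kk a) J
      rw [List.length_map] at this
      refine (this.mono (b := d - 1 + p) (by omega) (by omega : 0 ≤ 1) le_rfl).congr fun _ z => ?_
      rw [hl]
      rfl
  refine ((hr j).add (h1.add h2)).congr fun _ z => ?_
  have h3 : ∑ a, cc a * Db (vs a) (fun z => G (io e z) j (kk a)) z =
      (∑ a, if (vs a).length ≤ p then cc a * Db (vs a) (fun z => G (io e z) j (kk a)) z else 0) +
      ∑ a, if (vs a).length ≤ p then 0 else
      cc a * Db (vs a) (fun z => G (io e z) j (kk a)) z := by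
    rw [← Finset.sum_add_distrib]
    refine Finset.sum_congr rfl fun a _ => ?_
    split_ifs <;> simp
  have h4 := hU z j
  simp only [Pi.sub_apply]
  rw [hm z]
  linarith

end

/-- Theorem: far-field expansion for point defects. -/
theorem point_defect_far_field_expansion
    (d : ℕ) (hd : 2 ≤ d)
    (A : Matrix (Fin d) (Fin d) ℝ) (hA : IsUnit A.det)
    (R : Finset (Vec d)) (hR0 : (0 : Vec d) ∉ R)
    (hRlat : ∀ ρ ∈ R, ρ ∈ Lattice d A)
    (hRsym : ∀ ρ ∈ R, -ρ ∈ R)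
    (hRspan : ∀ x ∈ Lattice d A, ∃ c : Vec d → ℤ, x = ∑ ρ ∈ R, (c ρ : ℝ) • ρ)
    (p J K : ℕ) (hK : J + 2 + (p - 1) / d ≤ K)
    (V : ({x // x ∈ R} → Vec d) → ℝ)
    (hV : ContDiff ℝ (K : ℕ∞) V)
    (hVsym : PointSym R hRsym V)
    (hstab : IsStable d d A R (CofV R V))
    (G : Vec d → Fin d → Fin d → ℝ) (hG : IsLatticeGreen d d A R (CofV R V) G)
    (g : Vec d → {x // x ∈ R} → Vec d)
    (hgsupp : ∃ rad : ℝ, ∀ z : Fin d → ℤ, rad ≤ enorm (latticePt d A z) →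
      ∀ ρ : {x // x ∈ R}, g (latticePt d A z) ρ = 0)
    (ubar : Vec d → Vec d) (hubar : InH1 A R ubar)
    (hequil : ∀ v : Vec d → Vec d, InHc A R v →
      (∑' z : Fin d → ℤ, deltaEsite R V ubar v (latticePt d A z)) =
        ∑' z : Fin d → ℤ, ∑ ρ ∈ R.attach,
          dotV (g (latticePt d A z) ρ) (D1 (ρ : Vec d) v (latticePt d A z)))
    (s : Fin d → Vec d) (hslat : ∀ i, s i ∈ Lattice d A)
    (hsind : LinearIndependent ℝ s)
    (hsspan : ∀ x ∈ Lattice d A, ∃ z : Fin d → ℤ, x = ∑ i, (z i : ℝ) • s i) :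
    ∃ (rad : ℝ) (uC : ℕ → Vec d → Vec d)
      (b : (i : ℕ) → Fin d → (Fin i → Fin d) → ℝ),
      0 < rad ∧
      (∀ i : ℕ, ContDiffOn ℝ (⊤ : ℕ∞) (uC i) {x : Vec d | rad ≤ enorm x}) ∧
      (∀ (i : ℕ) (x : Vec d), enorm x < rad → uC i x = 0) ∧
      (∀ i j : ℕ, ∃ Cij : ℝ, ∀ x : Vec d, rad ≤ enorm x →
        ‖iteratedFDerivWithin ℝ j (uC i) {y : Vec d | rad ≤ enorm y} x‖ ≤
          Cij * ang x ^ ((2 : ℝ) - d - i - j) * Real.log (ang x) ^ i) ∧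
      (∀ (i : ℕ) (k : Fin d), SymArr (b i k)) ∧
      (∀ j : ℕ, 1 ≤ j → j ≤ J → ∃ Cj : ℝ, ∀ z : Fin d → ℤ,
        DnormJ R j
          (fun ℓ => ubar ℓ - ∑ i ∈ Finset.Icc (d + 1) p, uC i ℓ -
            ∑ i ∈ Finset.Icc 1 p, ∑ k : Fin d,
              multipole d d s i (b i k) (col G k) ℓ)
          (latticePt d A z) ≤
          Cj * ang (latticePt d A z) ^ ((1 : ℝ) - d - j - p) *
            Real.log (ang (latticePt d A z)) ^ (p + 1)) := by
  rcases Nat.eq_zero_or_pos J with hJ | hJ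
  · subst hJ
    refine ⟨1, fun _ _ => 0, fun _ _ _ => 0, one_pos, fun i => contDiffOn_const,
      fun _ _ _ => rfl, fun i j => ⟨0, fun x _ => ?_⟩, fun _ _ _ _ => rfl,
      fun j h1 h2 => absurd (h1.trans h2) (by omega)⟩
    have : iteratedFDerivWithin ℝ j (fun _ : Vec d => (0 : Vec d)) {y : Vec d | 1 ≤ enorm y} = 0 :=
      iteratedFDerivWithin_zero_fun
    rw [this]
    simp
  obtain ⟨e, τ, he⟩ := exists_crd hA s hslat hsind hsspan
  obtain ⟨σ, hσ, hcl⟩ := he.exists_dir R hRlat hRspan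
  have hV' : ContDiff ℝ ((J - 1 + (p - 1) / d + 3 : ℕ)) V := hV.of_le (by
    have : J - 1 + (p - 1) / d + 3 ≤ K := by omega
    exact WithTop.coe_le_coe.2 (Nat.cast_le.2 this))
  obtain ⟨f, P⟩ := prob_build he hd hσ hcl hV' hG g hgsupp ubar hubar hequil
  have hp : p ≤ d * ((p - 1) / d) + d := by
    have h1 := Nat.div_add_mod (p - 1) d
    have h2 := Nat.mod_lt (p - 1) (show d > 0 by omega)
    omega
  obtain ⟨c, h, ⟨κ, hκ, cc, vs, kk, hvs, hw⟩, hr⟩ := P.expand hd (J - 1) ((p - 1) / d) p le_rfl hp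
  obtain ⟨U, hU1, hU2, hU3⟩ := exists_uC e hd hw
  refine ⟨1, uCf U, fun i k => symb (b0 cc vs kk i k), one_pos, uCf_contDiff hU1, ?_,
    uCf_bound hU1 hU3, fun i k => symb_sym _, fun j hj hjJ => ?_⟩
  · intro i x hx
    simp [uCf, not_le.2 hx]
  · refine he.final_bound hd hσ c hj hjJ fun k => ?_
    rw [show J - 1 + 1 = J by omega] at hr
    exact remainder_ty he hd P.green ubar hr (fun a => (hvs a).1) hw hU2 k

end Defect
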